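/- arXiv:1102.5358 — 8 statements merged into one kernel-verified Lean document; each statement's English description precedes it below -/
import Mathlib

section
/- Let (X,d) be a compact metric space, μ a Borel probability measure on X, and T : X → X an invertible bi-measurable measure-preserving transformation that is ergodic with respect to μ. Suppose there are an increasing sequence (q_n) of natural numbers, Borel sets Ξ_n ⊆ X and δ > 0 with μ(Ξ_n) → δ, μ(Ξ_n Δ T⁻¹Ξ_n) → 0, and sup_{x∈Ξ_n} d(x, T^{q_n} x) → 0. Let φ : X → ℝ be Borel measurable and integrable with ∫_X φ dμ = 0, and assume the sequence (∫_{Ξ_n} |φ^{(q_n)}(x)| dμ(x))_{n∈ℕ} is bounded. If there exists c with 0 < c < δ such that for all sufficiently large positive integers k one has limsup_{n→∞} |∫_{Ξ_n} e^{2πi k φ^{(q_n)}(x)} dμ(x)| ≤ c, then the skew product T_φ : X × ℝ → X × ℝ, T_φ(x,y) = (T x, y + φ(x)), is ergodic with respect to the product of μ with Lebesgue measure on ℝ. -/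
open MeasureTheory Set Filter

lemma hilb_aux {E : Type*} [NormedAddCommGroup E] [InnerProductSpace ℝ E] [CompleteSpace E]
    (U : E →ₗᵢ[ℝ] E) (g : E) (hg : ∀ f, U f = f → inner ℝ f g = 0) (w : ℕ → E)
    (hw : ∀ n, ‖w n‖ ≤ 1) (hU : Tendsto (fun n => ‖w n - U (w n)‖) atTop (nhds 0)) :
    Tendsto (fun n => inner ℝ (w n) g) atTop (nhds 0) := by
  let R : Submodule ℝ E := LinearMap.range (U.toLinearMap - LinearMap.id)
  have hcl : g ∈ closure (R : Set E) := by
    have h1 : g ∈ Rᗮᗮ := by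
      rw [Submodule.mem_orthogonal]
      intro f hf
      apply hg
      rw [Submodule.mem_orthogonal'] at hf
      have h2 : inner ℝ f (U f - f) = 0 := hf _ ⟨f, by simp⟩
      rw [inner_sub_right, real_inner_self_eq_norm_sq] at h2
      have h3 : ‖U f - f‖ ^ 2 = 0 := by
        rw [norm_sub_sq_real, real_inner_comm, U.norm_map]
        linarith
      have h4 : U f - f = 0 := by simpa using h3
      exact sub_eq_zero.mp h4
    rw [Submodule.orthogonal_orthogonal_eq_closure] at h1
    exact h1
  rw [Metric.tendsto_atTop]
  intro ε hε
  obtain ⟨r, ⟨h, rfl⟩, hr⟩ := Metric.mem_closure_iff.mp hcl (ε/2) (by positivity)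
  have hlim : Tendsto (fun n => ‖w n - U (w n)‖ * ‖h‖) atTop (nhds 0) := by
    simpa using hU.mul_const ‖h‖
  obtain ⟨N, hN⟩ := (Metric.tendsto_atTop.mp hlim) (ε/2) (by positivity)
  refine ⟨N, fun n hn => ?_⟩
  have h5 := hN n hn
  simp only [Real.dist_eq, sub_zero] at h5 ⊢
  have e1 : inner ℝ (w n) g = inner ℝ (w n) (g - (U h - h)) + inner ℝ (w n - U (w n)) (U h) := by
    rw [inner_sub_right, inner_sub_left, inner_sub_right, U.inner_map_map]
    ring
  have e2 : |inner ℝ (w n) (g - (U h - h))| ≤ ‖g - (U h - h)‖ := by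
    refine (abs_real_inner_le_norm _ _).trans ?_
    have := mul_le_mul_of_nonneg_right (hw n) (norm_nonneg (g - (U h - h)))
    linarith
  have e3 : |inner ℝ (w n - U (w n)) (U h)| ≤ ‖w n - U (w n)‖ * ‖h‖ := by
    refine (abs_real_inner_le_norm _ _).trans ?_
    rw [U.norm_map]
  have e4 : ‖g - (U h - h)‖ < ε / 2 := by
    simpa [dist_eq_norm] using hr
  rw [e1]
  have := abs_add_le (inner ℝ (w n) (g - (U h - h))) (inner ℝ (w n - U (w n)) (U h))
  have := le_abs_self (‖w n - U (w n)‖ * ‖h‖)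
  linarith

lemma erg_aux {X : Type*} [MeasurableSpace X] (μ : Measure X) [IsProbabilityMeasure μ]
    (T : X → X) (hT : Ergodic T μ) (G : X → ℝ) (hG : Measurable G) (M : ℝ) (hM : ∀ x, |G x| ≤ M)
    (u : ℕ → X → ℝ) (hu : ∀ n, Measurable (u n)) (h0 : ∀ n x, 0 ≤ u n x) (h1 : ∀ n x, u n x ≤ 1)
    (hinv : Tendsto (fun n => ∫ x, |u n x - u n (T x)| ∂μ) atTop (nhds 0)) :
    Tendsto (fun n => (∫ x, u n x * G x ∂μ) - (∫ x, u n x ∂μ) * ∫ x, G x ∂μ) atTop (nhds 0) := by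
  have hTm := hT.toMeasurePreserving
  have hul : ∀ n, MemLp (u n) 2 μ := fun n =>
    MemLp.of_bound (hu n).aestronglyMeasurable 1 (ae_of_all _ fun x => by
      rw [Real.norm_eq_abs, abs_of_nonneg (h0 n x)]; exact h1 n x)
  set I := ∫ x, G x ∂μ with hI
  have hGl : MemLp (fun x => G x - I) 2 μ :=
    (MemLp.of_bound hG.aestronglyMeasurable M (ae_of_all _ fun x => by
      rw [Real.norm_eq_abs]; exact hM x)).sub (memLp_const I)
  have hGint : Integrable G μ := 
    Integrable.of_bound hG.aestronglyMeasurable M (ae_of_all _ fun x => by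
      rw [Real.norm_eq_abs]; exact hM x)
  have huint : ∀ n, Integrable (u n) μ := fun n => (hul n).integrable (by norm_num)
  let U := Lp.compMeasurePreservingₗᵢ ℝ (E := ℝ) (p := 2) T hTm
  have key := hilb_aux U (hGl.toLp _) ?_ (fun n => (hul n).toLp _) ?_ ?_
  · refine key.congr fun n => ?_
    rw [L2.inner_def]
    have : ∫ a, inner ℝ (((hul n).toLp _ : Lp ℝ 2 μ) a) ((hGl.toLp _ : Lp ℝ 2 μ) a) ∂μ
        = ∫ a, (u n a * G a - u n a * I) ∂μ := by
      apply integral_congr_ae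
      filter_upwards [(hul n).coeFn_toLp, hGl.coeFn_toLp] with a ha hb
      rw [ha, hb]
      simp; ring
    rw [this, integral_sub, integral_mul_const]
    · exact hGint.bdd_mul (c := 1) (hu n).aestronglyMeasurable (ae_of_all _ fun x => by
        rw [Real.norm_eq_abs, abs_of_nonneg (h0 n x)]; exact h1 n x)
    · exact (huint n).mul_const _
  · intro f hf
    have h2 : (f : X → ℝ) ∘ T =ᵐ[μ] f := by
      have := Lp.coeFn_compMeasurePreserving f hTm
      have h3 : Lp.compMeasurePreserving T hTm f = f := hf
      rw [h3] at this
      exact this.symm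
    obtain ⟨k, hk⟩ := hT.ae_eq_const_of_ae_eq_comp_ae (Lp.aestronglyMeasurable f) h2
    rw [L2.inner_def]
    have : ∫ a, inner ℝ ((f : X → ℝ) a) ((hGl.toLp _ : Lp ℝ 2 μ) a) ∂μ
        = ∫ a, (k * (G a - I)) ∂μ := by
      apply integral_congr_ae
      filter_upwards [hk, hGl.coeFn_toLp] with a ha hb
      rw [ha, hb]
      simp; ring
    rw [this, integral_const_mul, integral_sub hGint (integrable_const _)]
    simp [hI]
  · intro n
    rw [← sq_le_one_iff₀ (norm_nonneg _), ← real_inner_self_eq_norm_sq, L2.inner_def]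
    calc ∫ a, inner ℝ (((hul n).toLp _ : Lp ℝ 2 μ) a) (((hul n).toLp _ : Lp ℝ 2 μ) a) ∂μ
       = ∫ a, u n a * u n a ∂μ := by
          apply integral_congr_ae
          filter_upwards [(hul n).coeFn_toLp] with a ha
          rw [ha]; simp [sq]
      _ ≤ ∫ a, (1:ℝ) ∂μ := by
          apply integral_mono_of_nonneg (ae_of_all _ fun x => mul_nonneg (h0 n x) (h0 n x))
            (integrable_const _) (ae_of_all _ fun x => mul_le_one₀ (h1 n x) (h0 n x) (h1 n x))
      _ = 1 := by simp
  · have hsq : Tendsto (fun n => Real.sqrt (∫ x, |u n x - u n (T x)| ∂μ)) atTop (nhds 0) := by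
      simpa using hinv.sqrt
    refine squeeze_zero (fun n => norm_nonneg _) (fun n => ?_) hsq
    apply Real.le_sqrt_of_sq_le
    rw [← real_inner_self_eq_norm_sq, L2.inner_def]
    have hUn : (U ((hul n).toLp _) : X → ℝ) =ᵐ[μ] u n ∘ T := by
      have := Lp.coeFn_compMeasurePreserving ((hul n).toLp (u n)) hTm
      exact this.trans (hTm.quasiMeasurePreserving.ae_eq_comp (hul n).coeFn_toLp)
    have habs : ∀ x, |u n x - u n (T x)| ≤ 1 := fun x => by
      rw [abs_le]; constructor <;> linarith [h0 n x, h1 n x, h0 n (T x), h1 n (T x)]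
    calc _ = ∫ a, |u n a - u n (T a)| * |u n a - u n (T a)| ∂μ := by
          apply integral_congr_ae
          filter_upwards [(hul n).coeFn_toLp, hUn, Lp.coeFn_sub ((hul n).toLp (u n)) (U ((hul n).toLp _))] with a ha hb hc
          rw [hc]
          simp only [Pi.sub_apply]
          rw [ha, hb]; simp [sq]
      _ ≤ _ := by
          apply integral_mono_of_nonneg (ae_of_all _ fun x => by positivity)
          · apply Integrable.abs
            exact (huint n).sub ((hTm.integrable_comp (hu n).aestronglyMeasurable).mpr (huint n))
          · exact ae_of_all _ fun x => mul_le_of_le_one_right (abs_nonneg _) (habs x)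

lemma rig_aux {X : Type*} [MetricSpace X] [CompactSpace X] [MeasurableSpace X] [BorelSpace X]
    (μ : Measure X) [IsProbabilityMeasure μ] (T : X → X)
    (hT : MeasurePreserving T μ μ)
    (q : ℕ → ℕ) (Ξ : ℕ → Set X) (hΞ : ∀ n, MeasurableSet (Ξ n))
    (hΞd : Tendsto (fun n => ⨆ x ∈ Ξ n, dist x (T^[q n] x)) atTop (nhds 0))
    (F : X → ℝ) (hF : Integrable F μ) :
    Tendsto (fun n => ∫ x in Ξ n, |F (T^[q n] x) - F x| ∂μ) atTop (nhds 0) := by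
  have hd : ∀ n, ∀ x ∈ Ξ n, dist x (T^[q n] x) ≤ ⨆ x ∈ Ξ n, dist x (T^[q n] x) := by
    intro n x hx
    have hb : BddAbove (range fun x => ⨆ (_ : x ∈ Ξ n), dist x (T^[q n] x)) := by
      refine ⟨Metric.diam (univ : Set X), ?_⟩
      rintro _ ⟨z, rfl⟩
      by_cases hz : z ∈ Ξ n
      · simp only [hz, ciSup_unique]
        exact Metric.dist_le_diam_of_mem isCompact_univ.isBounded (mem_univ _) (mem_univ _)
      · simp only [hz, Real.iSup_of_isEmpty]
        exact Metric.diam_nonneg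
    refine le_trans ?_ (le_ciSup hb x)
    simp [hx]
  rw [Metric.tendsto_atTop]
  intro ε hε
  obtain ⟨h, hh, hhi⟩ := hF.exists_boundedContinuous_integral_sub_le (ε := ε / 4) (by positivity)
  have huc : UniformContinuous h := CompactSpace.uniformContinuous_of_continuous h.continuous
  obtain ⟨r, hr, hrr⟩ := Metric.uniformContinuous_iff.mp huc (ε/4) (by positivity)
  obtain ⟨N, hN⟩ := (Metric.tendsto_atTop.mp hΞd) r hr
  refine ⟨N, fun n hn => ?_⟩
  have h1 := hN n hn
  rw [Real.dist_eq, sub_zero] at h1 ⊢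
  have hTq := hT.iterate (q n)
  have hint : Integrable (fun x => |F x - h x|) μ := (hF.sub hhi).abs
  have hint2 : Integrable (fun x => |F (T^[q n] x) - h (T^[q n] x)|) μ := 
    (hTq.integrable_comp hint.aestronglyMeasurable).mpr hint
  rw [abs_of_nonneg (integral_nonneg fun x => abs_nonneg _)]
  have hh' : ∫ x, |F x - h x| ∂μ ≤ ε / 4 := hh
  have hh2 : ∫ x, |F (T^[q n] x) - h (T^[q n] x)| ∂μ ≤ ε / 4 := by
    have hm := integral_map hTq.measurable.aemeasurable
      (f := fun x => |F x - h x|) (by rw [hTq.map_eq]; exact hint.aestronglyMeasurable)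
    rw [hTq.map_eq] at hm
    rw [← hm]; exact hh'
  have hsum : Integrable (fun x => |F (T^[q n] x) - h (T^[q n] x)| + |F x - h x|) μ :=
    hint2.add hint
  calc ∫ x in Ξ n, |F (T^[q n] x) - F x| ∂μ 
      ≤ ∫ x in Ξ n, (|F (T^[q n] x) - h (T^[q n] x)| + |F x - h x| + ε / 4) ∂μ := by
        apply integral_mono_of_nonneg (ae_of_all _ fun x => abs_nonneg _)
        · exact (hsum.add (integrable_const _)).integrableOn
        · filter_upwards [ae_restrict_mem (hΞ n)] with x hx
          have h2 := hrr (((hd n x hx).trans (le_abs_self _)).trans_lt h1)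
          rw [Real.dist_eq] at h2
          rw [abs_sub_comm] at h2
          have e : F (T^[q n] x) - F x = (F (T^[q n] x) - h (T^[q n] x)) + (h (T^[q n] x) - h x) - (F x - h x) := by ring
          rw [e]
          have := abs_sub ((F (T^[q n] x) - h (T^[q n] x)) + (h (T^[q n] x) - h x)) (F x - h x)
          have := abs_add_le (F (T^[q n] x) - h (T^[q n] x)) (h (T^[q n] x) - h x)
          linarith
    _ ≤ ∫ x, (|F (T^[q n] x) - h (T^[q n] x)| + |F x - h x| + ε / 4) ∂μ := by
        apply setIntegral_le_integral (hsum.add (integrable_const _))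
        exact ae_of_all _ fun x => add_nonneg (add_nonneg (abs_nonneg _) (abs_nonneg _)) (by positivity)
    _ < ε := by
        rw [integral_add hsum (integrable_const _), integral_add hint2 hint]
        simp
        linarith

lemma key_aux {X : Type*} [MetricSpace X] [CompactSpace X] [MeasurableSpace X] [BorelSpace X]
    (μ : Measure X) [IsProbabilityMeasure μ] (T : X → X)
    (hT : Ergodic T μ)
    (q : ℕ → ℕ) (Ξ : ℕ → Set X) (hΞ : ∀ n, MeasurableSet (Ξ n))
    (hΞT : Tendsto (fun n => μ (symmDiff (Ξ n) (T ⁻¹' Ξ n))) atTop (nhds 0))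
    (hΞd : Tendsto (fun n => ⨆ x ∈ Ξ n, dist x (T^[q n] x)) atTop (nhds 0))
    (φ : X → ℝ) (hφmeas : Measurable φ) (hφint : Integrable φ μ)
    (g : X → ℝ → ℝ) (hgm : ∀ y, Measurable fun x => g x y) (M : ℝ) (hM : ∀ x y, |g x y| ≤ M)
    (L : ℝ) (hL : 0 < L) (hgL : ∀ x y y', |g x y - g x y'| ≤ L * |y - y'|)
    (hginv : ∀ᵐ x ∂μ, ∀ y, g x y = g (T x) (y + φ x))
    (t y : ℝ) (hpos : 0 < ∫ x, |g x y - g x (y + t)| ∂μ) :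
    ∃ ε > 0, Tendsto (fun n => μ.real (Ξ n ∩ {x | |(∑ i ∈ Finset.range (q n), φ (T^[i] x)) - t| < ε}))
      atTop (nhds 0) := by
  have hTm := hT.toMeasurePreserving
  set η := ∫ x, |g x y - g x (y + t)| ∂μ with hη
  set S : ℕ → X → ℝ := fun n x => ∑ i ∈ Finset.range (q n), φ (T^[i] x) with hS
  have hSm : ∀ n, Measurable (S n) := fun n =>
    Finset.measurable_sum _ fun i _ => hφmeas.comp (hTm.measurable.iterate i)
  have hST : ∀ n x, S n (T x) - S n x = φ (T^[q n] x) - φ x := by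
    intro n x
    simp only [hS, ← Function.iterate_succ_apply]
    rw [← Finset.sum_sub_distrib, Finset.sum_range_sub (fun i => φ (T^[i] x))]
    simp
  have hit : ∀ᵐ x ∂μ, ∀ n y, g x y = g (T^[n] x) (y + ∑ i ∈ Finset.range n, φ (T^[i] x)) := by
    have h1 : ∀ᵐ x ∂μ, ∀ n : ℕ, ∀ y, g (T^[n] x) y = g (T (T^[n] x)) (y + φ (T^[n] x)) :=
      ae_all_iff.2 fun n => (hTm.iterate n).quasiMeasurePreserving.ae hginv
    filter_upwards [h1] with x hx n
    induction n with
    | zero => intro y; simp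
    | succ n ih =>
      intro y
      rw [ih y, hx n, Finset.sum_range_succ, Function.iterate_succ_apply', add_assoc]
  set ε := η / (4 * L) with hε
  have hεpos : 0 < ε := by positivity
  refine ⟨ε, hεpos, ?_⟩
  let ψ : ℝ → ℝ := fun s => max 0 (1 - |s - t| / (2 * ε))
  have hψ0 : ∀ s, 0 ≤ ψ s := fun s => le_max_left _ _
  have hψ1 : ∀ s, ψ s ≤ 1 := fun s => max_le zero_le_one (by
    have : 0 ≤ |s - t| / (2 * ε) := by positivity
    linarith)
  have hψL : ∀ s s', |ψ s - ψ s'| ≤ (2 * ε)⁻¹ * |s - s'| := by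
    intro s s'
    refine (abs_max_sub_max_le_max _ _ _ _).trans ?_
    have e : 1 - |s - t| / (2 * ε) - (1 - |s' - t| / (2 * ε)) = (2 * ε)⁻¹ * (|s' - t| - |s - t|) := by
      field_simp; ring
    rw [e, abs_mul, abs_of_pos (by positivity : 0 < (2 * ε)⁻¹), sub_self, abs_zero]
    apply max_le (by positivity)
    refine mul_le_mul_of_nonneg_left ?_ (by positivity)
    refine (abs_abs_sub_abs_le (s' - t) (s - t)).trans ?_
    rw [abs_sub_comm s s']
    apply le_of_eq; congr 1; ring
  have hψm : Measurable ψ := by fun_prop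
  let u : ℕ → X → ℝ := fun n => (Ξ n).indicator fun x => ψ (S n x)
  have hum : ∀ n, Measurable (u n) := fun n => (hψm.comp (hSm n)).indicator (hΞ n)
  have hu0 : ∀ n x, 0 ≤ u n x := fun n x => indicator_nonneg (fun x _ => hψ0 _) x
  have hu1 : ∀ n x, u n x ≤ 1 := fun n x => by
    by_cases hx : x ∈ Ξ n
    · simp only [u, indicator_of_mem hx]; exact hψ1 _
    · simp only [u, indicator_of_notMem hx]; exact zero_le_one
  have huint : ∀ n, Integrable (u n) μ := fun n =>
    Integrable.of_bound (hum n).aestronglyMeasurable 1 (ae_of_all _ fun x => by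
      rw [Real.norm_eq_abs, abs_of_nonneg (hu0 n x)]; exact hu1 n x)
  have hφq : ∀ n, Integrable (fun x => |φ (T^[q n] x) - φ x|) μ := fun n =>
    ((((hTm.iterate (q n)).integrable_comp hφint.aestronglyMeasurable).mpr hφint).sub hφint).abs
  have hTΞ : ∀ n, MeasurableSet (symmDiff (Ξ n) (T ⁻¹' Ξ n)) := fun n =>
    (hΞ n).symmDiff (hTm.measurable (hΞ n))
  have hinv : Tendsto (fun n => ∫ x, |u n x - u n (T x)| ∂μ) atTop (nhds 0) := by
    have l1 : Tendsto (fun n => μ.real (symmDiff (Ξ n) (T ⁻¹' Ξ n)) +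
        (2 * ε)⁻¹ * ∫ x in Ξ n, |φ (T^[q n] x) - φ x| ∂μ) atTop (nhds 0) := by
      have a1 : Tendsto (fun n => μ.real (symmDiff (Ξ n) (T ⁻¹' Ξ n))) atTop (nhds 0) := by
        exact (ENNReal.tendsto_toReal ENNReal.zero_ne_top).comp hΞT
      have a2 := rig_aux μ T hTm q Ξ hΞ hΞd φ hφint
      simpa using a1.add (a2.const_mul (2 * ε)⁻¹)
    refine squeeze_zero (fun n => integral_nonneg fun x => abs_nonneg _) (fun n => ?_) l1
    have i1 : Integrable ((symmDiff (Ξ n) (T ⁻¹' Ξ n)).indicator fun _ => (1:ℝ)) μ :=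
      (integrable_const _).indicator (hTΞ n)
    have i2 : Integrable (fun x => (2 * ε)⁻¹ * (Ξ n).indicator (fun x => |φ (T^[q n] x) - φ x|) x) μ :=
      ((hφq n).indicator (hΞ n)).const_mul _
    calc ∫ x, |u n x - u n (T x)| ∂μ ≤ ∫ x, ((symmDiff (Ξ n) (T ⁻¹' Ξ n)).indicator (fun _ => (1:ℝ)) x
          + (2 * ε)⁻¹ * (Ξ n).indicator (fun x => |φ (T^[q n] x) - φ x|) x) ∂μ := by
          apply integral_mono_of_nonneg (ae_of_all _ fun x => abs_nonneg _) (i1.add i2)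
          refine ae_of_all _ fun x => ?_
          have hI : 0 ≤ (Ξ n).indicator (fun x => |φ (T^[q n] x) - φ x|) x :=
            indicator_nonneg (fun x _ => abs_nonneg _) x
          have hI2 : 0 ≤ (2 * ε)⁻¹ * (Ξ n).indicator (fun x => |φ (T^[q n] x) - φ x|) x := by
            positivity
          by_cases hx : x ∈ symmDiff (Ξ n) (T ⁻¹' Ξ n)
          · simp only [Pi.add_apply, indicator_of_mem hx]
            have : |u n x - u n (T x)| ≤ 1 := by
              rw [abs_le]
              constructor <;> linarith [hu0 n x, hu1 n x, hu0 n (T x), hu1 n (T x)]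
            linarith
          · simp only [Pi.add_apply, indicator_of_notMem hx, zero_add]
            by_cases hx1 : x ∈ Ξ n
            · have hx2 : T x ∈ Ξ n := by
                by_contra h
                exact hx (Or.inl ⟨hx1, h⟩)
              simp only [u, indicator_of_mem hx1, indicator_of_mem hx2]
              refine (hψL _ _).trans ?_
              rw [abs_sub_comm, hST]
            · have hx2 : T x ∉ Ξ n := by
                intro h
                exact hx (Or.inr ⟨h, hx1⟩)
              simp [u, hx1, hx2]
      _ = _ := by
          rw [integral_add i1 i2, integral_const_mul, integral_indicator (hΞ n),
            integral_indicator (hTΞ n)]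
          simp
  have hGm : Measurable fun x => |g x y - g x (y + t)| := ((hgm y).sub (hgm (y + t))).abs
  have herg := erg_aux μ T hT (fun x => |g x y - g x (y + t)|) hGm (2 * M) (fun x => by
    rw [abs_abs]
    have := abs_sub (g x y) (g x (y + t))
    linarith [hM x y, hM x (y + t)]) u hum hu0 hu1 hinv
  have hgi : ∀ y, Integrable (fun x => g x y) μ := fun y =>
    Integrable.of_bound (hgm y).aestronglyMeasurable M (ae_of_all _ fun x => hM x y)
  have hrig := rig_aux μ T hTm q Ξ hΞ hΞd (fun x => g x (y + t)) (hgi _)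
  have hmn : ∀ n, ∫ x, u n x * |g x y - g x (y + t)| ∂μ ≤ (η / 2) * (∫ x, u n x ∂μ) +
      ∫ x in Ξ n, |g (T^[q n] x) (y + t) - g x (y + t)| ∂μ := by
    intro n
    have i2 : Integrable (fun x => (Ξ n).indicator (fun x => |g (T^[q n] x) (y + t) - g x (y + t)|) x) μ :=
      (((((hTm.iterate (q n)).integrable_comp (hgi (y+t)).aestronglyMeasurable).mpr
        (hgi _)).sub (hgi _)).abs).indicator (hΞ n)
    rw [← integral_const_mul, ← integral_indicator (hΞ n), ← integral_add ((huint n).const_mul _) i2]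
    apply integral_mono_of_nonneg
      (ae_of_all _ fun x => mul_nonneg (hu0 n x) (abs_nonneg _)) (((huint n).const_mul _).add i2)
    filter_upwards [hit] with x hx
    by_cases hx1 : x ∈ Ξ n
    · simp only [Pi.add_apply, indicator_of_mem hx1]
      have hx2 := hx (q n) y
      change g x y = g _ (y + S n x) at hx2
      by_cases hx3 : |S n x - t| < 2 * ε
      · have b1 : |g x y - g x (y + t)| ≤ η / 2 + |g (T^[q n] x) (y + t) - g x (y + t)| := by
          have b2 := hgL (T^[q n] x) (y + S n x) (y + t)
          rw [← hx2] at b2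
          have b3 : L * |y + S n x - (y + t)| ≤ η / 2 := by
            rw [add_sub_add_left_eq_sub]
            calc L * |S n x - t| ≤ L * (2 * ε) := by gcongr
              _ = η / 2 := by rw [hε]; field_simp; ring
          have := abs_sub_le (g x y) (g (T^[q n] x) (y + t)) (g x (y + t))
          linarith
        calc u n x * |g x y - g x (y + t)| ≤ u n x * (η / 2 + |g (T^[q n] x) (y + t) - g x (y + t)|) :=
              mul_le_mul_of_nonneg_left b1 (hu0 n x)
          _ ≤ _ := by
              have := mul_le_of_le_one_left (abs_nonneg (g (T^[q n] x) (y + t) - g x (y + t))) (hu1 n x)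
              linarith
      · have : u n x = 0 := by
          simp only [u, indicator_of_mem hx1, ψ]
          apply max_eq_left
          have : 1 ≤ |S n x - t| / (2 * ε) := by
            rw [le_div_iff₀ (by positivity)]; linarith
          linarith
        rw [this]; simp
    · simp [u, hx1]
  have hm : Tendsto (fun n => ∫ x, u n x ∂μ) atTop (nhds 0) := by
    have l2 : Tendsto (fun n => (2 / η) * ((∫ x in Ξ n, |g (T^[q n] x) (y + t) - g x (y + t)| ∂μ) -
      ((∫ x, u n x * |g x y - g x (y + t)| ∂μ) - (∫ x, u n x ∂μ) * η))) atTop (nhds 0) := by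
      simpa using (hrig.sub herg).const_mul (2 / η)
    refine squeeze_zero (fun n => integral_nonneg fun x => hu0 n x) (fun n => ?_) l2
    rw [div_mul_eq_mul_div, le_div_iff₀ hpos]
    linarith [hmn n]
  have hm2 : Tendsto (fun n => 2 * ∫ x, u n x ∂μ) atTop (nhds 0) := by simpa using hm.const_mul 2
  refine squeeze_zero (fun n => measureReal_nonneg) (fun n => ?_) hm2
  have hms : MeasurableSet (Ξ n ∩ {x | |S n x - t| < ε}) :=
    (hΞ n).inter (measurableSet_lt ((hSm n).sub_const t).abs measurable_const)
  rw [← integral_const_mul]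
  calc μ.real (Ξ n ∩ {x | |S n x - t| < ε})
      = ∫ x, (Ξ n ∩ {x | |S n x - t| < ε}).indicator (fun _ => (1:ℝ)) x ∂μ := by
        rw [integral_indicator hms]; simp
    _ ≤ _ := by
      apply integral_mono ((integrable_const _).indicator hms) ((huint n).const_mul _)
      intro x
      by_cases hx : x ∈ Ξ n ∩ {x | |S n x - t| < ε}
      · simp only [indicator_of_mem hx, u, indicator_of_mem hx.1]
        have hx2 : |S n x - t| < ε := hx.2
        have : |S n x - t| / (2 * ε) ≤ 1 / 2 := by
          rw [div_le_iff₀ (by positivity)]; linarith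
        have := le_max_right 0 (1 - |S n x - t| / (2 * ε))
        simp only [ψ]
        linarith
      · simp only [indicator_of_notMem hx]
        linarith [hu0 n x]

lemma dioph_aux (H : AddSubgroup ℝ) (a : ℝ) (ha : H = AddSubgroup.closure {a}) (R ε : ℝ) (hR : 0 < R)
    (hε : 0 < ε) (K : ℕ) : ∃ k : ℕ, K ≤ k ∧ ∀ t ∈ H, |t| ≤ R →
      ‖Complex.exp (2 * (Real.pi : ℂ) * Complex.I * (k : ℂ) * (t : ℂ)) - 1‖ < ε := by
  by_cases h0 : a = 0
  · refine ⟨K, le_rfl, fun t ht _ => ?_⟩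
    subst h0
    have : t = 0 := by
      rw [ha, AddSubgroup.mem_closure_singleton] at ht
      obtain ⟨m, rfl⟩ := ht
      simp
    simpa [this] using hε
  have ha0 : 0 < |a| := abs_pos.mpr h0
  obtain ⟨N, hN⟩ := exists_nat_gt (2 * Real.pi * (R / |a|) / ε)
  have hNpos : 0 < N := by
    have : (0:ℝ) < N := lt_of_le_of_lt (by positivity) hN
    exact_mod_cast this
  obtain ⟨k, hk0, -, hk⟩ := Real.exists_nat_abs_mul_sub_round_le ((K : ℝ) * a) hNpos
  refine ⟨k * K, Nat.le_mul_of_pos_left _ hk0, fun t ht htR => ?_⟩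
  rw [ha, AddSubgroup.mem_closure_singleton] at ht
  obtain ⟨m, rfl⟩ := ht
  set j := round ((k : ℝ) * (K * a))
  set r := (k : ℝ) * (K * a) - j with hr
  have e : Complex.exp (2 * (Real.pi : ℂ) * Complex.I * ((k * K : ℕ) : ℂ) * ((m • a : ℝ) : ℂ))
     = Complex.exp (Complex.I * ((2 * Real.pi * (m * r) : ℝ) : ℂ)) := by
    rw [← Complex.exp_periodic.int_mul (m * j) (Complex.I * ((2 * Real.pi * (m * r) : ℝ) : ℂ))]
    congr 1
    rw [hr]
    push_cast [zsmul_eq_mul]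
    ring
  rw [e]
  refine (Real.norm_exp_I_mul_ofReal_sub_one_le).trans_lt ?_
  rw [Real.norm_eq_abs, abs_mul, abs_mul (m : ℝ), abs_of_pos (by positivity : 0 < 2 * Real.pi)]
  have hm : |(m:ℝ)| ≤ R / |a| := by
    rw [le_div_iff₀ ha0, ← abs_mul]
    simpa [zsmul_eq_mul] using htR
  rw [div_lt_iff₀ hε] at hN
  calc 2 * Real.pi * (|(m:ℝ)| * |r|) ≤ 2 * Real.pi * ((R / |a|) * (1 / (N + 1))) := by gcongr
    _ = 2 * Real.pi * (R / |a|) / (N + 1) := by ring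
    _ < ε := by
      rw [div_lt_iff₀ (by positivity)]
      linarith

lemma inv_aux {X : Type*} [MetricSpace X] [CompactSpace X] [MeasurableSpace X] [BorelSpace X]
    (μ : Measure X) [IsProbabilityMeasure μ] (T : X → X)
    (hT : Ergodic T μ)
    (q : ℕ → ℕ) (Ξ : ℕ → Set X) (hΞ : ∀ n, MeasurableSet (Ξ n))
    (δ : ℝ)
    (hΞδ : Tendsto (fun n => (μ (Ξ n)).toReal) atTop (nhds δ))
    (hΞT : Tendsto (fun n => μ (symmDiff (Ξ n) (T ⁻¹' Ξ n))) atTop (nhds 0))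
    (hΞd : Tendsto (fun n => ⨆ x ∈ Ξ n, dist x (T^[q n] x)) atTop (nhds 0))
    (φ : X → ℝ) (hφmeas : Measurable φ) (hφint : Integrable φ μ)
    (hbd : ∃ C : ℝ, ∀ n,
      (∫ x in Ξ n, |∑ i ∈ Finset.range (q n), φ (T^[i] x)| ∂μ) ≤ C)
    (c : ℝ) (hcδ : c < δ)
    (hosc : ∀ᶠ (k : ℕ) in atTop,
      Filter.limsup (fun n =>
        ‖∫ x in Ξ n, Complex.exp (2 * (Real.pi : ℂ) * Complex.I * (k : ℂ) *
          ((∑ i ∈ Finset.range (q n), φ (T^[i] x) : ℝ) : ℂ)) ∂μ‖) atTop ≤ c)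
    (g : X → ℝ → ℝ) (hgm : ∀ y, Measurable fun x => g x y) (M : ℝ) (hM : ∀ x y, |g x y| ≤ M)
    (L : ℝ) (hL : 0 < L) (hgL : ∀ x y y', |g x y - g x y'| ≤ L * |y - y'|)
    (hginv : ∀ᵐ x ∂μ, ∀ y, g x y = g (T x) (y + φ x)) (t y : ℝ) :
    ∀ᵐ x ∂μ, g x (y + t) = g x y := by
  have hTm := hT.toMeasurePreserving
  have hgi : ∀ y, Integrable (fun x => g x y) μ := fun y =>
    Integrable.of_bound (hgm y).aestronglyMeasurable M (ae_of_all _ fun x => hM x y)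
  have hiff : ∀ t y, (∀ᵐ x ∂μ, g x (y + t) = g x y) ↔ ∫ x, |g x y - g x (y + t)| ∂μ = 0 := by
    intro t y
    have hi : Integrable (fun x => |g x y - g x (y + t)|) μ := ((hgi _).sub (hgi _)).abs
    rw [integral_eq_zero_iff_of_nonneg (fun x => abs_nonneg _) hi]
    apply eventually_congr
    refine ae_of_all _ fun x => ?_
    simp only [Pi.zero_apply, abs_eq_zero, sub_eq_zero]
    exact eq_comm
  let H : AddSubgroup ℝ :=
    { carrier := {t | ∀ y, ∀ᵐ x ∂μ, g x (y + t) = g x y}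
      zero_mem' := by intro y; simp
      add_mem' := by
        intro a b ha hb y
        filter_upwards [ha y, hb (y + a)] with x h1 h2
        rw [← add_assoc, h2, h1]
      neg_mem' := by
        intro a ha y
        filter_upwards [ha (y + -a)] with x h1
        rw [← h1]; simp }
  rcases H.dense_or_cyclic with hd | ⟨a, ha⟩
  · -- dense case
    rw [hiff]
    have hc : Continuous fun t => ∫ x, |g x y - g x (y + t)| ∂μ := by
      apply continuous_of_dominated (bound := fun _ => 2 * M)
      · intro t; exact ((hgm y).sub (hgm (y + t))).abs.aestronglyMeasurable
      · intro t
        refine ae_of_all _ fun x => ?_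
        rw [Real.norm_eq_abs, abs_abs]
        have := abs_sub (g x y) (g x (y + t))
        linarith [hM x y, hM x (y + t)]
      · exact integrable_const _
      · refine ae_of_all _ fun x => ?_
        have : Continuous (g x) := by
          refine (LipschitzWith.of_dist_le_mul (K := ⟨L, hL.le⟩) fun s s' => ?_).continuous
          exact hgL x s s'
        fun_prop
    have : (fun t => ∫ x, |g x y - g x (y + t)| ∂μ) = fun _ => 0 :=
      hc.ext_on hd continuous_const fun t ht => (hiff t y).mp (ht y)
    exact congrFun this t
  · exfalso
    obtain ⟨C, hC⟩ := hbd
    set S : ℕ → X → ℝ := fun n x => ∑ i ∈ Finset.range (q n), φ (T^[i] x) with hS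
    have hSm : ∀ n, Measurable (S n) := fun n =>
      Finset.measurable_sum _ fun i _ => hφmeas.comp (hTm.measurable.iterate i)
    have hSi : ∀ n, Integrable (S n) μ := fun n =>
      integrable_finsetSum _ fun i _ =>
        ((hTm.iterate i).integrable_comp hφint.aestronglyMeasurable).mpr hφint
    set ε := (δ - c) / 4 with hε
    have hεpos : 0 < ε := by rw [hε]; linarith
    obtain ⟨R, hR0, hRC⟩ : ∃ R : ℝ, 0 < R ∧ 2 / R * C ≤ ε := by
      refine ⟨2 * (|C| + 1) / ε, by positivity, ?_⟩
      have : 2 / (2 * (|C| + 1) / ε) * C = ε * (C / (|C| + 1)) := by field_simp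
      rw [this]
      have : C / (|C| + 1) ≤ 1 := by
        rw [div_le_one (by positivity)]; linarith [le_abs_self C]
      nlinarith
    obtain ⟨K, hK⟩ := eventually_atTop.mp hosc
    obtain ⟨k, hkK, hk⟩ := dioph_aux H a ha R ε hR0 hεpos K
    have hlim := hK k hkK
    let e : ℝ → ℂ := fun t => Complex.exp (2 * (Real.pi : ℂ) * Complex.I * (k : ℂ) * (t : ℂ))
    have hec : Continuous e := by fun_prop
    have he1 : ∀ t, ‖e t‖ = 1 := by
      intro t
      have : (2 * (Real.pi : ℂ) * Complex.I * (k : ℂ) * (t : ℂ)) = ((2 * Real.pi * k * t : ℝ) : ℂ) * Complex.I := by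
        push_cast; ring
      simp only [e]
      rw [this, Complex.norm_exp_ofReal_mul_I]
    let Q : Set ℝ := Icc (-R) R ∩ {t | ε ≤ ‖e t - 1‖}
    have hQ : IsCompact Q := isCompact_Icc.inter_right
      (isClosed_le continuous_const (hec.sub continuous_const).norm)
    have hQlim : Tendsto (fun n => μ.real (Ξ n ∩ {x | S n x ∈ Q})) atTop (nhds 0) := by
      refine hQ.induction_on (p := fun Q => Tendsto (fun n => μ.real (Ξ n ∩ {x | S n x ∈ Q})) atTop (nhds 0))
        ?_ ?_ ?_ ?_
      · simp
      · intro s s' hss h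
        refine squeeze_zero (fun n => measureReal_nonneg) (fun n => ?_) h
        exact measureReal_mono (fun x hx => ⟨hx.1, hss hx.2⟩)
      · intro s s' h h'
        refine squeeze_zero (fun n => measureReal_nonneg) (fun n => ?_) (by simpa using h.add h')
        refine (measureReal_mono ?_).trans (measureReal_union_le _ _)
        rintro x ⟨hx, hx' | hx'⟩
        · exact Or.inl ⟨hx, hx'⟩
        · exact Or.inr ⟨hx, hx'⟩
      · intro t ht
        have htH : t ∉ H := fun h => by
          have := hk t h (abs_le.mpr ht.1)
          exact absurd ht.2 (not_le.mpr this)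
        have : ∃ y, ¬ (∀ᵐ x ∂μ, g x (y + t) = g x y) := by
          by_contra hcon
          push Not at hcon
          exact htH hcon
        obtain ⟨y, hy⟩ := this
        rw [hiff] at hy
        have hpos : 0 < ∫ x, |g x y - g x (y + t)| ∂μ :=
          lt_of_le_of_ne (integral_nonneg fun x => abs_nonneg _) (Ne.symm hy)
        obtain ⟨r, hr, hlim⟩ := key_aux μ T hT q Ξ hΞ hΞT hΞd φ hφmeas hφint g hgm M hM L hL hgL hginv t y hpos
        exact ⟨Metric.ball t r, mem_nhdsWithin_of_mem_nhds (Metric.ball_mem_nhds t hr), hlim⟩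
    have hein : ∀ n, Integrable (fun x => e (S n x)) μ := fun n =>
      Integrable.of_bound (hec.measurable.comp (hSm n)).aestronglyMeasurable 1 (ae_of_all _ fun x => (he1 _).le)
    have hQm : ∀ n, MeasurableSet {x | S n x ∈ Q} := fun n => hSm n hQ.measurableSet
    have hbound : ∀ n, μ.real (Ξ n) - 2 * ε - 2 * μ.real (Ξ n ∩ {x | S n x ∈ Q}) ≤
        ‖∫ x in Ξ n, e (S n x) ∂μ‖ := by
      intro n
      have i1 : Integrable (fun _ : X => ε) (μ.restrict (Ξ n)) := integrable_const _
      have i2 : Integrable (fun x => 2 * {x | S n x ∈ Q}.indicator (fun _ => (1:ℝ)) x) (μ.restrict (Ξ n)) :=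
        ((integrable_const _).indicator (hQm n)).const_mul _
      have i3 : Integrable (fun x => 2 / R * |S n x|) (μ.restrict (Ξ n)) :=
        ((hSi n).abs.const_mul _).integrableOn
      have i12 : Integrable (fun x => ε + 2 * {x | S n x ∈ Q}.indicator (fun _ => (1:ℝ)) x)
        (μ.restrict (Ξ n)) := i1.add i2
      have b1 : ‖∫ x in Ξ n, (e (S n x) - 1) ∂μ‖ ≤ ∫ x in Ξ n, (ε + 2 * {x | S n x ∈ Q}.indicator (fun _ => (1:ℝ)) x
          + 2 / R * |S n x|) ∂μ := by
        apply norm_integral_le_of_norm_le (i12.add i3)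
        refine ae_of_all _ fun x => ?_
        have c2 : ‖e (S n x) - 1‖ ≤ 2 := by
          refine (norm_sub_le _ _).trans ?_
          rw [he1]; norm_num
        have c3 : 0 ≤ 2 / R * |S n x| := by positivity
        by_cases h1 : S n x ∈ Q
        · have : x ∈ {x | S n x ∈ Q} := h1
          simp only [Pi.add_apply, indicator_of_mem this]
          linarith
        · have : x ∉ {x | S n x ∈ Q} := h1
          simp only [Pi.add_apply, indicator_of_notMem this]
          by_cases h2 : |S n x| ≤ R
          · have : ‖e (S n x) - 1‖ < ε := by
              by_contra h3
              exact h1 ⟨abs_le.mp h2, not_lt.mp h3⟩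
            linarith
          · have : 2 ≤ 2 / R * |S n x| := by
              rw [div_mul_eq_mul_div, le_div_iff₀ hR0]
              linarith
            linarith
      rw [integral_add i12 i3, integral_add i1 i2, integral_const_mul, integral_const_mul,
        integral_indicator (hQm n), integral_sub (hein n).integrableOn (integrable_const _)] at b1
      simp only [integral_const, MeasurableSet.univ, measureReal_restrict_apply, univ_inter, smul_eq_mul,
        mul_one, measureReal_restrict_apply (hQm n), Measure.restrict_restrict (hQm n)] at b1
      have hC' : ∫ x in Ξ n, |S n x| ∂μ ≤ C := hC n
      have hC2 : 2 / R * ∫ x in Ξ n, |S n x| ∂μ ≤ ε :=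
        le_trans (mul_le_mul_of_nonneg_left hC' (by positivity)) hRC
      have h1 : μ.real (Ξ n) * ε ≤ ε := by
        have : μ.real (Ξ n) ≤ 1 := measureReal_le_one
        nlinarith
      have h2 : μ.real (Ξ n) ≤ ‖∫ x in Ξ n, e (S n x) ∂μ‖ + ‖(∫ x in Ξ n, e (S n x) ∂μ) - μ.real (Ξ n) • (1:ℂ)‖ := by
        have := norm_sub_norm_le (μ.real (Ξ n) • (1:ℂ)) (∫ x in Ξ n, e (S n x) ∂μ)
        rw [norm_sub_rev] at this
        have h4 : ‖μ.real (Ξ n) • (1:ℂ)‖ = μ.real (Ξ n) := by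
          rw [norm_smul]; simp
        linarith
      rw [inter_comm] at b1
      linarith
    have hb : Tendsto (fun n => μ.real (Ξ n) - 2 * ε - 2 * μ.real (Ξ n ∩ {x | S n x ∈ Q})) atTop
        (nhds (δ - 2 * ε)) := by
      have : Tendsto (fun n => μ.real (Ξ n)) atTop (nhds δ) := hΞδ
      simpa using (this.sub_const (2 * ε)).sub (hQlim.const_mul 2)
    have hev : ∀ᶠ n in atTop, c + ε ≤ ‖∫ x in Ξ n, e (S n x) ∂μ‖ := by
      have : c + ε < δ - 2 * ε := by rw [hε]; linarith
      filter_upwards [hb.eventually_const_lt this] with n hn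
      exact hn.le.trans (hbound n)
    have := le_limsup_of_frequently_le hev.frequently (by
      refine isBoundedUnder_of ⟨1, fun n => ?_⟩
      refine (norm_integral_le_of_norm_le_const (C := 1) (ae_of_all _ fun x => (he1 _).le)).trans ?_
      simp [measureReal_le_one])
    have h5 : c + ε ≤ c := this.trans hlim
    linarith

lemma fibre_aux (B : Set ℝ) (hB : MeasurableSet B)
    (h : ∀ r : ℚ, 0 < r → ∀ y : ℝ, (volume (B ∩ Ioo y (y + r))).toReal = (volume (B ∩ Ioo 0 (0 + (r:ℝ)))).toReal) :
    volume B = 0 ∨ volume Bᶜ = 0 := by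
  have hfin : ∀ a b : ℝ, volume (B ∩ Ioo a b) ≠ ⊤ := fun a b =>
    ne_top_of_le_ne_top (by simp [Real.volume_Ioo]) (measure_mono inter_subset_right)
  set ν := (volume : Measure ℝ).restrict B with hν
  have hinv : ν.IsAddLeftInvariant := by
    refine ⟨fun t => ?_⟩
    symm
    apply Real.measure_ext_Ioo_rat
    intro a b
    rw [Measure.map_apply (measurable_const_add t) measurableSet_Ioo]
    have e : (fun x => t + x) ⁻¹' Ioo (a:ℝ) b = Ioo ((a:ℝ) - t) (b - t) := by
      ext x; simp only [mem_preimage, mem_Ioo]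
      constructor <;> rintro ⟨h1, h2⟩ <;> constructor <;> linarith
    rw [e, hν, Measure.restrict_apply measurableSet_Ioo, Measure.restrict_apply measurableSet_Ioo]
    rcases le_or_gt b a with hab | hab
    · have hab' : (b:ℝ) ≤ a := by exact_mod_cast hab
      rw [Ioo_eq_empty (by linarith), Ioo_eq_empty (by linarith)]
    · have h1 := h (b - a) (sub_pos.mpr hab) a
      have h2 := h (b - a) (sub_pos.mpr hab) (a - t)
      have e1 : (a:ℝ) + ((b - a : ℚ) : ℝ) = b := by push_cast; ring
      have e2 : (a:ℝ) - t + ((b - a : ℚ) : ℝ) = b - t := by push_cast; ring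
      rw [e1] at h1
      rw [e2] at h2
      rw [inter_comm _ B, inter_comm _ B]
      exact (ENNReal.toReal_eq_toReal_iff' (hfin _ _) (hfin _ _)).mp (h1.trans h2.symm)
  have hs := Measure.isAddLeftInvariant_eq_smul ν volume
  set k := Measure.addHaarScalarFactor ν volume
  have h0 : ν Bᶜ = 0 := by rw [hν, Measure.restrict_apply hB.compl]; simp
  rw [hs, Measure.smul_apply] at h0
  by_cases hk : k = 0
  · left
    have h1 : ν B = volume B := by rw [hν, Measure.restrict_apply hB, inter_self]
    rw [← h1, hs, hk]; simp
  · right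
    rcases smul_eq_zero.mp h0 with h | h
    · exact absurd h hk
    · exact h

lemma lip_aux (B : Set ℝ) (h : ℝ) (y y' : ℝ) :
    |(volume (B ∩ Ioo y (y + h))).toReal - (volume (B ∩ Ioo y' (y' + h))).toReal| ≤ 1 * |y - y'| := by
  have hfin : ∀ a b : ℝ, volume (B ∩ Ioo a b) ≠ ⊤ := fun a b =>
    ne_top_of_le_ne_top (by simp [Real.volume_Ioo]) (measure_mono inter_subset_right)
  have key : ∀ y y' : ℝ, volume.real (B ∩ Ioo y (y + h)) ≤ volume.real (B ∩ Ioo y' (y' + h)) + |y - y'| := by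
    intro y y'
    have hsub : B ∩ Ioo y (y + h) ⊆ (B ∩ Ioo y' (y' + h)) ∪ (Icc y y' ∪ Icc (y' + h) (y + h)) := by
      rintro x ⟨hx, h1, h2⟩
      by_cases a1 : y' < x
      · by_cases a2 : x < y' + h
        · exact Or.inl ⟨hx, a1, a2⟩
        · exact Or.inr (Or.inr ⟨not_lt.mp a2, h2.le⟩)
      · exact Or.inr (Or.inl ⟨h1.le, not_lt.mp a1⟩)
    have hf2 : volume ((B ∩ Ioo y' (y' + h)) ∪ (Icc y y' ∪ Icc (y' + h) (y + h))) ≠ ⊤ := by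
      refine ne_top_of_le_ne_top ?_ (measure_union_le _ _)
      refine ENNReal.add_ne_top.mpr ⟨hfin _ _, ?_⟩
      refine ne_top_of_le_ne_top ?_ (measure_union_le _ _)
      simp [Real.volume_Icc]
    refine (measureReal_mono hsub hf2).trans ((measureReal_union_le _ _).trans ?_)
    gcongr
    refine (measureReal_union_le _ _).trans ?_
    rw [Real.volume_real_Icc, Real.volume_real_Icc]
    rcases le_total y y' with hle | hle
    · rw [max_eq_left (by linarith), max_eq_right (by linarith), abs_of_nonpos (by linarith)]; linarith
    · rw [max_eq_right (by linarith), max_eq_left (by linarith), abs_of_nonneg (by linarith)]; linarith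
  have k1 := key y y'
  have k2 := key y' y
  rw [abs_sub_comm y' y] at k2
  simp only [Measure.real] at k1 k2
  rw [abs_le]; constructor <;> linarith

theorem stmt0
    {X : Type*} [MetricSpace X] [CompactSpace X] [MeasurableSpace X] [BorelSpace X]
    (μ : Measure X) [IsProbabilityMeasure μ]
    (T S : X → X) (hTmeas : Measurable T) (hSmeas : Measurable S)
    (hST : Function.LeftInverse S T) (hTS : Function.RightInverse S T)
    (hTpres : MeasurePreserving T μ μ)
    (hTerg : ∀ A : Set X, MeasurableSet A →
      μ (symmDiff A (T ⁻¹' A)) = 0 → μ A = 0 ∨ μ Aᶜ = 0)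
    (q : ℕ → ℕ) (hq : StrictMono q)
    (Ξ : ℕ → Set X) (hΞ : ∀ n, MeasurableSet (Ξ n))
    (δ : ℝ) (hδ : 0 < δ)
    (hΞδ : Tendsto (fun n => (μ (Ξ n)).toReal) atTop (nhds δ))
    (hΞT : Tendsto (fun n => μ (symmDiff (Ξ n) (T ⁻¹' Ξ n))) atTop (nhds 0))
    (hΞd : Tendsto (fun n => ⨆ x ∈ Ξ n, dist x (T^[q n] x)) atTop (nhds 0))
    (φ : X → ℝ) (hφmeas : Measurable φ) (hφint : Integrable φ μ)
    (hφ0 : (∫ x, φ x ∂μ) = 0)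
    (hbd : ∃ C : ℝ, ∀ n,
      (∫ x in Ξ n, |∑ i ∈ Finset.range (q n), φ (T^[i] x)| ∂μ) ≤ C)
    (c : ℝ) (hc0 : 0 < c) (hcδ : c < δ)
    (hosc : ∀ᶠ (k : ℕ) in atTop,
      Filter.limsup (fun n =>
        ‖∫ x in Ξ n, Complex.exp (2 * (Real.pi : ℂ) * Complex.I * (k : ℂ) *
          ((∑ i ∈ Finset.range (q n), φ (T^[i] x) : ℝ) : ℂ)) ∂μ‖) atTop ≤ c) :
    ∀ A : Set (X × ℝ), MeasurableSet A →
      (μ.prod (volume : Measure ℝ))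
          (symmDiff A ((fun p : X × ℝ => (T p.1, p.2 + φ p.1)) ⁻¹' A)) = 0 →
      (μ.prod (volume : Measure ℝ)) A = 0 ∨
      (μ.prod (volume : Measure ℝ)) Aᶜ = 0 := by
  intro A hA hAinv
  have hT : Ergodic T μ := by
    refine { toMeasurePreserving := hTpres, aeconst_set := fun s hs hs' => ?_ }
    rw [eventuallyConst_set']
    rcases hTerg s hs (by rw [hs']; simp) with h | h
    · left; exact ae_eq_empty.mpr h
    · right; exact ae_eq_univ.mpr h
  let F : X → Set ℝ := fun x => Prod.mk x ⁻¹' A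
  have hF : ∀ x, MeasurableSet (F x) := fun x => measurable_prodMk_left hA
  have hfib : ∀ᵐ x ∂μ, (F x : Set ℝ) =ᵐ[volume] (fun y => y + φ x) ⁻¹' (F (T x)) := by
    have h1 := Measure.ae_ae_of_ae_prod (show ∀ᵐ p ∂(μ.prod (volume : Measure ℝ)), p ∉ symmDiff A ((fun p : X × ℝ => (T p.1, p.2 + φ p.1)) ⁻¹' A) from measure_eq_zero_iff_ae_notMem.mp hAinv)
    filter_upwards [h1] with x hx
    rw [← measure_symmDiff_eq_zero_iff, measure_eq_zero_iff_ae_notMem]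
    exact hx
  let g : ℝ → X → ℝ → ℝ := fun h x y => (volume (F x ∩ Ioo y (y + h))).toReal
  have hgconst : ∀ h : ℝ, ∀ t y, ∀ᵐ x ∂μ, g h x (y + t) = g h x y := by
    intro h
    refine inv_aux μ T hT q Ξ hΞ δ hΞδ hΞT hΞd φ hφmeas hφint hbd c hcδ hosc (g h) ?_ |h| ?_ 1 one_pos
      (fun x y y' => lip_aux _ _ _ _) ?_
    · intro y
      have : MeasurableSet (A ∩ (univ ×ˢ Ioo y (y + h))) :=
        hA.inter (MeasurableSet.univ.prod measurableSet_Ioo)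
      have h2 := (measurable_measure_prodMk_left (ν := (volume : Measure ℝ)) this).ennreal_toReal
      convert h2 using 4
      ext z; simp [F]
    · intro x y
      rw [abs_of_nonneg ENNReal.toReal_nonneg]
      refine (ENNReal.toReal_mono (by simp [Real.volume_Ioo]) (measure_mono inter_subset_right)).trans ?_
      rw [Real.volume_Ioo, ENNReal.toReal_ofReal']
      exact max_le (by linarith [le_abs_self h]) (abs_nonneg h)
    · filter_upwards [hfib] with x hx y
      simp only [g]
      congr 1
      rw [← measure_preimage_add_right volume (φ x) (F (T x) ∩ Ioo (y + φ x) (y + φ x + h))]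
      have e : (fun z => z + φ x) ⁻¹' Ioo (y + φ x) (y + φ x + h) = Ioo y (y + h) := by
        ext z; simp only [mem_preimage, mem_Ioo]
        constructor <;> rintro ⟨h1, h2⟩ <;> constructor <;> linarith
      rw [preimage_inter, e]
      exact measure_congr (hx.inter (ae_eq_refl _))
  have hdich : ∀ᵐ x ∂μ, volume (F x) = 0 ∨ volume (F x)ᶜ = 0 := by
    have h1 : ∀ᵐ x ∂μ, ∀ r s : ℚ, g r x (0 + s) = g r x 0 :=
      ae_all_iff.2 fun r => ae_all_iff.2 fun s => hgconst r s 0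
    filter_upwards [h1] with x hx
    apply fibre_aux _ (hF x)
    intro r _ y
    have hc : Continuous (g r x) := by
      refine (LipschitzWith.of_dist_le_mul (K := 1) fun s s' => ?_).continuous
      exact lip_aux _ _ _ _
    have : g r x = fun _ => g r x 0 := by
      refine hc.ext_on Rat.denseRange_cast continuous_const ?_
      rintro _ ⟨s, rfl⟩
      have := hx r s
      rwa [zero_add] at this
    exact congrFun this y
  let B : Set X := {x | volume (F x) = 0}
  have hBm : MeasurableSet B :=
    measurable_measure_prodMk_left (ν := (volume : Measure ℝ)) hA (measurableSet_singleton 0)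
  have hBinv : μ (symmDiff B (T ⁻¹' B)) = 0 := by
    rw [measure_symmDiff_eq_zero_iff]
    filter_upwards [hfib] with x hx
    apply propext
    change volume (F x) = 0 ↔ volume (F (T x)) = 0
    rw [measure_congr hx, measure_preimage_add_right]
  rcases hTerg B hBm hBinv with h | h
  · right
    rw [Measure.measure_prod_null hA.compl]
    filter_upwards [hdich, measure_eq_zero_iff_ae_notMem.mp h] with x h1 h2
    rcases h1 with h1 | h1
    · exact absurd h1 h2
    · exact h1
  · left
    rw [Measure.measure_prod_null hA]
    filter_upwards [measure_eq_zero_iff_ae_notMem.mp h] with x h2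
    exact not_not.mp h2
end

section
/- Let x₀ < x₂ be real numbers and Λ, V ≥ 0. Let ψ : (x₀,x₂) → ℝ be a function admitting a function ψ′ : (x₀,x₂) → ℝ, integrable on every compact subinterval of (x₀,x₂), such that ψ(b) − ψ(a) = ∫_a^b ψ′(x) dx whenever x₀ < a ≤ b < x₂, and |ψ′(x)|·min(x−x₀, x₂−x) ≤ Λ for almost every x ∈ (x₀,x₂). Let g : [x₀,x₂] → ℝ have total variation at most V, and set φ = ψ + g, assumed Lebesgue-integrable on (x₀,x₂). Then for all a, b with x₀ ≤ a < b ≤ x₂: (i) |m(φ,(a,b)) − m(φ,(x₀,x₂))| ≤ (Λ+V)·(4 + (x₂−x₀)/(b−a)), and (ii) (1/(b−a)) ∫_a^b |φ(x) − m(φ,(a,b))| dx ≤ 8(Λ+V). -/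
open MeasureTheory Set

lemma aux_left (ψ ψ' : ℝ → ℝ) (Λ a x c : ℝ) (hax : a < x) (hxc : x ≤ c)
    (hftc : ψ c - ψ x = ∫ t in x..c, ψ' t)
    (hb : ∀ᵐ t ∂(volume : Measure ℝ), t ∈ Ioc x c → |ψ' t| * (t - a) ≤ Λ) :
    |ψ x - ψ c| ≤ Λ * (Real.log (c - a) - Real.log (x - a)) := by
  have hne : ∀ t ∈ uIcc x c, t - a ≠ 0 := by
    intro t ht
    rw [uIcc_of_le hxc] at ht
    linarith [ht.1]
  have hii : IntervalIntegrable (fun t => Λ * (t - a)⁻¹) volume x c := by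
    apply ContinuousOn.intervalIntegrable
    exact continuousOn_const.mul (ContinuousOn.inv₀ (by fun_prop) hne)
  have h1 := intervalIntegral.norm_integral_le_of_norm_le (f := ψ') hxc (by
    filter_upwards [hb] with t ht hm
    have h0 : 0 < t - a := by linarith [hm.1]
    rw [Real.norm_eq_abs, ← div_eq_mul_inv, le_div_iff₀ h0]
    exact ht hm) hii
  rw [← hftc, Real.norm_eq_abs, abs_sub_comm] at h1
  refine h1.trans (le_of_eq ?_)
  rw [intervalIntegral.integral_const_mul, intervalIntegral.integral_comp_sub_right (fun t => t⁻¹) a,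
    integral_inv_of_pos (by linarith) (by linarith), Real.log_div (by linarith) (by linarith)]

lemma aux_right (ψ ψ' : ℝ → ℝ) (Λ b x c : ℝ) (hax : x < b) (hxc : c ≤ x)
    (hftc : ψ x - ψ c = ∫ t in c..x, ψ' t)
    (hb : ∀ᵐ t ∂(volume : Measure ℝ), t ∈ Ioc c x → |ψ' t| * (b - t) ≤ Λ) :
    |ψ x - ψ c| ≤ Λ * (Real.log (b - c) - Real.log (b - x)) := by
  have hne : ∀ t ∈ uIcc c x, b - t ≠ 0 := by
    intro t ht
    rw [uIcc_of_le hxc] at ht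
    linarith [ht.2]
  have hii : IntervalIntegrable (fun t => Λ * (b - t)⁻¹) volume c x := by
    apply ContinuousOn.intervalIntegrable
    exact continuousOn_const.mul (ContinuousOn.inv₀ (by fun_prop) hne)
  have h1 := intervalIntegral.norm_integral_le_of_norm_le (f := ψ') hxc (by
    filter_upwards [hb] with t ht hm
    have h0 : 0 < b - t := by linarith [hm.2]
    rw [Real.norm_eq_abs, ← div_eq_mul_inv, le_div_iff₀ h0]
    exact ht hm) hii
  rw [← hftc, Real.norm_eq_abs] at h1
  refine h1.trans (le_of_eq ?_)
  rw [intervalIntegral.integral_const_mul, intervalIntegral.integral_comp_sub_left (fun t => t⁻¹) b,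
    integral_inv_of_pos (by linarith) (by linarith), Real.log_div (by linarith) (by linarith)]

lemma aux_key
    (x₀ x₂ : ℝ) (Λ V : ℝ) (hV : 0 ≤ V)
    (ψ ψ' g : ℝ → ℝ)
    (hftc : ∀ a b : ℝ, x₀ < a → a ≤ b → b < x₂ →
      ψ b - ψ a = ∫ x in a..b, ψ' x)
    (hbound : ∀ᵐ x ∂(volume : Measure ℝ), x ∈ Ioo x₀ x₂ →
      |ψ' x| * min (x - x₀) (x₂ - x) ≤ Λ)
    (hg : eVariationOn g (Icc x₀ x₂) ≤ ENNReal.ofReal V)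
    (hφint : IntegrableOn (fun x => ψ x + g x) (Ioo x₀ x₂) volume)
    (a b : ℝ) (ha : x₀ ≤ a) (hab : a < b) (hb : b ≤ x₂) (k : ℝ)
    (hk : k = ψ ((a + b) / 2) + g ((a + b) / 2)) :
    (∫ x in Ioo a b, |ψ x + g x - k|) ≤ (Λ + V) * (b - a) := by
  obtain ⟨c, hc⟩ : ∃ c, c = (a + b) / 2 := ⟨_, rfl⟩
  rw [← hc] at hk
  have hgV : ∀ x ∈ Icc x₀ x₂, |g x - g c| ≤ V := by
    intro x hx
    have h := (eVariationOn.edist_le g hx (y := c) ⟨by linarith, by linarith⟩).trans hg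
    rw [edist_dist, ENNReal.ofReal_le_ofReal_iff hV] at h
    exact h
  have hφ1 : IntegrableOn (fun x => |ψ x + g x - k|) (Ioo x₀ x₂) volume :=
    (hφint.sub (integrableOn_const (by simp))).abs
  have hφ : ∀ p q, x₀ ≤ p → p ≤ q → q ≤ x₂ →
      IntervalIntegrable (fun x => |ψ x + g x - k|) volume p q := by
    intro p q hp hpq hq
    rw [intervalIntegrable_iff_integrableOn_Ioo_of_le hpq]
    exact hφ1.mono_set (Ioo_subset_Ioo hp hq)
  rw [← integral_Ioc_eq_integral_Ioo, ← intervalIntegral.integral_of_le hab.le,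
    ← intervalIntegral.integral_add_adjacent_intervals
      (hφ a c ha (by linarith) (by linarith)) (hφ c b (by linarith) (by linarith) hb)]
  have L : (∫ x in a..c, |ψ x + g x - k|) ≤ (Λ + V) * (c - a) := by
    have hl : IntervalIntegrable (fun x => Real.log (x - a)) volume a c := by
      have := (intervalIntegral.intervalIntegrable_log' (a := 0) (b := c - a)).comp_sub_right a
      simpa using this
    have hl2 : IntervalIntegrable (fun x => Λ * (Real.log (c - a) - Real.log (x - a))) volume a c :=
      (intervalIntegrable_const.sub hl).const_mul _
    calc _ ≤ ∫ x in a..c, (Λ * (Real.log (c - a) - Real.log (x - a)) + V) := by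
          apply intervalIntegral.integral_mono_on_of_le_Ioo (by linarith)
            (hφ a c ha (by linarith) (by linarith)) (hl2.add intervalIntegrable_const)
          intro x hx
          have h1 := aux_left ψ ψ' Λ a x c hx.1 hx.2.le
            (hftc x c (by linarith [hx.1]) hx.2.le (by linarith)) (by
              filter_upwards [hbound] with t ht hm
              have h2 := ht ⟨by linarith [hm.1, hx.1], by linarith [hm.2]⟩
              refine le_trans (mul_le_mul_of_nonneg_left ?_ (abs_nonneg _)) h2
              exact le_min (by linarith) (by linarith [hm.2]))
          have h2 := hgV x ⟨by linarith [hx.1], by linarith [hx.2]⟩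
          have h3 := abs_add_le (ψ x - ψ c) (g x - g c)
          rw [hk, show ψ x + g x - (ψ c + g c) = ψ x - ψ c + (g x - g c) by ring]
          linarith
      _ = (Λ + V) * (c - a) := by
          rw [intervalIntegral.integral_add hl2 intervalIntegrable_const,
            intervalIntegral.integral_const_mul,
            intervalIntegral.integral_sub intervalIntegrable_const hl,
            intervalIntegral.integral_comp_sub_right Real.log a, integral_log]
          simp
          ring
  have R : (∫ x in c..b, |ψ x + g x - k|) ≤ (Λ + V) * (b - c) := by
    have hl : IntervalIntegrable (fun x => Real.log (b - x)) volume c b := by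
      have := (intervalIntegral.intervalIntegrable_log' (a := b - c) (b := 0)).comp_sub_left b
      simpa using this
    have hl2 : IntervalIntegrable (fun x => Λ * (Real.log (b - c) - Real.log (b - x))) volume c b :=
      (intervalIntegrable_const.sub hl).const_mul _
    calc _ ≤ ∫ x in c..b, (Λ * (Real.log (b - c) - Real.log (b - x)) + V) := by
          apply intervalIntegral.integral_mono_on_of_le_Ioo (by linarith)
            (hφ c b (by linarith) (by linarith) hb) (hl2.add intervalIntegrable_const)
          intro x hx
          have h1 := aux_right ψ ψ' Λ b x c hx.2 hx.1.le
            (hftc c x (by linarith) hx.1.le (by linarith [hx.2])) (by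
              filter_upwards [hbound] with t ht hm
              have h2 := ht ⟨by linarith [hm.1], by linarith [hm.2, hx.2]⟩
              refine le_trans (mul_le_mul_of_nonneg_left ?_ (abs_nonneg _)) h2
              exact le_min (by linarith [hm.1]) (by linarith))
          have h2 := hgV x ⟨by linarith [hx.1], by linarith [hx.2]⟩
          have h3 := abs_add_le (ψ x - ψ c) (g x - g c)
          rw [hk, show ψ x + g x - (ψ c + g c) = ψ x - ψ c + (g x - g c) by ring]
          linarith
      _ = (Λ + V) * (b - c) := by
          rw [intervalIntegral.integral_add hl2 intervalIntegrable_const,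
            intervalIntegral.integral_const_mul,
            intervalIntegral.integral_sub intervalIntegrable_const hl,
            intervalIntegral.integral_comp_sub_left Real.log b, integral_log]
          simp
          ring
  linarith

lemma aux_mean (f : ℝ → ℝ) (a b k : ℝ) (hab : a < b) (hf : IntegrableOn f (Ioo a b) volume) :
    |(b - a)⁻¹ * (∫ x in Ioo a b, f x) - k| ≤ (b - a)⁻¹ * ∫ x in Ioo a b, |f x - k| := by
  have h0 : 0 < b - a := by linarith
  have h1 : (b - a)⁻¹ * (∫ x in Ioo a b, f x) - k = (b - a)⁻¹ * ∫ x in Ioo a b, (f x - k) := by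
    rw [integral_sub hf (integrableOn_const (by simp))]
    simp [hab.le]
    field_simp
  rw [h1, abs_mul, abs_of_pos (inv_pos.2 h0)]
  exact mul_le_mul_of_nonneg_left abs_integral_le_integral_abs (inv_pos.2 h0).le

/-- The single-interval form of Proposition 2.9 of the paper: mean-value estimates for
`φ = ψ + g`, where `ψ` has a logarithmic-singularity bound `Λ` at the two endpoints and
`g` has total variation at most `V`. -/
theorem stmt1
    (x₀ x₂ : ℝ) (hx : x₀ < x₂) (Λ V : ℝ) (hΛ : 0 ≤ Λ) (hV : 0 ≤ V)
    (ψ ψ' g : ℝ → ℝ)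
    (hint : ∀ a b : ℝ, x₀ < a → a ≤ b → b < x₂ → IntervalIntegrable ψ' volume a b)
    (hftc : ∀ a b : ℝ, x₀ < a → a ≤ b → b < x₂ →
      ψ b - ψ a = ∫ x in a..b, ψ' x)
    (hbound : ∀ᵐ x ∂(volume : Measure ℝ), x ∈ Ioo x₀ x₂ →
      |ψ' x| * min (x - x₀) (x₂ - x) ≤ Λ)
    (hg : eVariationOn g (Icc x₀ x₂) ≤ ENNReal.ofReal V)
    (hφint : IntegrableOn (fun x => ψ x + g x) (Ioo x₀ x₂) volume) :
    ∀ a b : ℝ, x₀ ≤ a → a < b → b ≤ x₂ →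
      |(b - a)⁻¹ * (∫ x in Ioo a b, (ψ x + g x)) -
          (x₂ - x₀)⁻¹ * (∫ x in Ioo x₀ x₂, (ψ x + g x))| ≤
        (Λ + V) * (4 + (x₂ - x₀) / (b - a)) ∧
      (b - a)⁻¹ *
          (∫ x in Ioo a b,
            |(ψ x + g x) - (b - a)⁻¹ * (∫ y in Ioo a b, (ψ y + g y))|) ≤
        8 * (Λ + V) := by
  intro a b ha hab hb
  have h0 : 0 < b - a := by linarith
  have hL : 0 < x₂ - x₀ := by linarith
  have hi : IntegrableOn (fun x => ψ x + g x) (Ioo a b) volume :=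
    hφint.mono_set (Ioo_subset_Ioo ha hb)
  have hc : ∀ k : ℝ, IntegrableOn (fun _ : ℝ => k) (Ioo a b) volume :=
    fun k => integrableOn_const (by simp)
  constructor
  · obtain ⟨k, hk⟩ : ∃ k, k = ψ ((x₀ + x₂) / 2) + g ((x₀ + x₂) / 2) := ⟨_, rfl⟩
    have K := aux_key x₀ x₂ Λ V hV ψ ψ' g hftc hbound hg hφint x₀ x₂ le_rfl hx le_rfl k hk
    have m1 := aux_mean _ a b k hab hi
    have m2 := aux_mean _ x₀ x₂ k hx hφint
    have K2 : (∫ x in Ioo a b, |ψ x + g x - k|) ≤ ∫ x in Ioo x₀ x₂, |ψ x + g x - k| := by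
      apply setIntegral_mono_set
      · exact (hφint.sub (integrableOn_const (by simp))).abs
      · exact Filter.Eventually.of_forall fun x => abs_nonneg _
      · exact (Ioo_subset_Ioo ha hb).eventuallyLE
    have e1 := mul_le_mul_of_nonneg_left (K2.trans K) (inv_pos.2 h0).le
    have e2 := mul_le_mul_of_nonneg_left K (inv_pos.2 hL).le
    have e3 : (x₂ - x₀)⁻¹ * ((Λ + V) * (x₂ - x₀)) = Λ + V := by field_simp
    have e4 : (b - a)⁻¹ * ((Λ + V) * (x₂ - x₀)) = (Λ + V) * ((x₂ - x₀) / (b - a)) := by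
      field_simp
    have t := abs_sub_le ((b - a)⁻¹ * (∫ x in Ioo a b, (ψ x + g x))) k
      ((x₂ - x₀)⁻¹ * (∫ x in Ioo x₀ x₂, (ψ x + g x)))
    rw [abs_sub_comm k] at t
    rw [mul_add]
    linarith
  · obtain ⟨k, hk⟩ : ∃ k, k = ψ ((a + b) / 2) + g ((a + b) / 2) := ⟨_, rfl⟩
    have K := aux_key x₀ x₂ Λ V hV ψ ψ' g hftc hbound hg hφint a b ha hab hb k hk
    have m1 := aux_mean _ a b k hab hi
    have e1 := mul_le_mul_of_nonneg_left K (inv_pos.2 h0).le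
    have e3 : (b - a)⁻¹ * ((Λ + V) * (b - a)) = Λ + V := by field_simp
    generalize (b - a)⁻¹ * (∫ x in Ioo a b, (ψ x + g x)) = M at *
    have i1 : IntegrableOn (fun x => |ψ x + g x - k|) (Ioo a b) volume := (hi.sub (hc k)).abs
    have i2 : (∫ x in Ioo a b, |ψ x + g x - M|) ≤
        ∫ x in Ioo a b, (|ψ x + g x - k| + |M - k|) := by
      apply integral_mono (hi.sub (hc M)).abs (i1.add (hc _))
      intro x
      have := abs_sub_le (ψ x + g x) k M
      rw [abs_sub_comm k] at this
      exact this
    rw [integral_add i1 (hc _)] at i2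
    have i3 : (∫ x in Ioo a b, |M - k|) = (b - a) * |M - k| := by simp [hab.le]
    rw [i3] at i2
    have e4 := mul_le_mul_of_nonneg_left i2 (inv_pos.2 h0).le
    rw [mul_add, inv_mul_cancel_left₀ h0.ne'] at e4
    linarith
end

section
/- Let x₀ < x₁ be real numbers and C ≥ 0. Let f : (x₀,x₁] → ℝ be a function admitting a function f′ : (x₀,x₁] → ℝ, integrable on every compact subinterval of (x₀,x₁], such that f(b) − f(a) = ∫_a^b f′(x) dx whenever x₀ < a ≤ b ≤ x₁, and |f′(x)|·(x−x₀) ≤ C for almost every x ∈ (x₀,x₁]. Then for all a, b with x₀ < a < b ≤ x₁: (i) |m(f,(a,b)) − f(b)| ≤ 2C, and (ii) |f(b) − f(a)| ≤ C·(b−a)/(a−x₀). -/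
open MeasureTheory Set

/-- Lemma A.1 of the paper. -/
theorem stmt3
    (x₀ x₁ : ℝ) (hx : x₀ < x₁) (C : ℝ) (hC : 0 ≤ C)
    (f f' : ℝ → ℝ)
    (hint : ∀ a b : ℝ, x₀ < a → a ≤ b → b ≤ x₁ → IntervalIntegrable f' volume a b)
    (hftc : ∀ a b : ℝ, x₀ < a → a ≤ b → b ≤ x₁ →
      f b - f a = ∫ x in a..b, f' x)
    (hbound : ∀ᵐ x ∂(volume : Measure ℝ), x ∈ Ioc x₀ x₁ → |f' x| * (x - x₀) ≤ C) :
    ∀ a b : ℝ, x₀ < a → a < b → b ≤ x₁ →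
      |(b - a)⁻¹ * (∫ x in a..b, f x) - f b| ≤ 2 * C ∧
      |f b - f a| ≤ C * (b - a) / (a - x₀) := by
  have key : ∀ a b : ℝ, x₀ < a → a ≤ b → b ≤ x₁ →
      |f b - f a| ≤ C * (Real.log (b - x₀) - Real.log (a - x₀)) := by
    intro a b ha hab hb
    have hcont : ContinuousOn (fun t : ℝ => C * (t - x₀)⁻¹) (uIcc a b) := by
      rw [uIcc_of_le hab]
      apply ContinuousOn.mul continuousOn_const
      apply ContinuousOn.inv₀ (by fun_prop)
      intro t ht
      have := ht.1
      exact ne_of_gt (by linarith)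
    have h1 : ‖∫ t in a..b, f' t‖ ≤ ∫ t in a..b, C * (t - x₀)⁻¹ := by
      apply intervalIntegral.norm_integral_le_of_norm_le hab _ hcont.intervalIntegrable
      filter_upwards [hbound] with t ht hm
      have h0 : 0 < t - x₀ := by linarith [hm.1]
      have := ht ⟨by linarith [hm.1], hm.2.trans hb⟩
      rw [Real.norm_eq_abs, ← div_eq_mul_inv, le_div_iff₀ h0]
      exact this
    rw [hftc a b ha hab hb, ← Real.norm_eq_abs]
    refine h1.trans (le_of_eq ?_)
    rw [intervalIntegral.integral_const_mul,
      intervalIntegral.integral_comp_sub_right (fun t => t⁻¹) x₀,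
      integral_inv_of_pos (by linarith) (by linarith),
      Real.log_div (by linarith) (by linarith)]
  intro a b ha hab hb
  have hα : 0 < a - x₀ := by linarith
  have hβ : 0 < b - x₀ := by linarith
  have hba : 0 < b - a := by linarith
  constructor
  · have hfc : ContinuousOn f (uIcc a b) := by
      have h2 : ContinuousOn (fun x => f a + ∫ t in a..x, f' t) (uIcc a b) := by
        apply continuousOn_const.add
        apply intervalIntegral.continuousOn_primitive_interval
        have := hint a b ha hab.le hb
        rwa [intervalIntegrable_iff', ] at this
      refine h2.congr ?_
      intro x hx'
      rw [uIcc_of_le hab.le] at hx'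
      have := hftc a x ha hx'.1 (hx'.2.trans hb)
      simp only
      linarith
    have hlc : ContinuousOn (fun x : ℝ => Real.log (x - x₀)) (uIcc a b) := by
      rw [uIcc_of_le hab.le]
      apply ContinuousOn.log (by fun_prop)
      intro t ht
      have := ht.1
      exact ne_of_gt (by linarith)
    have h3 : ‖∫ x in a..b, (f x - f b)‖
        ≤ ∫ x in a..b, C * (Real.log (b - x₀) - Real.log (x - x₀)) := by
      apply intervalIntegral.norm_integral_le_of_norm_le hab.le
      · refine Filter.Eventually.of_forall fun x hx' => ?_
        rw [Real.norm_eq_abs, abs_sub_comm]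
        exact key x b (by linarith [hx'.1]) hx'.2 hb
      · exact (continuousOn_const.mul (continuousOn_const.sub hlc)).intervalIntegrable
    rw [intervalIntegral.integral_const_mul,
      intervalIntegral.integral_sub (by simp) hlc.intervalIntegrable,
      intervalIntegral.integral_comp_sub_right (fun t => Real.log t) x₀, integral_log,
      intervalIntegral.integral_sub hfc.intervalIntegrable (by simp)] at h3
    simp only [intervalIntegral.integral_const, smul_eq_mul, Real.norm_eq_abs] at h3
    have hlog : Real.log (a - x₀) ≤ Real.log (b - x₀) :=
      Real.log_le_log hα (by linarith)
    have h4 : |(∫ x in a..b, f x) - (b - a) * f b| ≤ C * (b - a) := by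
      refine h3.trans (mul_le_mul_of_nonneg_left ?_ hC)
      nlinarith [mul_nonneg hα.le (sub_nonneg.2 hlog)]
    have h5 : (b - a)⁻¹ * (∫ x in a..b, f x) - f b
        = (b - a)⁻¹ * ((∫ x in a..b, f x) - (b - a) * f b) := by
      field_simp
    rw [h5, abs_mul, abs_of_pos (inv_pos.2 hba), inv_mul_le_iff₀ hba]
    nlinarith [mul_nonneg hC hba.le]
  · refine (key a b ha hab.le hb).trans ?_
    rw [mul_div_assoc, ← Real.log_div hβ.ne' hα.ne']
    refine mul_le_mul_of_nonneg_left ?_ hC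
    refine (Real.log_le_sub_one_of_pos (div_pos hβ hα)).trans (le_of_eq ?_)
    field_simp
    ring
end

section
/- Let x₀ < x₁ be real numbers and C ≥ 0. Let f : (x₀,x₁] → ℝ be a function admitting a function f′ : (x₀,x₁] → ℝ, integrable on every compact subinterval of (x₀,x₁], such that f(b) − f(a) = ∫_a^b f′(x) dx whenever x₀ < a ≤ b ≤ x₁, and |f′(x)|·(x−x₀) ≤ C for almost every x ∈ (x₀,x₁]. Then for every b ∈ (x₀,x₁], f is Lebesgue-integrable on (x₀,b] and |(1/(b−x₀)) ∫_{x₀}^b f(x) dx − f(b)| ≤ C. -/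
open MeasureTheory Set

/-- The endpoint case `J = [x₀,b]` of Lemma A.1 of the paper. -/
theorem stmt4
    (x₀ x₁ : ℝ) (hx : x₀ < x₁) (C : ℝ) (hC : 0 ≤ C)
    (f f' : ℝ → ℝ)
    (hint : ∀ a b : ℝ, x₀ < a → a ≤ b → b ≤ x₁ → IntervalIntegrable f' volume a b)
    (hftc : ∀ a b : ℝ, x₀ < a → a ≤ b → b ≤ x₁ →
      f b - f a = ∫ x in a..b, f' x)
    (hbound : ∀ᵐ x ∂(volume : Measure ℝ), x ∈ Ioc x₀ x₁ → |f' x| * (x - x₀) ≤ C) :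
    ∀ b : ℝ, x₀ < b → b ≤ x₁ →
      IntegrableOn f (Ioc x₀ b) volume ∧
      |(b - x₀)⁻¹ * (∫ x in Ioc x₀ b, f x) - f b| ≤ C := by
  intro b hb hb1
  have key : ∀ x ∈ Ioc x₀ b, ‖f x - f b‖ ≤ C * (Real.log (b - x₀) - Real.log (x - x₀)) := by
    intro x hxm
    have hxp : 0 < x - x₀ := sub_pos.2 hxm.1
    have hbp : 0 < b - x₀ := sub_pos.2 hb
    rw [norm_sub_rev, hftc x b hxm.1 hxm.2 hb1]
    have hgi : IntervalIntegrable (fun t => C * (t - x₀)⁻¹) volume x b := by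
      apply ContinuousOn.intervalIntegrable
      rw [uIcc_of_le hxm.2]
      apply ContinuousOn.mul continuousOn_const
      apply ContinuousOn.inv₀ (by fun_prop)
      intro t ht
      have := ht.1
      have : 0 < t - x₀ := by linarith
      exact this.ne'
    have h1 := intervalIntegral.norm_integral_le_of_norm_le (f := f')
      (g := fun t => C * (t - x₀)⁻¹) hxm.2 (by
        filter_upwards [hbound] with t ht htm
        have h0 : 0 < t - x₀ := by linarith [htm.1]
        rw [Real.norm_eq_abs, ← div_eq_mul_inv, le_div_iff₀ h0]
        exact ht ⟨by linarith, htm.2.trans hb1⟩) hgi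
    refine h1.trans_eq ?_
    rw [intervalIntegral.integral_const_mul,
      intervalIntegral.integral_comp_sub_right (fun t => t⁻¹) x₀, integral_inv_of_pos hxp hbp,
      Real.log_div hbp.ne' hxp.ne']
  have hcont : ContinuousOn f (Ioc x₀ b) := by
    intro x hxm
    have ha0 : x₀ < (x₀ + x) / 2 := by linarith [hxm.1]
    have hax : (x₀ + x) / 2 < x := by linarith [hxm.1]
    set a := (x₀ + x) / 2
    have hab : a ≤ b := hax.le.trans hxm.2
    have hc : ContinuousOn (fun y => f a + ∫ t in a..y, f' t) (Icc a b) := by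
      apply ContinuousOn.add continuousOn_const
      have := intervalIntegral.continuousOn_primitive_interval'
        (hint a b ha0 hab hb1) left_mem_uIcc
      rwa [uIcc_of_le hab] at this
    have hc' : ContinuousOn f (Icc a b) := by
      refine hc.congr ?_
      intro y hy
      have := hftc a y ha0 hy.1 (hy.2.trans hb1)
      simp only
      linarith
    refine (hc' x ⟨hax.le, hxm.2⟩).mono_of_mem_nhdsWithin ?_
    filter_upwards [self_mem_nhdsWithin, mem_nhdsWithin_of_mem_nhds (Ioi_mem_nhds hax)] with y hy hy2
    exact ⟨le_of_lt hy2, hy.2⟩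
  have hlog : IntervalIntegrable (fun x => Real.log (x - x₀)) volume x₀ b := by
    have h := (intervalIntegral.intervalIntegrable_log' (a := 0) (b := b - x₀)).comp_sub_right x₀
    simpa using h
  have hgI : IntervalIntegrable (fun x => C * (Real.log (b - x₀) - Real.log (x - x₀))) volume x₀ b :=
    (intervalIntegrable_const.sub hlog).const_mul C
  have hgint : IntegrableOn (fun x => C * (Real.log (b - x₀) - Real.log (x - x₀))) (Ioc x₀ b) volume :=
    (intervalIntegrable_iff_integrableOn_Ioc_of_le hb.le).1 hgI
  have hgval : ∫ x in Ioc x₀ b, C * (Real.log (b - x₀) - Real.log (x - x₀)) = C * (b - x₀) := by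
    rw [← intervalIntegral.integral_of_le hb.le, intervalIntegral.integral_const_mul,
      intervalIntegral.integral_sub intervalIntegrable_const hlog,
      intervalIntegral.integral_comp_sub_right (fun t => Real.log t) x₀, integral_log]
    simp
  have hae : ∀ᵐ x ∂(volume.restrict (Ioc x₀ b)),
      ‖f x - f b‖ ≤ C * (Real.log (b - x₀) - Real.log (x - x₀)) :=
    (ae_restrict_iff' measurableSet_Ioc).2 (Filter.Eventually.of_forall key)
  have hcI : IntegrableOn (fun _ : ℝ => f b) (Ioc x₀ b) volume :=
    integrableOn_const (by simp)
  have hdI : IntegrableOn (fun x => f x - f b) (Ioc x₀ b) volume :=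
    Integrable.mono' hgint
      ((hcont.sub continuousOn_const).aestronglyMeasurable measurableSet_Ioc) hae
  have hfI : IntegrableOn f (Ioc x₀ b) volume := by
    have := Integrable.add hdI hcI
    refine this.congr (Filter.Eventually.of_forall fun x => ?_)
    simp
  refine ⟨hfI, ?_⟩
  have hbp : 0 < b - x₀ := sub_pos.2 hb
  have h2 := norm_integral_le_of_norm_le hgint hae
  rw [hgval, integral_sub hfI hcI, Real.norm_eq_abs] at h2
  have h3 : ∫ _ in Ioc x₀ b, f b = (b - x₀) * f b := by
    rw [← intervalIntegral.integral_of_le hb.le]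
    simp
  rw [h3] at h2
  have h4 : (b - x₀)⁻¹ * (∫ x in Ioc x₀ b, f x) - f b
      = (b - x₀)⁻¹ * ((∫ x in Ioc x₀ b, f x) - (b - x₀) * f b) := by
    field_simp
  rw [h4, abs_mul, abs_of_pos (inv_pos.2 hbp), inv_mul_le_iff₀ hbp]
  linarith
end

section
/- Fix ε ∈ (0,1]. There exists a constant C > 0 with the following property. Let g : [−1,1]×[−1,1] → ℝ be twice continuously differentiable with ε-Hölder continuous second-order partial derivatives. Then there exist a real number c, a Lebesgue-integrable function ζ : [0,1] → ℝ, and the function ξ₀ : [0,1] → ℝ defined by ξ₀(t) = ξ₀(0) + ∫_0^t (c + ∫_0^r ζ(w) dw) dr (for some value ξ₀(0)), such that: (i) ξ^g(s) = −g(0,0)·log s − (∂²g/∂x∂y)(0,0)·s·log s + ξ₀(s) for all s ∈ (0,1]; and (ii) the function ξ̃(s) := −(∂²g/∂x∂y)(0,0)·s·log s + ξ₀(s) satisfies sup_{s∈[0,1]} |ξ̃(s)| + Var_{[0,1]} ξ̃ ≤ C·‖g‖_{C²}, where ‖g‖_{C²} is the supremum over [−1,1]×[−1,1] of the absolute values of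 g and of all its partial derivatives of order at most 2, and Var denotes total variation. In particular ξ₀ is absolutely continuous on [0,1] with absolutely continuous derivative, and C does not depend on g. -/
open MeasureTheory Set

noncomputable def avg (n : ℝ → ℝ) (r : ℝ) : ℝ := ∫ α in (0:ℝ)..1, n (α * r)

lemma mul_avg (n : ℝ → ℝ) (r : ℝ) : r * avg n r = ∫ a in (0:ℝ)..r, n a := by
  unfold avg
  rw [intervalIntegral.mul_integral_comp_mul_right]; simp

lemma avg_hasDerivAt {n : ℝ → ℝ} (hn : Continuous n) {r : ℝ} (hr : 0 < r) :
    HasDerivAt (avg n) ((n r - avg n r) / r) r := by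
  have h1 : HasDerivAt (fun x => ∫ a in (0:ℝ)..x, n a) (n r) r :=
    intervalIntegral.integral_hasDerivAt_right (hn.intervalIntegrable _ _)
      (hn.stronglyMeasurableAtFilter _ _) hn.continuousAt
  have h2 := h1.div (hasDerivAt_id r) hr.ne'
  have h3 : HasDerivAt (avg n) ((n r * r - (∫ a in (0:ℝ)..r, n a) * 1) / r ^ 2) r := by
    refine h2.congr_of_eventuallyEq ?_
    filter_upwards [lt_mem_nhds hr] with x hx
    have := mul_avg n x
    simp only [Pi.div_apply, id]
    rw [← this]; field_simp
  convert h3 using 1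
  rw [← mul_avg]; field_simp

lemma avg_continuous2 {q : ℝ → ℝ → ℝ} (hq : Continuous (Function.uncurry q)) :
    Continuous (Function.uncurry (fun x y => avg (fun a => q a y) x)) := by
  unfold avg Function.uncurry
  apply intervalIntegral.continuous_parametric_intervalIntegral_of_continuous'
  have : (Function.uncurry fun (p : ℝ × ℝ) (t : ℝ) => q (t * p.1) p.2)
     = (Function.uncurry q) ∘ (fun z : (ℝ × ℝ) × ℝ => (z.2 * z.1.1, z.1.2)) := rfl
  rw [this]
  exact hq.comp (by fun_prop)

lemma avg_continuous {n : ℝ → ℝ} (hn : Continuous n) : Continuous (avg n) := by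
  have := avg_continuous2 (q := fun x _ => n x) (hn.comp continuous_fst)
  exact this.comp (f := fun x : ℝ => (x, (0:ℝ))) (by fun_prop)

lemma avg_abs_le {n : ℝ → ℝ} {B r : ℝ} (h : ∀ a, |n a| ≤ B) : |avg n r| ≤ B := by
  have := intervalIntegral.norm_integral_le_of_norm_le_const (a := 0) (b := 1)
    (f := fun α => n (α * r)) (C := B) (fun x _ => h _)
  simpa [avg] using this

lemma avg_diff_le {n : ℝ → ℝ} (hn : Continuous n) {B r c : ℝ}
    (h : ∀ a ∈ Icc (0:ℝ) 1, |c - n (a * r)| ≤ B) : |c - avg n r| ≤ B := by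
  have h0 : c - avg n r = ∫ α in (0:ℝ)..1, (c - n (α * r)) := by
    rw [intervalIntegral.integral_sub (by simp)
      ((by fun_prop : Continuous fun α => n (α * r)).intervalIntegrable _ _)]
    simp [avg]
  rw [h0]
  have := intervalIntegral.norm_integral_le_of_norm_le_const (a := 0) (b := 1)
    (f := fun α => c - n (α * r)) (C := B) (fun x hx => h x (by
      rw [uIoc_of_le zero_le_one] at hx; exact ⟨hx.1.le, hx.2⟩))
  simpa using this

lemma avg_diff_le2 {n n' : ℝ → ℝ} (hn : Continuous n) (hn' : Continuous n') {B r : ℝ}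
    (h : ∀ a, |n a - n' a| ≤ B) : |avg n r - avg n' r| ≤ B := by
  have h0 : avg n r - avg n' r = avg (fun a => n a - n' a) r := by
    unfold avg
    rw [intervalIntegral.integral_sub
      ((by fun_prop : Continuous fun α => n (α * r)).intervalIntegrable _ _)
      ((by fun_prop : Continuous fun α => n' (α * r)).intervalIntegrable _ _)]
  rw [h0]
  exact avg_abs_le h

lemma cov {φ : ℝ → ℝ → ℝ} (hφ : Continuous (Function.uncurry φ)) {r : ℝ} (hr : 0 < r)
    (hr1 : r ≤ 1) :
    ∫ v in r..1, φ v (r / v) / v = ∫ v in r..1, φ (r / v) v / v := by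
  have h := intervalIntegral.integral_comp_mul_deriv'' (a := r) (b := 1)
    (f := fun v => r / v) (f' := fun v => -r / v ^ 2) (g := fun w => φ w (r / w) / w) ?_ ?_ ?_ ?_
  · simp only [div_self hr.ne', div_one] at h
    rw [intervalIntegral.integral_symm, ← h, ← intervalIntegral.integral_neg]
    apply intervalIntegral.integral_congr
    intro v hv
    rw [uIcc_of_le hr1] at hv
    have hv0 : 0 < v := hr.trans_le hv.1
    have : r / (r / v) = v := by field_simp
    simp only [Function.comp, this]
    field_simp
  · rw [uIcc_of_le hr1]
    exact continuousOn_const.div continuousOn_id (fun x hx => (hr.trans_le hx.1).ne')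
  · intro x hx
    rw [min_eq_left hr1] at hx
    have hx0 : x ≠ 0 := (hr.trans hx.1).ne'
    have := (hasDerivAt_const x r).div (hasDerivAt_id x) hx0
    refine (this.congr_deriv ?_).hasDerivWithinAt
    simp
  · rw [uIcc_of_le hr1]
    exact continuousOn_const.div (by fun_prop) (fun x hx => pow_ne_zero _ (hr.trans_le hx.1).ne')
  · have hs : (fun v => r / v) '' uIcc r 1 ⊆ Ioi 0 := by
      rintro _ ⟨v, hv, rfl⟩
      rw [uIcc_of_le hr1] at hv
      exact div_pos hr (hr.trans_le hv.1)
    refine ContinuousOn.mono ?_ hs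
    have h0 : ∀ x ∈ Ioi (0:ℝ), x ≠ 0 := fun x hx => ne_of_gt hx
    refine ContinuousOn.div ?_ continuousOn_id h0
    exact hφ.comp_continuousOn (f := fun w => (w, r / w))
      (continuousOn_id.prodMk (continuousOn_const.div continuousOn_id h0))

lemma triangle {F : ℝ → ℝ → ℝ} {s : ℝ} (hs1 : s ≤ 1)
    (hF : ContinuousOn (Function.uncurry F) (Icc s 1 ×ˢ Icc s 1)) :
    IntervalIntegrable (fun v => ∫ r in s..v, F r v) volume s 1 ∧
    IntervalIntegrable (fun r => ∫ v in r..1, F r v) volume s 1 ∧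
    ∫ v in s..1, ∫ r in s..v, F r v = ∫ r in s..1, ∫ v in r..1, F r v := by
  let F' : ℝ → ℝ → ℝ := fun r v => if r < v then F r v else 0
  have hint : IntegrableOn (Function.uncurry F') (Ioc s 1 ×ˢ Ioc s 1) := by
    have h1 : IntegrableOn (Function.uncurry F) (Ioc s 1 ×ˢ Ioc s 1) :=
      (hF.integrableOn_compact (isCompact_Icc.prod isCompact_Icc)).mono_set
        (prod_mono Ioc_subset_Icc_self Ioc_subset_Icc_self)
    have hm : MeasurableSet {z : ℝ × ℝ | z.1 < z.2} :=
      measurableSet_lt measurable_fst measurable_snd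
    have h2 := Integrable.indicator h1 hm
    refine h2.congr (Filter.Eventually.of_forall ?_)
    rintro ⟨r, v⟩
    simp [F', indicator, Function.uncurry]
  have e1 : ∀ v ∈ Ioc s 1, ∫ r in s..1, F' r v = ∫ r in s..v, F r v := by
    intro v hv
    rw [intervalIntegral.integral_of_le hs1, intervalIntegral.integral_of_le hv.1.le,
      integral_Ioc_eq_integral_Ioo (x := s) (y := v)]
    have : (fun r => F' r v) = (Iio v).indicator (fun r => F r v) := by
      ext r; simp [F', indicator]
    rw [this, setIntegral_indicator measurableSet_Iio]
    congr 2
    ext x; constructor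
    · rintro ⟨h1, h2⟩; exact ⟨h1.1, h2⟩
    · rintro ⟨h1, h2⟩; exact ⟨⟨h1, h2.le.trans hv.2⟩, h2⟩
  have e2 : ∀ r ∈ Ioc s 1, ∫ v in s..1, F' r v = ∫ v in r..1, F r v := by
    intro r hr
    rw [intervalIntegral.integral_of_le hs1, intervalIntegral.integral_of_le hr.2]
    have : (fun v => F' r v) = (Ioi r).indicator (fun v => F r v) := by
      ext v; simp [F', indicator]
    rw [this, setIntegral_indicator measurableSet_Ioi]
    congr 2
    ext x; constructor
    · rintro ⟨h1, h2⟩; exact ⟨h2, h1.2⟩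
    · rintro ⟨h1, h2⟩; exact ⟨⟨hr.1.trans h1, h2⟩, h1⟩
  have hint' : Integrable (Function.uncurry F')
      ((volume.restrict (Ioc s 1)).prod (volume.restrict (Ioc s 1))) := by
    rw [Measure.prod_restrict, ← Measure.volume_eq_prod]; exact hint
  refine ⟨?_, ?_, ?_⟩
  · rw [intervalIntegrable_iff_integrableOn_Ioc_of_le hs1]
    refine IntegrableOn.congr_fun hint'.integral_prod_right (fun v hv => ?_) measurableSet_Ioc
    rw [← e1 v hv, intervalIntegral.integral_of_le hs1]; rfl
  · rw [intervalIntegrable_iff_integrableOn_Ioc_of_le hs1]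
    refine IntegrableOn.congr_fun hint'.integral_prod_left (fun v hv => ?_) measurableSet_Ioc
    rw [← e2 v hv, intervalIntegral.integral_of_le hs1]; rfl
  · have h := intervalIntegral_intervalIntegral_swap (F := F') (a := s) (b := 1) (c := s) (d := 1)
      (by rw [uIoc_of_le hs1]; exact hint)
    rw [intervalIntegral.integral_of_le hs1, intervalIntegral.integral_of_le hs1] at h
    rw [intervalIntegral.integral_of_le hs1, intervalIntegral.integral_of_le hs1,
      ← setIntegral_congr_fun measurableSet_Ioc e1, ← setIntegral_congr_fun measurableSet_Ioc e2,
      h]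

lemma leibniz {φ ψ : ℝ → ℝ → ℝ} (hφ : Continuous (Function.uncurry φ))
    (hψ : ContinuousOn (Function.uncurry ψ) (Ioi 0 ×ˢ univ))
    (hd : ∀ x > 0, ∀ y, HasDerivAt (fun x => φ x y) (ψ x y) x) {s : ℝ} (hs : 0 < s)
    (hs1 : s ≤ 1) :
    IntervalIntegrable (fun r => ∫ v in r..1, ψ (r / v) v / v ^ 2) volume s 1 ∧
    ∫ v in s..1, φ (s / v) v / v =
      ∫ r in s..1, (φ 1 r / r - ∫ v in r..1, ψ (r / v) v / v ^ 2) := by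
  have hF : ContinuousOn (Function.uncurry (fun r v => ψ (r / v) v / v ^ 2))
      (Icc s 1 ×ˢ Icc s 1) := by
    refine ContinuousOn.div (f := fun z : ℝ × ℝ => ψ (z.1 / z.2) z.2)
      (g := fun z : ℝ × ℝ => z.2 ^ 2) ?_ (by fun_prop) ?_
    · refine hψ.comp (f := fun z : ℝ × ℝ => (z.1 / z.2, z.2)) ?_ ?_
      · exact (continuousOn_fst.div continuousOn_snd
          (fun z hz => (hs.trans_le hz.2.1).ne')).prodMk continuousOn_snd
      · intro z hz
        exact ⟨div_pos (hs.trans_le hz.1.1) (hs.trans_le hz.2.1), mem_univ _⟩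
    · intro z hz
      exact pow_ne_zero _ (hs.trans_le hz.2.1).ne'
  obtain ⟨i1, i2, e⟩ := triangle hs1 hF
  refine ⟨i2, ?_⟩
  have hc : IntervalIntegrable (fun r => φ 1 r / r) volume s 1 := by
    apply ContinuousOn.intervalIntegrable
    rw [uIcc_of_le hs1]
    refine ContinuousOn.div ?_ continuousOn_id (fun x hx => (hs.trans_le hx.1).ne')
    exact (hφ.comp (f := fun r : ℝ => ((1:ℝ), r)) (by fun_prop)).continuousOn
  rw [intervalIntegral.integral_sub hc i2, ← e, ← intervalIntegral.integral_sub hc i1]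
  apply intervalIntegral.integral_congr
  intro v hv
  rw [uIcc_of_le hs1] at hv
  have hv0 : 0 < v := hs.trans_le hv.1
  have key : ∫ r in s..v, ψ (r / v) v / v ^ 2 = φ (v / v) v / v - φ (s / v) v / v := by
    apply intervalIntegral.integral_eq_sub_of_hasDerivAt (f := fun r => φ (r / v) v / v)
    · intro r hr
      rw [uIcc_of_le hv.1] at hr
      have hr0 : 0 < r := hs.trans_le hr.1
      have h1 := (hd (r / v) (div_pos hr0 hv0) v).comp r ((hasDerivAt_id r).div_const v)
      refine (h1.div_const v).congr_deriv ?_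
      field_simp
    · apply ContinuousOn.intervalIntegrable
      rw [uIcc_of_le hv.1]
      exact hF.comp (f := fun r : ℝ => (r, v)) (by fun_prop)
        (fun r hr => ⟨⟨hr.1, hr.2.trans hv.2⟩, hv⟩)
  simp only [key, div_self hv0.ne']
  ring

lemma lemB {q : ℝ → ℝ → ℝ} (hq : Continuous (Function.uncurry q)) {K B ε : ℝ} (hK : 0 ≤ K)
    (hε : 0 < ε) (hB : ∀ x y, |q x y| ≤ B) (h00 : q 0 0 = 0)
    (hx : ∀ x x' y, |q x y - q x' y| ≤ K * |x - x'| ^ ε)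
    (hy : ∀ x y y', |q x y - q x y'| ≤ K * |y - y'| ^ ε) :
    ∃ Y : ℝ → ℝ, IntegrableOn Y (Icc 0 1) volume ∧ ∀ s ∈ Ioc (0:ℝ) 1,
      (∫ u in s..1, (∫ a in (0:ℝ)..u, ∫ b in (0:ℝ)..(s / u), q a b) / u =
        ∫ r in s..1, (avg (fun a => ∫ b in (0:ℝ)..1, q a b) r - ∫ w in r..1, Y w)) ∧
      |∫ w in s..1, Y w| ≤ B * (- Real.log s) := by
  have hqx : ∀ y, Continuous fun a => q a y := fun y =>
    hq.comp (f := fun a : ℝ => (a, y)) (by fun_prop)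
  set p : ℝ → ℝ → ℝ := fun x y => avg (fun a => q a y) x with hp
  have hpc : Continuous (Function.uncurry p) := avg_continuous2 hq
  set d : ℝ → ℝ → ℝ := fun x y => q x y - p x y with hd
  have hdc : Continuous (Function.uncurry d) := hq.sub hpc
  set T : ℝ → ℝ := fun w => ∫ v in w..1, d v (w / v) / v with hT
  set Y : ℝ → ℝ := fun w => (p 1 w - T w) / w with hY
  have B1 : ∀ x y, 0 ≤ x → |d x y| ≤ K * x ^ ε := by
    intro x y hx0
    apply avg_diff_le (hqx y)
    intro a ha
    refine (hx _ _ _).trans ?_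
    gcongr
    rw [abs_of_nonneg (by nlinarith [ha.2])]
    nlinarith [ha.1]
  have hpy : ∀ x y y', |p x y - p x y'| ≤ K * |y - y'| ^ ε := by
    intro x y y'
    exact avg_diff_le2 (hqx y) (hqx y') (fun a => hy a y y')
  have B2 : ∀ x y, 0 ≤ y → |d x y - d x 0| ≤ 2 * K * y ^ ε := by
    intro x y hy0
    have h1 := hy x y 0
    have h2 := hpy x y 0
    rw [sub_zero, abs_of_nonneg hy0] at h1 h2
    have : d x y - d x 0 = (q x y - q x 0) - (p x y - p x 0) := by simp only [hd]; ring
    rw [this]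
    refine (abs_sub _ _).trans ?_
    linarith
  have B3 : ∀ v y, 0 < v → 0 < y → |d v y - d v 0| ≤ 2 * K * (v ^ (2 * ε / 3) * y ^ (ε / 3)) := by
    intro v y hv hy0
    rcases le_total v y with h | h
    · have h1 : |d v y - d v 0| ≤ 2 * K * v ^ ε := by
        refine (abs_sub _ _).trans ?_
        have := B1 v y hv.le
        have := B1 v 0 hv.le
        linarith
      refine h1.trans ?_
      gcongr
      have : v ^ ε = v ^ (2 * ε / 3) * v ^ (ε / 3) := by
        rw [← Real.rpow_add hv]; congr 1; ring
      rw [this]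
      gcongr
    · refine (B2 v y hy0.le).trans ?_
      gcongr
      have : y ^ ε = y ^ (2 * ε / 3) * y ^ (ε / 3) := by
        rw [← Real.rpow_add hy0]; congr 1; ring
      rw [this]
      gcongr
  have cdiv : ∀ {w : ℝ} {F : ℝ → ℝ}, 0 < w → w ≤ 1 → ContinuousOn F (Icc w 1) →
      IntervalIntegrable (fun v => F v / v) volume w 1 := by
    intro w F hw hw1 hF
    apply ContinuousOn.intervalIntegrable
    rw [uIcc_of_le hw1]
    exact hF.div continuousOn_id (fun x hx => (hw.trans_le hx.1).ne')
  have cdv : ∀ {φ : ℝ → ℝ → ℝ}, Continuous (Function.uncurry φ) → ∀ {w : ℝ}, 0 < w →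
      ContinuousOn (fun v => φ v (w / v)) (Icc w 1) := by
    intro φ hφ w hw
    exact hφ.comp_continuousOn (f := fun v => (v, w / v))
      (continuousOn_id.prodMk (continuousOn_const.div continuousOn_id
        (fun x hx => (hw.trans_le hx.1).ne')))
  have cd0 : Continuous fun v => d v 0 := hdc.comp (f := fun a : ℝ => (a, (0:ℝ))) (by fun_prop)
  have B4 : ∀ w ∈ Ioc (0:ℝ) 1, |∫ v in w..1, (d v (w / v) - d v 0) / v| ≤
      6 * K / ε * w ^ (ε / 3) := by
    intro w hw
    have h1 := intervalIntegral.norm_integral_le_of_norm_le (a := w) (b := 1) (μ := volume)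
      (f := fun v => (d v (w / v) - d v 0) / v)
      (g := fun v => 2 * K * w ^ (ε / 3) * v ^ (ε / 3 - 1)) hw.2 ?_ ?_
    · refine h1.trans ?_
      rw [intervalIntegral.integral_const_mul, integral_rpow (Or.inl (by linarith))]
      have : (1 ^ (ε / 3 - 1 + 1) - w ^ (ε / 3 - 1 + 1)) / (ε / 3 - 1 + 1) ≤ 3 / ε := by
        have h0 : 0 ≤ w ^ (ε / 3 - 1 + 1) := Real.rpow_nonneg hw.1.le _
        rw [Real.one_rpow, show ε / 3 - 1 + 1 = ε / 3 by ring] at *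
        rw [div_le_div_iff₀ (by positivity) hε]
        nlinarith
      have h2 : 0 ≤ 2 * K * w ^ (ε / 3) := by have := Real.rpow_nonneg hw.1.le (ε / 3); positivity
      calc _ ≤ 2 * K * w ^ (ε / 3) * (3 / ε) := mul_le_mul_of_nonneg_left this h2
        _ = _ := by ring
    · refine Filter.Eventually.of_forall (fun v hv => ?_)
      have hv0 : 0 < v := hw.1.trans hv.1
      have h2 := B3 v (w / v) hv0 (div_pos hw.1 hv0)
      rw [Real.norm_eq_abs, abs_div, abs_of_pos hv0, div_le_iff₀ hv0]
      refine h2.trans (le_of_eq ?_)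
      rw [Real.div_rpow hw.1.le hv0.le, Real.rpow_sub_one hv0.ne']
      have : v ^ (2 * ε / 3) = v ^ (ε / 3) * v ^ (ε / 3) := by
        rw [← Real.rpow_add hv0]; congr 1; ring
      rw [this]
      have : v ^ (ε / 3) ≠ 0 := (Real.rpow_pos_of_pos hv0 _).ne'
      field_simp
    · exact (intervalIntegral.intervalIntegrable_rpow' (by linarith)).const_mul _
  have B5 : ∀ w ∈ Ioc (0:ℝ) 1, ∫ v in w..1, d v 0 / v = p 1 0 - p w 0 := by
    intro w hw
    apply intervalIntegral.integral_eq_sub_of_hasDerivAt (f := fun v => p v 0)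
    · intro v hv
      rw [uIcc_of_le hw.2] at hv
      exact avg_hasDerivAt (hqx 0) (hw.1.trans_le hv.1)
    · exact cdiv hw.1 hw.2 cd0.continuousOn
  have B6 : ∀ w, 0 ≤ w → |p w 0| ≤ K * w ^ ε := by
    intro w hw
    have := avg_diff_le (hqx 0) (r := w) (c := 0) (B := K * w ^ ε) ?_
    · simpa [hp] using this
    · intro a ha
      have h1 := hx 0 (a * w) 0
      rw [h00] at h1
      refine h1.trans ?_
      gcongr
      rw [zero_sub, abs_neg, abs_of_nonneg (mul_nonneg ha.1 hw)]
      nlinarith [ha.2]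
  have B7 : ∀ w ∈ Ioc (0:ℝ) 1, |p 1 w - T w| ≤ (2 * K + 6 * K / ε) * w ^ (ε / 3) := by
    intro w hw
    have e : T w = (∫ v in w..1, (d v (w / v) - d v 0) / v) + (p 1 0 - p w 0) := by
      rw [← B5 w hw, ← intervalIntegral.integral_add]
      · apply intervalIntegral.integral_congr
        intro v _
        simp only
        ring
      · exact cdiv hw.1 hw.2 ((cdv hdc hw.1).sub cd0.continuousOn)
      · exact cdiv hw.1 hw.2 cd0.continuousOn
    have e2 : p 1 w - T w = (p 1 w - p 1 0) + p w 0 -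
        ∫ v in w..1, (d v (w / v) - d v 0) / v := by rw [e]; ring
    rw [e2]
    have h1 := hpy 1 w 0
    rw [sub_zero, abs_of_pos hw.1] at h1
    have h2 := B6 w hw.1.le
    have h3 := B4 w hw
    have h4 : w ^ ε ≤ w ^ (ε / 3) :=
      Real.rpow_le_rpow_of_exponent_ge hw.1 hw.2 (by linarith)
    have h5 := mul_le_mul_of_nonneg_left h4 hK
    refine (abs_sub _ _).trans ?_
    have := abs_add_le (p 1 w - p 1 0) (p w 0)
    linarith
  have hYi : IntegrableOn Y (Icc 0 1) volume := by
    rw [integrableOn_Icc_iff_integrableOn_Ioc]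
    have hdom : IntegrableOn (fun w : ℝ => (2 * K + 6 * K / ε) * w ^ (ε / 3 - 1)) (Ioc 0 1) := by
      rw [← intervalIntegrable_iff_integrableOn_Ioc_of_le zero_le_one]
      exact (intervalIntegral.intervalIntegrable_rpow' (by linarith)).const_mul _
    have hTm : AEStronglyMeasurable T (volume.restrict (Ioc 0 1)) := by
      let D : ℝ × ℝ → ℝ := {z : ℝ × ℝ | z.1 < z.2 ∧ z.2 ≤ 1}.indicator
        (fun z => d z.2 (z.1 / z.2) / z.2)
      have hDm : StronglyMeasurable D := by
        apply Measurable.stronglyMeasurable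
        apply Measurable.indicator
        · refine Measurable.div ?_ measurable_snd
          exact hdc.measurable.comp (f := fun z : ℝ × ℝ => (z.2, z.1 / z.2)) (by fun_prop)
        · exact (measurableSet_lt measurable_fst measurable_snd).inter
            (measurableSet_le measurable_snd measurable_const)
      have h1 : StronglyMeasurable fun w => ∫ v, D (w, v) := hDm.integral_prod_right'
      refine h1.aestronglyMeasurable.congr ?_
      filter_upwards [ae_restrict_mem measurableSet_Ioc] with w hw
      simp only [hT]
      rw [intervalIntegral.integral_of_le hw.2, ← integral_indicator measurableSet_Ioc]
      congr 1
    have hYm : AEStronglyMeasurable Y (volume.restrict (Ioc 0 1)) := by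
      have : AEStronglyMeasurable (fun w => p 1 w) (volume.restrict (Ioc (0:ℝ) 1)) :=
        (hpc.comp (f := fun w : ℝ => ((1:ℝ), w)) (by fun_prop)).aestronglyMeasurable
      exact ((this.sub hTm).aemeasurable.div aemeasurable_id).aestronglyMeasurable
    refine Integrable.mono' hdom hYm ?_
    filter_upwards [ae_restrict_mem measurableSet_Ioc] with w hw
    have h1 := B7 w hw
    rw [Real.norm_eq_abs, abs_div, abs_of_pos hw.1, div_le_iff₀ hw.1, Real.rpow_sub_one hw.1.ne']
    refine h1.trans (le_of_eq ?_)
    have := hw.1.ne'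
    field_simp
  have B9 : ∀ r ∈ Ioc (0:ℝ) 1, ∫ v in r..1, p v (r / v) / v = ∫ w in r..1, Y w := by
    intro r hr
    rw [cov hpc hr.1 hr.2]
    have h := (leibniz (φ := p) (ψ := fun x y => d x y / x) hpc ?_ ?_ hr.1 hr.2).2
    · rw [h]
      apply intervalIntegral.integral_congr
      intro w hw
      rw [uIcc_of_le hr.2] at hw
      have hw0 : 0 < w := hr.1.trans_le hw.1
      simp only [hY, hT]
      rw [cov hdc hw0 hw.2, sub_div, ← intervalIntegral.integral_div]
      congr 1
      apply intervalIntegral.integral_congr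
      intro v hv
      rw [uIcc_of_le hw.2] at hv
      have hv0 : 0 < v := hw0.trans_le hv.1
      simp only
      field_simp
    · exact ContinuousOn.div hdc.continuousOn continuousOn_fst (fun z hz => ne_of_gt hz.1)
    · intro x hx0 y
      exact avg_hasDerivAt (hqx y) hx0
  have fub : ∀ x y, ∫ a in (0:ℝ)..x, ∫ b in (0:ℝ)..y, q a b = ∫ b in (0:ℝ)..y, x * p x b := by
    intro x y
    rw [intervalIntegral_intervalIntegral_swap]
    · simp only [hp, mul_avg]
    · exact (hq.continuousOn.integrableOn_compact
        (isCompact_uIcc.prod isCompact_uIcc)).mono_set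
          (prod_mono uIoc_subset_uIcc uIoc_subset_uIcc)
  refine ⟨Y, hYi, fun s hs => ⟨?_, ?_⟩⟩
  · have hfc : Continuous (Function.uncurry fun x y => ∫ b in (0:ℝ)..x, y * p y b) := by
      unfold Function.uncurry
      apply intervalIntegral.continuous_parametric_intervalIntegral_of_continuous
      · exact (continuous_snd.comp continuous_fst).mul
          (hpc.comp (f := fun z : (ℝ × ℝ) × ℝ => (z.1.2, z.2)) (by fun_prop))
      · exact continuous_fst
    have hψ : Continuous (Function.uncurry fun x y => y * p y x) :=
      continuous_snd.mul (hpc.comp (f := fun z : ℝ × ℝ => (z.2, z.1)) (by fun_prop))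
    have h := (leibniz hfc hψ.continuousOn ?_ hs.1 hs.2).2
    · simp only [fub]
      rw [h]
      apply intervalIntegral.integral_congr
      intro r hr
      rw [uIcc_of_le hs.2] at hr
      have hr0 : 0 < r := hs.1.trans_le hr.1
      simp only
      congr 1
      · rw [← fub, ← mul_avg]; field_simp
      · rw [← B9 r ⟨hr0, hr.2⟩]
        apply intervalIntegral.integral_congr
        intro v hv
        rw [uIcc_of_le hr.2] at hv
        have hv0 : 0 < v := hr0.trans_le hv.1
        simp only
        field_simp
    · intro x _ y
      have hc : Continuous fun b => y * p y b :=
        continuous_const.mul (hpc.comp (f := fun z : ℝ => (y, z)) (by fun_prop))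
      exact intervalIntegral.integral_hasDerivAt_right (hc.intervalIntegrable _ _)
        (hc.stronglyMeasurableAtFilter _ _) hc.continuousAt
  · rw [← B9 s hs]
    have h1 := intervalIntegral.norm_integral_le_of_norm_le (a := s) (b := 1) (μ := volume)
      (f := fun v => p v (s / v) / v)
      (g := fun v => B * v⁻¹) hs.2 ?_ ?_
    · refine h1.trans (le_of_eq ?_)
      rw [intervalIntegral.integral_const_mul, integral_inv_of_pos hs.1 one_pos]
      simp
    · refine Filter.Eventually.of_forall (fun v hv => ?_)
      have hv0 : 0 < v := hs.1.trans hv.1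
      rw [Real.norm_eq_abs, abs_div, abs_of_pos hv0, div_eq_mul_inv]
      gcongr
      exact avg_abs_le (fun a => hB _ _)
    · refine IntervalIntegrable.const_mul ?_ _
      simpa using cdiv hs.1 hs.2 (F := fun _ => 1) continuousOn_const

lemma evar_le {E W : ℝ → ℝ} {s : Set ℝ}
    (h : ∀ x ∈ s, ∀ y ∈ s, x ≤ y → |E y - E x| ≤ W y - W x) :
    eVariationOn E s ≤ eVariationOn W s := by
  apply iSup_mono
  rintro ⟨n, u, hu, us⟩
  apply Finset.sum_le_sum
  intro i _
  rw [edist_dist, edist_dist]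
  apply ENNReal.ofReal_le_ofReal
  rw [Real.dist_eq, Real.dist_eq]
  exact (h _ (us i) _ (us (i+1)) (hu (Nat.le_succ i))).trans (le_abs_self _)

lemma lemC {N Y : ℝ → ℝ} (hN : Continuous N) {K ε M κ : ℝ} (hε : 0 < ε) (hM : 0 ≤ M)
    (hNM : ∀ a, |N a| ≤ 4 * M) (hκ : |κ| ≤ M)
    (hH : ∀ w ∈ Ioc (0:ℝ) 1, ∀ a ∈ Icc (0:ℝ) 1, |N w - N (a * w)| ≤ K * w ^ ε)
    (hY : IntegrableOn Y (Icc 0 1) volume)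
    (hYM : ∀ s ∈ Ioc (0:ℝ) 1, |∫ w in s..1, Y w| ≤ 2 * M * (- Real.log s)) :
    ∃ (c ξ00 : ℝ) (ζ : ℝ → ℝ), IntegrableOn ζ (Icc 0 1) volume ∧
      (∀ s ∈ Ioc (0:ℝ) 1, ∫ r in s..1, (avg N r - ∫ w in r..1, Y w) =
                (ξ00 + ∫ r in (0:ℝ)..s, (c + ∫ w in (0:ℝ)..r, ζ w))) ∧
          ENNReal.ofReal
              (⨆ s : Icc (0:ℝ) 1,
                |(-κ * (s : ℝ) * Real.log (s : ℝ) +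
                  (ξ00 + ∫ r in (0:ℝ)..(s : ℝ), (c + ∫ w in (0:ℝ)..r, ζ w)))|) +
            eVariationOn
              (fun s => -κ * s * Real.log s +
                (ξ00 + ∫ r in (0:ℝ)..s, (c + ∫ w in (0:ℝ)..r, ζ w)))
              (Icc 0 1)
            ≤ ENNReal.ofReal (16 * M) := by
  set Z : ℝ → ℝ := fun w => (N w - avg N w) / w with hZ
  have hZi : IntegrableOn Z (Icc 0 1) volume := by
    rw [integrableOn_Icc_iff_integrableOn_Ioc]
    have hdom : IntegrableOn (fun w : ℝ => K * w ^ (ε - 1)) (Ioc 0 1) := by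
      rw [← intervalIntegrable_iff_integrableOn_Ioc_of_le zero_le_one]
      exact (intervalIntegral.intervalIntegrable_rpow' (by linarith)).const_mul _
    have hm : AEStronglyMeasurable Z (volume.restrict (Ioc 0 1)) :=
      ((hN.sub (avg_continuous hN)).measurable.div measurable_id).aestronglyMeasurable
    refine Integrable.mono' hdom hm ?_
    filter_upwards [ae_restrict_mem measurableSet_Ioc] with w hw
    have h1 : |N w - avg N w| ≤ K * w ^ ε := avg_diff_le hN (fun a ha => hH w hw a ha)
    rw [Real.norm_eq_abs, abs_div, abs_of_pos hw.1, div_le_iff₀ hw.1, Real.rpow_sub_one hw.1.ne']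
    refine h1.trans (le_of_eq ?_)
    have := hw.1.ne'
    field_simp
  have sub : ∀ {F : ℝ → ℝ}, IntegrableOn F (Icc 0 1) volume → ∀ {a b : ℝ}, a ∈ Icc (0:ℝ) 1 →
      b ∈ Icc (0:ℝ) 1 → IntervalIntegrable F volume a b := by
    intro F hF a b ha hb
    rw [intervalIntegrable_iff]
    refine hF.mono_set ?_
    exact uIoc_subset_uIcc.trans (uIcc_subset_Icc ha hb)
  have h01 : (0:ℝ) ∈ Icc (0:ℝ) 1 := by simp
  have h11 : (1:ℝ) ∈ Icc (0:ℝ) 1 := by simp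
  have hZr : ∀ r ∈ Icc (0:ℝ) 1, ∫ w in (0:ℝ)..r, Z w = avg N r - avg N 0 := by
    intro r hr
    exact intervalIntegral.integral_eq_sub_of_hasDerivAt_of_le hr.1
      (avg_continuous hN).continuousOn (fun x hx => avg_hasDerivAt hN hx.1) (sub hZi h01 hr)
  set ζ : ℝ → ℝ := fun w => -(Z w + Y w) with hζ
  have hζi : IntegrableOn ζ (Icc 0 1) volume := (hZi.add hY).neg
  set c : ℝ := -(avg N 0 - ∫ w in (0:ℝ)..1, Y w) with hc
  set H : ℝ → ℝ := fun r => c + ∫ w in (0:ℝ)..r, ζ w with hHd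
  have hHG : ∀ r ∈ Icc (0:ℝ) 1, avg N r - ∫ w in r..1, Y w = - H r := by
    intro r hr
    simp only [hHd, hζ, hc]
    rw [intervalIntegral.integral_neg, intervalIntegral.integral_add (sub hZi h01 hr)
      (sub hY h01 hr), hZr r hr,
      ← intervalIntegral.integral_add_adjacent_intervals (sub hY h01 hr) (sub hY hr h11)]
    ring
  have hHc : ContinuousOn H (Icc 0 1) := by
    refine continuousOn_const.add ?_
    have := intervalIntegral.continuousOn_primitive_interval (μ := volume) (f := ζ) (a := 0) (b := 1)
      (by rw [uIcc_of_le zero_le_one]; exact hζi)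
    rwa [uIcc_of_le zero_le_one] at this
  have hHi : IntegrableOn H (Icc 0 1) volume := hHc.integrableOn_compact isCompact_Icc
  set ξ00 : ℝ := - ∫ r in (0:ℝ)..1, H r with hξ
  have hX : ∀ s ∈ Icc (0:ℝ) 1, ∫ r in s..1, (avg N r - ∫ w in r..1, Y w) =
      ξ00 + ∫ r in (0:ℝ)..s, H r := by
    intro s hs
    have : ∫ r in s..1, (avg N r - ∫ w in r..1, Y w) = ∫ r in s..1, - H r := by
      apply intervalIntegral.integral_congr
      intro r hr
      rw [uIcc_of_le hs.2] at hr
      exact hHG r ⟨hs.1.trans hr.1, hr.2⟩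
    rw [this, intervalIntegral.integral_neg, hξ,
      ← intervalIntegral.integral_add_adjacent_intervals (sub hHi h01 hs) (sub hHi hs h11)]
    ring
  refine ⟨c, ξ00, ζ, hζi, fun s hs => hX s ⟨hs.1.le, hs.2⟩, ?_⟩
  set E : ℝ → ℝ := fun s => -κ * s * Real.log s + (ξ00 + ∫ r in (0:ℝ)..s, H r) with hE
  set W : ℝ → ℝ := fun s => M * (8 * s - 3 * (s * Real.log s)) with hW
  have key : ∀ s ∈ Icc (0:ℝ) 1, ∀ t ∈ Icc (0:ℝ) 1, s ≤ t → |E t - E s| ≤ W t - W s := by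
    intro s hs t ht hst
    set ℓ : ℝ := ∫ r in s..t, Real.log r with hℓ
    have eℓ : ℓ = t * Real.log t - s * Real.log s - t + s := integral_log
    have hℓ0 : 0 ≤ -ℓ := by
      rw [hℓ, ← intervalIntegral.integral_neg]
      apply intervalIntegral.integral_nonneg hst
      intro u hu
      have := Real.log_nonpos (hs.1.trans hu.1) (hu.2.trans ht.2)
      linarith
    have e1 : E t - E s = -κ * (ℓ + (t - s)) + ∫ r in s..t, H r := by
      rw [eℓ]
      simp only [hE]
      rw [← intervalIntegral.integral_add_adjacent_intervals (sub hHi h01 hs) (sub hHi hs ht)]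
      ring
    have hli : IntervalIntegrable (fun r => 2 * M * (- Real.log r)) volume s t :=
      (intervalIntegral.intervalIntegrable_log' (a := s) (b := t)).neg.const_mul (2 * M)
    have h1 : |∫ r in s..t, H r| ≤ ∫ r in s..t, (4 * M + 2 * M * (- Real.log r)) := by
      refine intervalIntegral.norm_integral_le_of_norm_le (μ := volume) (f := H)
        (g := fun r => 4 * M + 2 * M * (- Real.log r)) hst ?_ ?_
      · refine Filter.Eventually.of_forall (fun r hr => ?_)
        have hr' : r ∈ Ioc (0:ℝ) 1 := ⟨hs.1.trans_lt hr.1, hr.2.trans ht.2⟩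
        have e := hHG r ⟨hr'.1.le, hr'.2⟩
        rw [← norm_neg, ← e, Real.norm_eq_abs]
        refine (abs_sub _ _).trans ?_
        have := hYM r hr'
        have := avg_abs_le (r := r) hNM
        linarith
      · exact IntervalIntegrable.add (f := fun _ => 4 * M) intervalIntegrable_const hli
    have h2 : ∫ r in s..t, (4 * M + 2 * M * (- Real.log r)) = 4 * M * (t - s) + 2 * M * (-ℓ) := by
      rw [intervalIntegral.integral_add intervalIntegrable_const hli,
        intervalIntegral.integral_const_mul (2 * M), intervalIntegral.integral_neg,
        intervalIntegral.integral_const, smul_eq_mul]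
      ring
    have h3 : |-κ * (ℓ + (t - s))| ≤ M * (-ℓ + (t - s)) := by
      rw [abs_mul, abs_neg]
      apply mul_le_mul hκ _ (abs_nonneg _) hM
      rw [abs_le]; constructor <;> linarith
    have h4 : W t - W s = 5 * M * (t - s) + 3 * M * (-ℓ) := by
      simp only [hW]; rw [eℓ]; ring
    rw [e1, h4]
    refine (abs_add_le _ _).trans ?_
    linarith
  have hWm : MonotoneOn W (Icc 0 1) := by
    intro s hs t ht hst
    have := key s hs t ht hst
    linarith [abs_nonneg (E t - E s)]
  have hW0 : W 0 = 0 := by simp [hW]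
  have hW1 : W 1 = 8 * M := by simp [hW]; ring
  have hE1 : E 1 = 0 := by
    have := hX 1 h11
    rw [intervalIntegral.integral_same] at this
    simp only [hE, ← this]; simp
  have b1 : (⨆ s : Icc (0:ℝ) 1, |E s|) ≤ 8 * M := by
    have : Nonempty (Icc (0:ℝ) 1) := ⟨⟨0, h01⟩⟩
    apply ciSup_le
    rintro ⟨s, hs⟩
    have h1 := key s hs 1 h11 hs.2
    have h2 := hWm h01 hs hs.1
    rw [hE1, zero_sub, abs_neg] at h1
    simp only
    linarith
  have b2 : eVariationOn E (Icc 0 1) ≤ ENNReal.ofReal (8 * M) := by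
    refine (evar_le key).trans ?_
    have := hWm.eVariationOn_eq h01 h11
    rw [inter_self, hW0, hW1, sub_zero] at this
    exact this.le
  calc _ ≤ ENNReal.ofReal (8 * M) + ENNReal.ofReal (8 * M) :=
        add_le_add (ENNReal.ofReal_le_ofReal b1) b2
    _ = _ := by
        rw [← ENNReal.ofReal_add (by positivity) (by positivity)]; congr 1; ring

lemma ftc {F F' G : ℝ → ℝ} (hG : Continuous G)
    (hd : ∀ t ∈ Icc (-1:ℝ) 1, HasDerivWithinAt F (F' t) (Icc (-1) 1) t)
    (he : ∀ t ∈ Icc (0:ℝ) 1, G t = F' t) {x : ℝ} (hx : x ∈ Icc (0:ℝ) 1) :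
    ∫ a in (0:ℝ)..x, G a = F x - F 0 := by
  apply intervalIntegral.integral_eq_sub_of_hasDerivAt_of_le hx.1
  · intro t ht
    have : Icc 0 x ⊆ Icc (-1:ℝ) 1 := Icc_subset_Icc (by norm_num) hx.2
    exact ((hd t (this ht)).continuousWithinAt).mono this
  · intro t ht
    rw [he t ⟨ht.1.le, ht.2.le.trans hx.2⟩]
    exact (hd t ⟨by linarith [ht.1], by linarith [ht.2, hx.2]⟩).hasDerivAt
      (Icc_mem_nhds (by linarith [ht.1]) (by linarith [ht.2, hx.2]))
  · exact hG.intervalIntegrable _ _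

lemma avg_add {m n : ℝ → ℝ} (hm : Continuous m) (hn : Continuous n) (r : ℝ) :
    avg (fun x => m x + n x) r = avg m r + avg n r := by
  unfold avg
  rw [intervalIntegral.integral_add
      ((by fun_prop : Continuous fun α => m (α * r)).intervalIntegrable _ _)
      ((by fun_prop : Continuous fun α => n (α * r)).intervalIntegrable _ _)]

noncomputable def cl (x : ℝ) : ℝ := (projIcc (0:ℝ) 1 zero_le_one x : ℝ)

lemma cl_mem0 (x : ℝ) : cl x ∈ Icc (0:ℝ) 1 := (projIcc (0:ℝ) 1 zero_le_one x).2
lemma cl_mem (x : ℝ) : cl x ∈ Icc (-1:ℝ) 1 := ⟨by linarith [(cl_mem0 x).1], (cl_mem0 x).2⟩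
lemma cl_eq {x : ℝ} (hx : x ∈ Icc (0:ℝ) 1) : cl x = x := by
  unfold cl; rw [projIcc_of_mem _ hx]
lemma cl_cont : Continuous cl := continuous_subtype_val.comp continuous_projIcc
lemma cl_lip (x y : ℝ) : |cl x - cl y| ≤ |x - y| := by
  have := (LipschitzWith.projIcc (a := (0:ℝ)) (b := 1) zero_le_one).dist_le_mul x y
  rw [Subtype.dist_eq, Real.dist_eq, Real.dist_eq] at this
  simpa [cl] using this

lemma one_var {F F' : ℝ → ℝ} {M : ℝ} 
    (hd : ∀ t ∈ Icc (-1:ℝ) 1, HasDerivWithinAt F (F' t) (Icc (-1) 1) t)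
    (hb : ∀ t ∈ Icc (-1:ℝ) 1, |F' t| ≤ M) :
    Continuous (fun x => F (cl x)) ∧ ∀ x y, |F (cl x) - F (cl y)| ≤ M * |x - y| := by
  constructor
  · have : ContinuousOn F (Icc (-1) 1) := fun t ht => (hd t ht).continuousWithinAt
    exact this.comp_continuous cl_cont cl_mem
  · intro x y
    have := Convex.norm_image_sub_le_of_norm_hasDerivWithin_le hd hb (convex_Icc _ _)
      (cl_mem y) (cl_mem x)
    have hM : 0 ≤ M := (abs_nonneg _).trans (hb 0 (by norm_num))
    exact this.trans (mul_le_mul_of_nonneg_left (cl_lip x y) hM)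

/-- Lemma B.1 of the paper. For `g` of class `C^{2+ε}` on the square `[-1,1]²`, the
function `ξ^g(s) = ∫_s^1 g(u,s/u) u⁻¹ du` decomposes as
`ξ^g(s) = -g(0,0)·log s - g_{xy}(0,0)·s·log s + ξ₀(s)` with `ξ₀` absolutely continuous
with absolutely continuous derivative (encoded by the double-integral representation and
an integrable `ζ`), and `ξ̃ = ξ^g + g(0,0) log s` satisfies `‖ξ̃‖_sup + Var ξ̃ ≤ C‖g‖_{C²}`
with `C` independent of `g`. -/
theorem stmt6
    (ε : ℝ) (hε0 : 0 < ε) (hε1 : ε ≤ 1) :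
    ∃ C : ℝ, 0 < C ∧
      ∀ (g g10 g01 g20 g11 g02 : ℝ → ℝ → ℝ) (K : ℝ),
        (∀ x ∈ Icc (-1:ℝ) 1, ∀ y ∈ Icc (-1:ℝ) 1,
          HasDerivWithinAt (fun t => g t y) (g10 x y) (Icc (-1) 1) x ∧
          HasDerivWithinAt (fun t => g x t) (g01 x y) (Icc (-1) 1) y ∧
          HasDerivWithinAt (fun t => g10 t y) (g20 x y) (Icc (-1) 1) x ∧
          HasDerivWithinAt (fun t => g10 x t) (g11 x y) (Icc (-1) 1) y ∧
          HasDerivWithinAt (fun t => g01 x t) (g02 x y) (Icc (-1) 1) y) →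
        (∀ x ∈ Icc (-1:ℝ) 1, ∀ y ∈ Icc (-1:ℝ) 1,
         ∀ x' ∈ Icc (-1:ℝ) 1, ∀ y' ∈ Icc (-1:ℝ) 1,
          |g20 x y - g20 x' y'| ≤ K * ‖((x, y) : ℝ × ℝ) - (x', y')‖ ^ ε ∧
          |g11 x y - g11 x' y'| ≤ K * ‖((x, y) : ℝ × ℝ) - (x', y')‖ ^ ε ∧
          |g02 x y - g02 x' y'| ≤ K * ‖((x, y) : ℝ × ℝ) - (x', y')‖ ^ ε) →
        ∀ M : ℝ,
        (∀ x ∈ Icc (-1:ℝ) 1, ∀ y ∈ Icc (-1:ℝ) 1,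
          |g x y| ≤ M ∧ |g10 x y| ≤ M ∧ |g01 x y| ≤ M ∧
          |g20 x y| ≤ M ∧ |g11 x y| ≤ M ∧ |g02 x y| ≤ M) →
        ∃ (c ξ00 : ℝ) (ζ : ℝ → ℝ), IntegrableOn ζ (Icc 0 1) volume ∧
          (∀ s ∈ Ioc (0:ℝ) 1,
            (∫ u in s..1, g u (s / u) * (1 / u)) =
              -(g 0 0) * Real.log s - g11 0 0 * s * Real.log s +
                (ξ00 + ∫ r in (0:ℝ)..s, (c + ∫ w in (0:ℝ)..r, ζ w))) ∧
          ENNReal.ofReal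
              (⨆ s : Icc (0:ℝ) 1,
                |(-(g11 0 0) * (s : ℝ) * Real.log (s : ℝ) +
                  (ξ00 + ∫ r in (0:ℝ)..(s : ℝ), (c + ∫ w in (0:ℝ)..r, ζ w)))|) +
            eVariationOn
              (fun s => -(g11 0 0) * s * Real.log s +
                (ξ00 + ∫ r in (0:ℝ)..s, (c + ∫ w in (0:ℝ)..r, ζ w)))
              (Icc 0 1)
            ≤ ENNReal.ofReal (C * M) := by
  refine ⟨16, by norm_num, ?_⟩
  intro g g10 g01 g20 g11 g02 K hder hhol M hbd
  have z1 : (0:ℝ) ∈ Icc (-1:ℝ) 1 := by norm_num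
  have z0 : (0:ℝ) ∈ Icc (0:ℝ) 1 := by norm_num
  have o0 : (1:ℝ) ∈ Icc (0:ℝ) 1 := by norm_num
  have o1 : (1:ℝ) ∈ Icc (-1:ℝ) 1 := by norm_num
  have hM : 0 ≤ M := (abs_nonneg _).trans (hbd 0 z1 0 z1).1
  have hK : 0 ≤ K := by
    have := (abs_nonneg _).trans (hhol 0 z1 0 z1 1 o1 0 z1).1
    simpa [Prod.norm_def] using this
  set κ := g11 0 0 with hκ
  have hκM : |κ| ≤ M := (hbd 0 z1 0 z1).2.2.2.2.1
  set q : ℝ → ℝ → ℝ := fun x y => g11 (cl x) (cl y) - κ with hq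
  have cl0 : cl 0 = 0 := cl_eq z0
  have hq2 : ∀ z z' : ℝ × ℝ, |Function.uncurry q z - Function.uncurry q z'| ≤ K * ‖z - z'‖ ^ ε := by
    rintro ⟨x, y⟩ ⟨x', y'⟩
    have h := (hhol _ (cl_mem x) _ (cl_mem y) _ (cl_mem x') _ (cl_mem y')).2.1
    have e : Function.uncurry q (x, y) - Function.uncurry q (x', y') =
      g11 (cl x) (cl y) - g11 (cl x') (cl y') := by simp [Function.uncurry, hq]
    rw [e]
    refine h.trans ?_
    gcongr
    simp only [Prod.norm_def, Prod.fst_sub, Prod.snd_sub, Real.norm_eq_abs]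
    exact max_le_max (cl_lip _ _) (cl_lip _ _)
  have hqc : Continuous (Function.uncurry q) := by
    rw [continuous_iff_continuousAt]
    intro z0
    rw [ContinuousAt, tendsto_iff_dist_tendsto_zero]
    refine squeeze_zero (fun _ => dist_nonneg) (fun z => hq2 z z0) ?_
    have : Continuous fun z : ℝ × ℝ => K * ‖z - z0‖ ^ ε :=
      continuous_const.mul ((by fun_prop : Continuous fun z : ℝ × ℝ => ‖z - z0‖).rpow_const
        (fun _ => Or.inr hε0.le))
    have h := this.tendsto z0
    simpa [Real.zero_rpow hε0.ne'] using h
  have hqB : ∀ x y, |q x y| ≤ 2 * M := by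
    intro x y
    refine (abs_sub _ _).trans ?_
    have := (hbd _ (cl_mem x) _ (cl_mem y)).2.2.2.2.1
    linarith
  have hqx : ∀ x x' y, |q x y - q x' y| ≤ K * |x - x'| ^ ε := by
    intro x x' y
    simpa [Prod.norm_def, Function.uncurry] using hq2 (x, y) (x', y)
  have hqy : ∀ x y y', |q x y - q x y'| ≤ K * |y - y'| ^ ε := by
    intro x y y'
    simpa [Prod.norm_def, Function.uncurry] using hq2 (x, y) (x, y')
  have hqyc : ∀ a, Continuous fun b => q a b := fun a =>
    hqc.comp (f := fun b : ℝ => (a, b)) (by fun_prop)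
  have hq00 : q 0 0 = 0 := by simp [hq, cl0, hκ]
  obtain ⟨Y, hYi, hY⟩ := lemB hqc hK hε0 hqB hq00 hqx hqy
  obtain ⟨αc, αl⟩ := one_var (F := fun x => g10 x 0) (F' := fun x => g20 x 0) (M := M)
    (fun t ht => (hder t ht 0 z1).2.2.1) (fun t ht => (hbd t ht 0 z1).2.2.2.1)
  obtain ⟨βc, βl⟩ := one_var (F := fun y => g01 0 y) (F' := fun y => g02 0 y) (M := M)
    (fun t ht => (hder 0 z1 t ht).2.2.2.2) (fun t ht => (hbd 0 z1 t ht).2.2.2.2.2)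
  set α : ℝ → ℝ := fun x => g10 (cl x) 0 with hα
  set β : ℝ → ℝ := fun y => g01 0 (cl y) with hβ
  set n : ℝ → ℝ := fun a => ∫ b in (0:ℝ)..1, q a b with hn
  have hnc : Continuous n :=
    intervalIntegral.continuous_parametric_intervalIntegral_of_continuous' hqc 0 1
  have hnB : ∀ a, |n a| ≤ 2 * M := by
    intro a
    have := intervalIntegral.norm_integral_le_of_norm_le_const (a := 0) (b := 1)
      (f := fun b => q a b) (C := 2 * M) (fun x _ => hqB a x)
    simpa using this
  have hnl : ∀ x x', |n x - n x'| ≤ K * |x - x'| ^ ε := by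
    intro x x'
    have e : n x - n x' = ∫ b in (0:ℝ)..1, (q x b - q x' b) := by
      rw [intervalIntegral.integral_sub ((hqyc x).intervalIntegrable _ _)
        ((hqyc x').intervalIntegrable _ _)]
    rw [e]
    have := intervalIntegral.norm_integral_le_of_norm_le_const (a := 0) (b := 1)
      (f := fun b => q x b - q x' b) (C := K * |x - x'| ^ ε) (fun b _ => hqx x x' b)
    simpa using this
  set N : ℝ → ℝ := fun x => (α x + β x) + n x with hN
  have hNc : Continuous N := (αc.add βc).add hnc
  have hNM : ∀ a, |N a| ≤ 4 * M := by
    intro a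
    have h1 := (hbd _ (cl_mem a) 0 z1).2.1
    have h2 := (hbd 0 z1 _ (cl_mem a)).2.2.1
    have h3 := hnB a
    have h4 := abs_add_le (α a + β a) (n a)
    have h5 := abs_add_le (α a) (β a)
    simp only [hN]
    linarith
  have hH : ∀ w ∈ Ioc (0:ℝ) 1, ∀ a ∈ Icc (0:ℝ) 1, |N w - N (a * w)| ≤ (2 * M + K) * w ^ ε := by
    intro w hw a ha
    have e : N w - N (a * w) = ((α w - α (a * w)) + (β w - β (a * w))) + (n w - n (a * w)) := by
      simp only [hN]; ring
    rw [e]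
    have hd0 : |w - a * w| ≤ w := by
      rw [abs_of_nonneg (by nlinarith [ha.2, hw.1])]; nlinarith [ha.1, hw.1]
    have hw1 : w ≤ w ^ ε := by
      have := Real.rpow_le_rpow_of_exponent_ge hw.1 hw.2 hε1
      rwa [Real.rpow_one] at this
    have h1 : |α w - α (a * w)| ≤ M * w ^ ε :=
      (αl w (a * w)).trans (mul_le_mul_of_nonneg_left (hd0.trans hw1) hM)
    have h2 : |β w - β (a * w)| ≤ M * w ^ ε :=
      (βl w (a * w)).trans (mul_le_mul_of_nonneg_left (hd0.trans hw1) hM)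
    have h3 : |n w - n (a * w)| ≤ K * w ^ ε := by
      refine (hnl w (a * w)).trans ?_
      gcongr
    have h4 := abs_add_le ((α w - α (a * w)) + (β w - β (a * w))) (n w - n (a * w))
    have h5 := abs_add_le (α w - α (a * w)) (β w - β (a * w))
    linarith
  obtain ⟨c, ξ00, ζ, hζ, hrep, hvar⟩ := lemC hNc hε0 hM hNM hκM hH hYi (fun s hs => (hY s hs).2)
  refine ⟨c, ξ00, ζ, hζ, ?_, hvar⟩
  intro s hs
  rw [← hrep s hs]
  -- inner primitive
  set P : ℝ → ℝ → ℝ := fun a y => ∫ b in (0:ℝ)..y, q a b with hP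
  have hPc : Continuous (Function.uncurry P) := by
    unfold Function.uncurry
    apply intervalIntegral.continuous_parametric_intervalIntegral_of_continuous
    · exact hqc.comp (f := fun z : (ℝ × ℝ) × ℝ => (z.1.1, z.2)) (by fun_prop)
    · exact continuous_snd
  set Q : ℝ → ℝ → ℝ := fun x y => ∫ a in (0:ℝ)..x, P a y with hQ
  have hQc : Continuous (Function.uncurry Q) := by
    unfold Function.uncurry
    apply intervalIntegral.continuous_parametric_intervalIntegral_of_continuous
    · exact hPc.comp (f := fun z : (ℝ × ℝ) × ℝ => (z.2, z.1.2)) (by fun_prop)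
    · exact continuous_fst
  have hPx : ∀ y, Continuous fun a => P a y := fun y =>
    hPc.comp (f := fun a : ℝ => (a, y)) (by fun_prop)
  have dec : ∀ x ∈ Icc (0:ℝ) 1, ∀ y ∈ Icc (0:ℝ) 1,
      g x y = g 0 0 + x * avg α x + y * avg β y + κ * (x * y) + Q x y := by
    intro x hx y hy
    have hy1 : y ∈ Icc (-1:ℝ) 1 := ⟨by linarith [hy.1], hy.2⟩
    have e1 := ftc αc (F := fun x => g x 0) (F' := fun x => g10 x 0)
      (fun t ht => (hder t ht 0 z1).1) (fun t ht => by simp only [hα, cl_eq ht]) hx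
    have e2 := ftc βc (F := fun y => g 0 y) (F' := fun y => g01 0 y)
      (fun t ht => (hder 0 z1 t ht).2.1) (fun t ht => by simp only [hβ, cl_eq ht]) hy
    have e3 : ∀ a ∈ Icc (0:ℝ) 1, P a y + κ * y = g10 a y - g10 a 0 := by
      intro a ha
      have ha1 : a ∈ Icc (-1:ℝ) 1 := ⟨by linarith [ha.1], ha.2⟩
      have := ftc (G := fun b => q a b + κ) ((hqyc a).add continuous_const)
        (F := fun y => g10 a y) (F' := fun y => g11 a y)
        (fun t ht => (hder a ha1 t ht).2.2.2.1)
        (fun t ht => by simp only [hq, cl_eq ht, cl_eq ha]; ring) hy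
      rw [← this, intervalIntegral.integral_add ((hqyc a).intervalIntegrable _ _)
        intervalIntegrable_const]
      simp [hP, mul_comm]
    have e4 := ftc (G := fun a => P a y + κ * y) ((hPx y).add continuous_const)
      (F := fun x => g x y - g x 0) (F' := fun x => g10 x y - g10 x 0)
      (fun t ht => (hder t ht y hy1).1.sub (hder t ht 0 z1).1) e3 hx
    rw [intervalIntegral.integral_add ((hPx y).intervalIntegrable _ _)
        intervalIntegrable_const] at e4
    rw [← mul_avg] at e1 e2
    simp only [intervalIntegral.integral_const, smul_eq_mul, sub_zero] at e4
    simp only [hQ]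
    linarith
  have cdiv : ∀ {F : ℝ → ℝ}, ContinuousOn F (Icc s 1) →
      IntervalIntegrable (fun v => F v / v) volume s 1 := by
    intro F hF
    apply ContinuousOn.intervalIntegrable
    rw [uIcc_of_le hs.2]
    exact hF.div continuousOn_id (fun x hx => (hs.1.trans_le hx.1).ne')
  have cdv : ∀ {φ : ℝ → ℝ → ℝ}, Continuous (Function.uncurry φ) →
      IntervalIntegrable (fun v => φ v (s / v) / v) volume s 1 := by
    intro φ hφ
    apply cdiv
    exact hφ.comp_continuousOn (f := fun v => (v, s / v))
      (continuousOn_id.prodMk (continuousOn_const.div continuousOn_id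
        (fun x hx => (hs.1.trans_le hx.1).ne')))
  have avα := avg_continuous αc
  have avβ := avg_continuous βc
  have avn := avg_continuous hnc
  have hbc : Continuous (Function.uncurry fun (_ y : ℝ) => y * avg β y) := by
    unfold Function.uncurry; fun_prop
  have i1 : IntervalIntegrable (fun u : ℝ => (g 0 0 + κ * s) * u⁻¹) volume s 1 := by
    simpa [div_eq_mul_inv] using cdiv (F := fun _ => g 0 0 + κ * s) continuousOn_const
  have i2 : IntervalIntegrable (fun u : ℝ => avg α u) volume s 1 := avα.intervalIntegrable _ _
  have i3 := cdv hbc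
  have i4 := cdv hQc
  have i5 : IntervalIntegrable (fun u : ℝ => avg β u) volume s 1 := avβ.intervalIntegrable _ _
  have i6 : IntervalIntegrable (fun r => avg n r - ∫ w in r..1, Y w) volume s 1 := by
    refine IntervalIntegrable.sub (avn.intervalIntegrable _ _) ?_
    have h := intervalIntegral.continuousOn_primitive_interval_left (μ := volume) (f := Y)
      (a := 0) (b := 1) (by rw [uIcc_of_le zero_le_one]; exact hYi)
    rw [uIcc_of_le zero_le_one] at h
    apply ContinuousOn.intervalIntegrable
    rw [uIcc_of_le hs.2]
    exact h.mono (Icc_subset_Icc_left hs.1.le)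
  have L1 : ∫ u in s..1, g u (s / u) * (1 / u) =
      ∫ u in s..1, ((((g 0 0 + κ * s) * u⁻¹ + avg α u) + ((s / u) * avg β (s / u)) / u) +
        Q u (s / u) / u) := by
    apply intervalIntegral.integral_congr
    intro u hu
    rw [uIcc_of_le hs.2] at hu
    have hu0 : 0 < u := hs.1.trans_le hu.1
    simp only
    rw [dec u ⟨hu0.le, hu.2⟩ (s / u) ⟨(div_pos hs.1 hu0).le, (div_le_one hu0).2 hu.1⟩]
    field_simp
    ring
  have L3 : ∫ u in s..1, ((s / u) * avg β (s / u)) / u = ∫ u in s..1, avg β u := by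
    have := cov hbc hs.1 hs.2
    rw [this]
    apply intervalIntegral.integral_congr
    intro u hu
    rw [uIcc_of_le hs.2] at hu
    have hu0 : 0 < u := hs.1.trans_le hu.1
    simp only
    field_simp
  have R1 : ∫ r in s..1, (avg N r - ∫ w in r..1, Y w) =
      ∫ r in s..1, ((avg α r + avg β r) + (avg n r - ∫ w in r..1, Y w)) := by
    congr 1
    ext r
    rw [hN, avg_add (m := fun x => α x + β x) (αc.add βc) hnc, avg_add αc βc]
    ring
  rw [L1, intervalIntegral.integral_add ((i1.add i2).add i3) i4,
    intervalIntegral.integral_add (i1.add i2) i3, intervalIntegral.integral_add i1 i2, L3,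
    (hY s hs).1, R1, intervalIntegral.integral_add (i2.add i5) i6,
    intervalIntegral.integral_add i2 i5, intervalIntegral.integral_const_mul,
    integral_inv_of_pos hs.1 one_pos]
  simp only [one_div, Real.log_inv]
  ring
end

section
/- Let g : [0,1]×[0,1] → ℝ be continuously differentiable with g(0,0) = 0. Then the function u ↦ (g(u,0) + g(0,u))/u is Lebesgue-integrable on (0,1], and lim_{s→0⁺} ξ^g(s) = ∫_0^1 (g(u,0) + g(0,u))·(1/u) du. -/
open MeasureTheory Set Filter

/-- The limit formula (granicaxi) in Lemma B.1 of the paper. -/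
theorem stmt7
    (g g10 g01 : ℝ → ℝ → ℝ)
    (hdiff : ∀ x ∈ Icc (0:ℝ) 1, ∀ y ∈ Icc (0:ℝ) 1,
      HasDerivWithinAt (fun t => g t y) (g10 x y) (Icc 0 1) x ∧
      HasDerivWithinAt (fun t => g x t) (g01 x y) (Icc 0 1) y)
    (hc : ContinuousOn (fun p : ℝ × ℝ => g p.1 p.2) (Icc 0 1 ×ˢ Icc 0 1))
    (hc10 : ContinuousOn (fun p : ℝ × ℝ => g10 p.1 p.2) (Icc 0 1 ×ˢ Icc 0 1))
    (hc01 : ContinuousOn (fun p : ℝ × ℝ => g01 p.1 p.2) (Icc 0 1 ×ˢ Icc 0 1))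
    (hg00 : g 0 0 = 0) :
    IntegrableOn (fun u => (g u 0 + g 0 u) * (1 / u)) (Ioc 0 1) volume ∧
    Tendsto (fun s => ∫ u in s..1, g u (s / u) * (1 / u))
      (nhdsWithin 0 (Ioi 0))
      (nhds (∫ u in (0:ℝ)..1, (g u 0 + g 0 u) * (1 / u))) := by
  have h0 : (0:ℝ) ∈ Icc (0:ℝ) 1 := by simp
  have hcomp : IsCompact (Icc (0:ℝ) 1 ×ˢ Icc (0:ℝ) 1) := isCompact_Icc.prod isCompact_Icc
  obtain ⟨M1, hM1⟩ := hcomp.exists_bound_of_continuousOn hc10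
  obtain ⟨M2, hM2⟩ := hcomp.exists_bound_of_continuousOn hc01
  obtain ⟨M, hMa, hMb⟩ : ∃ M, M1 ≤ M ∧ M2 ≤ M := ⟨max M1 M2, le_max_left _ _, le_max_right _ _⟩
  have hM0 : 0 ≤ M := (norm_nonneg _).trans ((hM1 (0,0) ⟨h0, h0⟩).trans hMa)
  have bx : ∀ x ∈ Icc (0:ℝ) 1, ∀ y ∈ Icc (0:ℝ) 1, |g x y - g 0 y| ≤ M * x := by
    intro x hx y hy
    have := (convex_Icc (0:ℝ) 1).norm_image_sub_le_of_norm_hasDerivWithin_le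
      (f := fun t => g t y) (f' := fun t => g10 t y) (C := M)
      (fun t ht => (hdiff t ht y hy).1) (fun t ht => (hM1 (t,y) ⟨ht, hy⟩).trans hMa) h0 hx
    simpa [abs_of_nonneg hx.1] using this
  have bY : ∀ x ∈ Icc (0:ℝ) 1, ∀ y ∈ Icc (0:ℝ) 1, |g x y - g x 0| ≤ M * y := by
    intro x hx y hy
    have := (convex_Icc (0:ℝ) 1).norm_image_sub_le_of_norm_hasDerivWithin_le
      (f := fun t => g x t) (f' := fun t => g01 x t) (C := M)
      (fun t ht => (hdiff x hx t ht).2) (fun t ht => (hM2 (x,t) ⟨hx, ht⟩).trans hMb) h0 hy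
    simpa [abs_of_nonneg hy.1] using this
  have c1 : ContinuousOn (fun u => g u 0) (Icc 0 1) := fun x hx => (hdiff x hx 0 h0).1.continuousWithinAt
  have c2 : ContinuousOn (fun u => g 0 u) (Icc 0 1) := fun x hx => (hdiff 0 h0 x hx).2.continuousWithinAt
  have cinv : ContinuousOn (fun u : ℝ => 1 / u) (Ioc 0 1) :=
    continuousOn_const.div continuousOn_id (fun x hx => hx.1.ne')
  have hint : IntegrableOn (fun u => (g u 0 + g 0 u) * (1 / u)) (Ioc 0 1) volume := by
    refine Integrable.of_bound (μ := volume.restrict (Ioc (0:ℝ) 1)) ?_ (2 * M) ?_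
    · exact (((c1.add c2).mono Ioc_subset_Icc_self).mul cinv).aestronglyMeasurable measurableSet_Ioc
    · refine (ae_restrict_mem measurableSet_Ioc).mono fun u hu => ?_
      have hu' := Ioc_subset_Icc_self hu
      have e1 := bx u hu' 0 h0
      have e2 := bY 0 h0 u hu'
      rw [hg00, sub_zero] at e1 e2
      rw [Real.norm_eq_abs, abs_mul, abs_of_pos (one_div_pos.2 hu.1), mul_one_div, div_le_iff₀ hu.1]
      linarith [abs_add_le (g u 0) (g 0 u)]
  refine ⟨hint, ?_⟩
  have hlim1 : Tendsto (fun s => ∫ u in s..1, (g u 0 + g 0 u) * (1 / u))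
      (nhdsWithin 0 (Ioi 0)) (nhds (∫ u in (0:ℝ)..1, (g u 0 + g 0 u) * (1 / u))) := by
    have := intervalIntegral.continuousOn_primitive_interval_left (μ := volume) (a := 0) (b := 1)
      (f := fun u => (g u 0 + g 0 u) * (1 / u))
      (by rw [uIcc_of_le zero_le_one]; exact (integrableOn_Icc_iff_integrableOn_Ioc (by simp)).2 hint)
    rw [uIcc_of_le zero_le_one] at this
    have h2 := (this 0 h0).tendsto
    refine h2.mono_left ?_
    rw [← nhdsWithin_Ioc_eq_nhdsGT (zero_lt_one : (0:ℝ) < 1)]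
    exact nhdsWithin_mono _ Ioc_subset_Icc_self
  have hlim2 : Tendsto (fun s => (∫ u in s..1, g u (s / u) * (1 / u)) -
      ∫ u in s..1, (g u 0 + g 0 u) * (1 / u)) (nhdsWithin 0 (Ioi 0)) (nhds 0) := by
    have hl := (tendsto_log_mul_rpow_nhdsGT_zero (r := 1/2) (by norm_num)).const_mul (-(2 * M))
    rw [mul_zero] at hl
    refine squeeze_zero_norm' ?_ hl
    filter_upwards [Ioc_mem_nhdsGT (zero_lt_one : (0:ℝ) < 1)] with s hs
    have hs0 := hs.1
    have hsub : Icc s 1 ⊆ Icc 0 1 := Icc_subset_Icc_left hs0.le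
    have hpos : ∀ u ∈ Icc s 1, 0 < u := fun u hu => hs0.trans_le hu.1
    have hmem : ∀ u ∈ Icc s 1, s / u ∈ Icc s 1 := fun u hu =>
      ⟨by rw [le_div_iff₀ (hpos u hu)]; nlinarith [hu.2], by rw [div_le_one (hpos u hu)]; exact hu.1⟩
    have cs : ContinuousOn (fun u : ℝ => s / u) (Icc s 1) :=
      continuousOn_const.div continuousOn_id (fun x hx => (hpos x hx).ne')
    have ci : ContinuousOn (fun u : ℝ => 1 / u) (Icc s 1) :=
      continuousOn_const.div continuousOn_id (fun x hx => (hpos x hx).ne')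
    have ii : ∀ f : ℝ → ℝ, ContinuousOn f (Icc s 1) → IntervalIntegrable f volume s 1 :=
      fun f hf => hf.intervalIntegrable_of_Icc hs.2
    have k1 : IntervalIntegrable (fun u => g u (s/u) * (1/u)) volume s 1 := by
      refine ii _ (ContinuousOn.mul ?_ ci)
      exact hc.comp (continuousOn_id.prodMk cs) (fun u hu => ⟨hsub hu, hsub (hmem u hu)⟩)
    have k2 : IntervalIntegrable (fun u => g u 0 * (1/u)) volume s 1 := ii _ ((c1.mono hsub).mul ci)
    have k3c : ContinuousOn (fun u => g 0 u * (1/u)) (Icc s 1) := (c2.mono hsub).mul ci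
    have k3 : IntervalIntegrable (fun u => g 0 u * (1/u)) volume s 1 := ii _ k3c
    have k4 : IntervalIntegrable (fun u => g 0 (s/u) * (1/u)) volume s 1 :=
      ii _ (((c2.mono hsub).comp cs hmem).mul ci)
    have hsubst : ∫ u in s..1, g 0 (s/u) * (1/u) = ∫ u in s..1, g 0 u * (1/u) := by
      have hh := intervalIntegral.integral_comp_mul_deriv'' (a := s) (b := 1)
        (f := fun u => s / u) (f' := fun u => -(s / u^2)) (g := fun u => g 0 u * (1/u))
        (by rwa [uIcc_of_le hs.2])
        (by
          intro x hx
          rw [min_eq_left hs.2, max_eq_right hs.2] at hx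
          have hx0 : x ≠ 0 := (hs0.trans hx.1).ne'
          have := ((hasDerivAt_inv hx0).const_mul s).hasDerivWithinAt (s := Ioi x)
          simpa [div_eq_mul_inv] using this)
        (by
          rw [uIcc_of_le hs.2]
          exact (continuousOn_const.div (continuousOn_id.pow 2)
            (fun x hx => pow_ne_zero 2 (hpos x hx).ne')).neg)
        (by
          rw [uIcc_of_le hs.2]
          exact k3c.mono (image_subset_iff.2 hmem))
      simp only [div_self hs0.ne', div_one] at hh
      rw [intervalIntegral.integral_symm s 1] at hh
      rw [← neg_inj, ← hh, ← intervalIntegral.integral_neg]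
      refine intervalIntegral.integral_congr fun u hu => ?_
      rw [uIcc_of_le hs.2] at hu
      have := (hpos u hu).ne'
      simp only [Function.comp]
      field_simp
    have e : (∫ u in s..1, g u (s / u) * (1 / u)) - ∫ u in s..1, (g u 0 + g 0 u) * (1 / u)
        = ∫ u in s..1, (g u (s/u) * (1/u) - g u 0 * (1/u) - g 0 (s/u) * (1/u)) := by
      rw [intervalIntegral.integral_sub (k1.sub k2) k4, intervalIntegral.integral_sub k1 k2, hsubst]
      simp only [add_mul]
      rw [intervalIntegral.integral_add k2 k3]
      ring
    rw [e]
    have hb := intervalIntegral.norm_integral_le_of_norm_le (μ := volume) hs.2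
      (f := fun u => (g u (s/u) * (1/u) - g u 0 * (1/u) - g 0 (s/u) * (1/u)))
      (g := fun u => 2 * M * √s * (1/u))
      (Eventually.of_forall fun u hu => by
        have hu' := Ioc_subset_Icc_self hu
        have hu0 := hpos u hu'
        have hv := hmem u hu'
        have a1 := bx u (hsub hu') (s/u) (hsub hv)
        have a2 := bx u (hsub hu') 0 h0
        have a3 := bY u (hsub hu') (s/u) (hsub hv)
        have a4 := bY 0 h0 (s/u) (hsub hv)
        rw [hg00, sub_zero] at a2 a4
        rw [← sub_mul, ← sub_mul, Real.norm_eq_abs, abs_mul, abs_of_pos (one_div_pos.2 hu0)]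
        refine mul_le_mul_of_nonneg_right ?_ (one_div_pos.2 hu0).le
        have b1 : |g u (s/u) - g u 0 - g 0 (s/u)| ≤ 2 * M * u := by
          rw [abs_le] at *; constructor <;> linarith
        have b2 : |g u (s/u) - g u 0 - g 0 (s/u)| ≤ 2 * M * (s/u) := by
          rw [abs_le] at *; constructor <;> linarith
        rcases le_total u (√s) with h | h
        · exact b1.trans (by gcongr)
        · refine b2.trans ?_
          have : s / u ≤ √s := by
            rw [div_le_iff₀ hu0]
            nlinarith [Real.mul_self_sqrt hs0.le, Real.sqrt_nonneg s]
          gcongr)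
      (ii _ (continuousOn_const.mul ci))
    refine hb.trans (le_of_eq ?_)
    rw [intervalIntegral.integral_const_mul, integral_one_div_of_pos hs0 one_pos,
      one_div, Real.log_inv, Real.sqrt_eq_rpow]
    ring
  simpa using hlim2.add hlim1
end

section
/- Let g : [0,1]×[0,1] → ℝ be continuously differentiable. Then the function s ↦ ξ^g(s) is differentiable on (0,1) and for every s ∈ (0,1): (ξ^g)′(s) = ∫_{√s}^1 ((∂g/∂x)(s/u, u) + (∂g/∂y)(u, s/u))·(1/u²) du − g(√s, √s)/s. -/
open MeasureTheory Set

noncomputable def HH (g : ℝ → ℝ → ℝ) (u t : ℝ) : ℝ := (g u (t / u) + g (t / u) u) * (1 / u)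

def DD : Set (ℝ × ℝ) := {p | 0 < p.1 ∧ p.1 ≤ 1 ∧ 0 ≤ p.2 ∧ p.2 ≤ p.1}

lemma DD_maps {p : ℝ × ℝ} (hp : p ∈ DD) : p.1 ∈ Icc (0:ℝ) 1 ∧ p.2 / p.1 ∈ Icc (0:ℝ) 1 := by
  obtain ⟨h1, h2, h3, h4⟩ := hp
  exact ⟨⟨h1.le, h2⟩, div_nonneg h3 h1.le, (div_le_one h1).2 h4⟩

lemma cont1 {k : ℝ → ℝ → ℝ}
    (hc : ContinuousOn (fun p : ℝ × ℝ => k p.1 p.2) (Icc 0 1 ×ˢ Icc 0 1)) :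
    ContinuousOn (fun p : ℝ × ℝ => k p.1 (p.2 / p.1)) DD := by
  have h : ContinuousOn (fun p : ℝ × ℝ => (p.1, p.2 / p.1)) DD :=
    continuousOn_fst.prodMk (continuousOn_snd.div continuousOn_fst (fun p hp => hp.1.ne'))
  exact hc.comp h (fun p hp => ⟨(DD_maps hp).1, (DD_maps hp).2⟩)

lemma cont2 {k : ℝ → ℝ → ℝ}
    (hc : ContinuousOn (fun p : ℝ × ℝ => k p.1 p.2) (Icc 0 1 ×ˢ Icc 0 1)) :
    ContinuousOn (fun p : ℝ × ℝ => k (p.2 / p.1) p.1) DD := by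
  have h : ContinuousOn (fun p : ℝ × ℝ => (p.2 / p.1, p.1)) DD :=
    (continuousOn_snd.div continuousOn_fst (fun p hp => hp.1.ne')).prodMk continuousOn_fst
  exact hc.comp h (fun p hp => ⟨(DD_maps hp).2, (DD_maps hp).1⟩)

lemma contInv : ContinuousOn (fun p : ℝ × ℝ => 1 / p.1) DD :=
  continuousOn_const.div continuousOn_fst (fun p hp => hp.1.ne')

lemma contH {g : ℝ → ℝ → ℝ}
    (hc : ContinuousOn (fun p : ℝ × ℝ => g p.1 p.2) (Icc 0 1 ×ˢ Icc 0 1)) :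
    ContinuousOn (fun p : ℝ × ℝ => HH g p.1 p.2) DD :=
  ((cont1 hc).add (cont2 hc)).mul contInv

lemma slice {f : ℝ × ℝ → ℝ} (hf : ContinuousOn f DD) {a t : ℝ} (ha : 0 < a) (ht : 0 ≤ t)
    (hta : t ≤ a) : ContinuousOn (fun u => f (u, t)) (Icc a 1) :=
  hf.comp (continuousOn_id.prodMk continuousOn_const)
    (fun u hu => ⟨ha.trans_le hu.1, hu.2, ht, hta.trans hu.1⟩)

lemma sliceI {f : ℝ × ℝ → ℝ} (hf : ContinuousOn f DD) {a b c t : ℝ} (ha : 0 < a) (ht : 0 ≤ t)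
    (hta : t ≤ a) (hb : b ∈ Icc a 1) (hc : c ∈ Icc a 1) :
    IntervalIntegrable (fun u => f (u, t)) volume b c :=
  ((slice hf ha ht hta).mono (uIcc_subset_Icc hb hc)).intervalIntegrable

lemma fold {g : ℝ → ℝ → ℝ}
    (hc : ContinuousOn (fun p : ℝ × ℝ => g p.1 p.2) (Icc 0 1 ×ˢ Icc 0 1)) {t : ℝ}
    (ht : t ∈ Ioo (0:ℝ) 1) :
    ∫ u in t..1, g u (t / u) * (1 / u) = ∫ u in Real.sqrt t..1, HH g u t := by
  obtain ⟨h0, h1⟩ := ht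
  have hr0 : 0 < Real.sqrt t := Real.sqrt_pos.2 h0
  have hrr : Real.sqrt t * Real.sqrt t = t := Real.mul_self_sqrt h0.le
  set r := Real.sqrt t
  have hr1 : r < 1 := by nlinarith
  have htr : t ≤ r := by nlinarith
  have c1 := (cont1 hc).mul contInv
  have c2 := (cont2 hc).mul contInv
  have i1 : IntervalIntegrable (fun u => g u (t / u) * (1 / u)) volume t r :=
    sliceI c1 h0 h0.le le_rfl ⟨le_rfl, h1.le⟩ ⟨htr, hr1.le⟩
  have i2 : IntervalIntegrable (fun u => g u (t / u) * (1 / u)) volume r 1 :=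
    sliceI c1 h0 h0.le le_rfl ⟨htr, hr1.le⟩ ⟨h1.le, le_rfl⟩
  have i3 : IntervalIntegrable (fun u => g (t / u) u * (1 / u)) volume r 1 :=
    sliceI c2 h0 h0.le le_rfl ⟨htr, hr1.le⟩ ⟨h1.le, le_rfl⟩
  have key : ∫ u in t..r, g u (t / u) * (1 / u) = ∫ u in r..1, g (t / u) u * (1 / u) := by
    have hsub := intervalIntegral.integral_comp_mul_deriv' (a := r) (b := 1)
      (f := fun u => t / u) (f' := fun u => -t / u ^ 2)
      (g := fun u => g u (t / u) * (1 / u)) ?_ ?_ ?_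
    · have e1 : t / r = r := by rw [div_eq_iff hr0.ne', hrr]
      simp only [e1, div_one] at hsub
      rw [intervalIntegral.integral_symm, ← hsub, ← intervalIntegral.integral_neg]
      apply intervalIntegral.integral_congr
      intro u hu
      rw [uIcc_of_le hr1.le] at hu
      have hu0 : u ≠ 0 := (hr0.trans_le hu.1).ne'
      have e2 : t / (t / u) = u := by field_simp
      simp only [Function.comp, e2]
      field_simp
    · intro u hu
      rw [uIcc_of_le hr1.le] at hu
      have hu0 : u ≠ 0 := (hr0.trans_le hu.1).ne'
      have := (hasDerivAt_const u t).div (hasDerivAt_id u) hu0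
      exact this.congr_deriv (by simp)
    · apply ContinuousOn.div continuousOn_const (by fun_prop)
      intro u hu
      rw [uIcc_of_le hr1.le] at hu
      have hu0 : u ≠ 0 := (hr0.trans_le hu.1).ne'
      positivity
    · refine (slice c1 h0 h0.le le_rfl).mono ?_
      rintro _ ⟨u, hu, rfl⟩
      rw [uIcc_of_le hr1.le] at hu
      have hu0 : 0 < u := (hr0.trans_le hu.1)
      refine ⟨?_, ?_⟩
      · rw [le_div_iff₀ hu0]; nlinarith [hu.2]
      · rw [div_le_one hu0]; exact htr.trans hu.1
  rw [← intervalIntegral.integral_add_adjacent_intervals i1 i2, key,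
    ← intervalIntegral.integral_add i3 i2]
  apply intervalIntegral.integral_congr
  intro u _
  simp only [HH]
  ring

/-- The first-derivative formula for `ξ^g` from the proof of Lemma B.1 of the paper. -/
theorem stmt9
    (g g10 g01 : ℝ → ℝ → ℝ)
    (hdiff : ∀ x ∈ Icc (0:ℝ) 1, ∀ y ∈ Icc (0:ℝ) 1,
      HasDerivWithinAt (fun t => g t y) (g10 x y) (Icc 0 1) x ∧
      HasDerivWithinAt (fun t => g x t) (g01 x y) (Icc 0 1) y)
    (hc : ContinuousOn (fun p : ℝ × ℝ => g p.1 p.2) (Icc 0 1 ×ˢ Icc 0 1))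
    (hc10 : ContinuousOn (fun p : ℝ × ℝ => g10 p.1 p.2) (Icc 0 1 ×ˢ Icc 0 1))
    (hc01 : ContinuousOn (fun p : ℝ × ℝ => g01 p.1 p.2) (Icc 0 1 ×ˢ Icc 0 1)) :
    ∀ s ∈ Ioo (0:ℝ) 1,
      HasDerivAt (fun t => ∫ u in t..1, g u (t / u) * (1 / u))
        ((∫ u in Real.sqrt s..1, (g10 (s / u) u + g01 u (s / u)) * (1 / u ^ 2)) -
          g (Real.sqrt s) (Real.sqrt s) / s) s := by
  rintro s ⟨h0, h1⟩
  have hr0 : 0 < Real.sqrt s := Real.sqrt_pos.2 h0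
  have hrr : Real.sqrt s * Real.sqrt s = s := Real.mul_self_sqrt h0.le
  have hsq : HasDerivAt Real.sqrt (1 / (2 * Real.sqrt s)) s := Real.hasDerivAt_sqrt h0.ne'
  set r := Real.sqrt s with hr
  have hr1 : r < 1 := by nlinarith
  have hsr : s < r := by nlinarith
  have hsr' : s / r = r := by rw [div_eq_iff hr0.ne', hrr]
  have cH := contH hc
  have hN : Ioo 0 r ∈ nhds s := Ioo_mem_nhds h0 hsr
  -- first piece
  have D1 : HasDerivAt (fun t => ∫ u in r..1, HH g u t)
      (∫ u in r..1, (g10 (s / u) u + g01 u (s / u)) * (1 / u ^ 2)) s := by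
    obtain ⟨C1, hC1⟩ := (isCompact_Icc.prod isCompact_Icc).exists_bound_of_continuousOn hc10
    obtain ⟨C2, hC2⟩ := (isCompact_Icc.prod isCompact_Icc).exists_bound_of_continuousOn hc01
    refine (intervalIntegral.hasDerivAt_integral_of_dominated_loc_of_deriv_le
      (F := fun t u => HH g u t)
      (F' := fun t u => (g10 (t / u) u + g01 u (t / u)) * (1 / u ^ 2))
      (bound := fun _ => (C1 + C2) * (1 / r ^ 2)) hN ?_ ?_ ?_ ?_ ?_ ?_).2
    · filter_upwards [hN] with t ht
      exact (sliceI cH hr0 ht.1.le ht.2.le ⟨le_rfl, hr1.le⟩ ⟨hr1.le, le_rfl⟩).def'.aestronglyMeasurable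
    · exact sliceI cH hr0 h0.le hsr.le ⟨le_rfl, hr1.le⟩ ⟨hr1.le, le_rfl⟩
    · have c := ((cont2 hc10).add (cont1 hc01)).mul (contInv.pow 2)
      have := (sliceI c hr0 h0.le hsr.le ⟨le_rfl, hr1.le⟩ ⟨hr1.le, le_rfl⟩).def'.aestronglyMeasurable
      simpa using this
    · refine Filter.Eventually.of_forall fun u hu t ht => ?_
      rw [uIoc_of_le hr1.le] at hu
      have hu0 : 0 < u := hr0.trans hu.1
      have hm := DD_maps (p := (u, t)) ⟨hu0, hu.2, ht.1.le, (ht.2.trans hu.1).le⟩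
      have b1 := hC1 (t / u, u) ⟨hm.2, hm.1⟩
      have b2 := hC2 (u, t / u) ⟨hm.1, hm.2⟩
      have b3 : 1 / u ^ 2 ≤ 1 / r ^ 2 := by
        apply one_div_le_one_div_of_le (by positivity)
        have := hu.1.le
        gcongr
      rw [norm_mul, Real.norm_of_nonneg (by positivity : 0 ≤ 1 / u ^ 2)]
      have b4 := (norm_add_le (g10 (t / u) u) (g01 u (t / u))).trans (add_le_add b1 b2)
      exact mul_le_mul b4 b3 (by positivity) ((norm_nonneg _).trans b4)
    · exact intervalIntegrable_const
    · refine Filter.Eventually.of_forall fun u hu t ht => ?_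
      rw [uIoc_of_le hr1.le] at hu
      have hu0 : 0 < u := hr0.trans hu.1
      have hm := DD_maps (p := (u, t)) ⟨hu0, hu.2, ht.1.le, (ht.2.trans hu.1).le⟩
      have hnb : Icc (0:ℝ) 1 ∈ nhds (t / u) :=
        Icc_mem_nhds (div_pos ht.1 hu0) ((div_lt_one hu0).2 (ht.2.trans hu.1))
      have d1 := ((hdiff _ hm.2 _ hm.1).1.hasDerivAt hnb)
      have d2 := ((hdiff _ hm.1 _ hm.2).2.hasDerivAt hnb)
      have dd : HasDerivAt (fun t => t / u) (1 / u) t := (hasDerivAt_id t).div_const u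
      have e1 := HasDerivAt.comp t d1 dd
      have e2 := HasDerivAt.comp t d2 dd
      have e3 := (e2.add e1).mul_const (1 / u)
      refine e3.congr_deriv ?_
      simp only
      field_simp
      ring
  -- second piece
  have D2 : HasDerivAt (fun t => ∫ u in r..Real.sqrt t, HH g u t) (g r r / s) s := by
    have hlo : (fun t => (∫ u in r..Real.sqrt t, HH g u t) - HH g r s * (Real.sqrt t - r))
        =o[nhds s] fun t => Real.sqrt t - r := by
      rw [Asymptotics.isLittleO_iff]
      intro ε hε
      have hD : DD ∈ nhds (r, s) := by
        have hopen : IsOpen {p : ℝ × ℝ | 0 < p.1 ∧ p.1 < 1 ∧ 0 < p.2 ∧ p.2 < p.1} := by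
          refine (isOpen_lt continuous_const continuous_fst).inter
            ((isOpen_lt continuous_fst continuous_const).inter
            ((isOpen_lt continuous_const continuous_snd).inter
            (isOpen_lt continuous_snd continuous_fst)))
        refine Filter.mem_of_superset (hopen.mem_nhds ⟨hr0, hr1, h0, hsr⟩) ?_
        rintro p ⟨a, b, c, d⟩
        exact ⟨a, b.le, c.le, d.le⟩
      have hca := cH.continuousAt hD
      have hev := (Metric.continuousAt_iff'.1 hca ε hε).and hD
      obtain ⟨δ, hδ, hb⟩ := Metric.eventually_nhds_iff.1 hev
      have hs2 : ∀ᶠ t in nhds s, dist (Real.sqrt t) r < δ :=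
        Metric.continuousAt_iff'.1 hsq.continuousAt δ hδ
      filter_upwards [hs2, Metric.ball_mem_nhds s hδ] with t ht1 ht2
      have hu : ∀ u ∈ uIcc r (Real.sqrt t), dist (HH g u t) (HH g r s) < ε ∧ (u, t) ∈ DD := by
        intro u hu
        refine hb (y := (u, t)) ?_
        rw [Prod.dist_eq]
        refine max_lt ?_ ht2
        refine lt_of_le_of_lt ?_ ht1
        rw [dist_comm u, dist_comm _ r]
        exact Real.dist_left_le_of_mem_uIcc hu
      have hint : IntervalIntegrable (fun u => HH g u t) volume r (Real.sqrt t) := by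
        apply ContinuousOn.intervalIntegrable
        exact cH.comp (f := fun u => (u, t)) (continuousOn_id.prodMk continuousOn_const)
          (fun u h => (hu u h).2)
      have hcst : HH g r s * (Real.sqrt t - r) = ∫ u in r..Real.sqrt t, HH g r s := by
        rw [intervalIntegral.integral_const, smul_eq_mul, mul_comm]
      rw [hcst, ← intervalIntegral.integral_sub hint intervalIntegrable_const]
      apply intervalIntegral.norm_integral_le_of_norm_le_const
      intro u h
      exact (hu u (uIoc_subset_uIcc h)).1.le
    have hO : (fun t => Real.sqrt t - r) =O[nhds s] fun t => t - s := hsq.isBigO_sub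
    have h3 := hlo.trans_isBigO hO
    have h4 : HasDerivAt (fun t => (∫ u in r..Real.sqrt t, HH g u t)
        - HH g r s * (Real.sqrt t - r)) 0 s := by
      rw [hasDerivAt_iff_isLittleO]
      simpa [← hr] using h3
    have h5 := h4.add ((hsq.sub_const r).const_mul (HH g r s))
    have h6 : 0 + HH g r s * (1 / (2 * r)) = g r r / s := by
      simp only [HH, hsr']
      rw [← hrr]
      field_simp
      ring
    rw [h6] at h5
    refine h5.congr_of_eventuallyEq (Filter.Eventually.of_forall fun t => ?_)
    simp
  refine (D1.sub D2).congr_of_eventuallyEq ?_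
  filter_upwards [Ioo_mem_nhds h0 h1, hN] with t ht ht2
  have q0 : 0 < Real.sqrt t := Real.sqrt_pos.2 ht.1
  have qq : Real.sqrt t * Real.sqrt t = t := Real.mul_self_sqrt ht.1.le
  have q1 : Real.sqrt t < 1 := by nlinarith [ht.2]
  have qt : t ≤ Real.sqrt t := by nlinarith
  have i1 : IntervalIntegrable (fun u => HH g u t) volume r 1 :=
    sliceI cH ht.1 ht.1.le le_rfl ⟨ht2.2.le, hr1.le⟩ ⟨ht.2.le, le_rfl⟩
  have i2 : IntervalIntegrable (fun u => HH g u t) volume r (Real.sqrt t) :=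
    sliceI cH ht.1 ht.1.le le_rfl ⟨ht2.2.le, hr1.le⟩ ⟨qt, q1.le⟩
  rw [fold hc ht]
  exact (intervalIntegral.integral_interval_sub_left i1 i2).symm
end

section
/- Let g : [0,1]×[0,1] → ℝ be twice continuously differentiable. Then the function s ↦ ξ^g(s) is twice differentiable on (0,1) and for every s ∈ (0,1): (ξ^g)″(s) = ∫_{√s}^1 ((∂²g/∂x²)(s/u, u) + (∂²g/∂y²)(u, s/u))·(1/u³) du − ((∂g/∂x)(√s,√s) + (∂g/∂y)(√s,√s))/(s·√s) + g(√s,√s)/s². -/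
open MeasureTheory Set

open Filter Topology in
lemma aux_leibniz (f f' : ℝ → ℝ → ℝ) (r : ℝ → ℝ) (r' t1 t2 c s : ℝ)
    (hs : s ∈ Ioo t1 t2) (hrs : r s ∈ Ioo c 1) (hr : HasDerivAt r r' s)
    (hf : ContinuousOn (fun p : ℝ × ℝ => f p.1 p.2) (Icc t1 t2 ×ˢ Icc c 1))
    (hf' : ContinuousOn (fun p : ℝ × ℝ => f' p.1 p.2) (Icc t1 t2 ×ˢ Icc c 1))
    (hd : ∀ t ∈ Ioo t1 t2, ∀ u ∈ Icc c 1, HasDerivAt (fun t => f t u) (f' t u) t) :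
    HasDerivAt (fun t => ∫ u in (r t)..1, f t u)
      ((∫ u in (r s)..1, f' s u) - f s (r s) * r') s := by
  have hcont : ∀ t ∈ Icc t1 t2, ContinuousOn (f t) (Icc c 1) := fun t ht =>
    hf.comp (f := fun u => (t, u)) (by fun_prop) (fun u hu => ⟨ht, hu⟩)
  have hcont' : ∀ t ∈ Icc t1 t2, ContinuousOn (f' t) (Icc c 1) := fun t ht =>
    hf'.comp (f := fun u => (t, u)) (by fun_prop) (fun u hu => ⟨ht, hu⟩)
  have hII : ∀ t ∈ Icc t1 t2, ∀ a ∈ Icc c 1, ∀ b ∈ Icc c 1,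
      IntervalIntegrable (f t) volume a b := fun t ht a ha b hb =>
    ((hcont t ht).mono (uIcc_subset_Icc ha hb)).intervalIntegrable
  obtain ⟨C, hC⟩ := (isCompact_Icc.prod isCompact_Icc).exists_bound_of_continuousOn hf'
  have hC' : ∀ t ∈ Ioo t1 t2, ∀ u ∈ Icc c 1, ‖f' t u‖ ≤ C := fun t ht u hu =>
    hC (t, u) ⟨Ioo_subset_Icc_self ht, hu⟩
  have hsI := Ioo_subset_Icc_self hs
  have hrI := Ioo_subset_Icc_self hrs
  have h1I : (1:ℝ) ∈ Icc c 1 := ⟨(hrs.1.trans hrs.2).le, le_rfl⟩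
  have hnh : Ioo t1 t2 ∈ 𝓝 s := Ioo_mem_nhds hs.1 hs.2
  have hsub : uIoc (r s) 1 ⊆ Icc c 1 := uIoc_subset_uIcc.trans (uIcc_subset_Icc hrI h1I)
  have hrn : ∀ᶠ t in 𝓝 s, r t ∈ Icc c 1 :=
    hr.continuousAt.eventually (Icc_mem_nhds hrs.1 hrs.2)
  -- first piece
  have A1 : HasDerivAt (fun t => ∫ u in (r s)..1, f t u) (∫ u in (r s)..1, f' s u) s := by
    refine (intervalIntegral.hasDerivAt_integral_of_dominated_loc_of_deriv_le
      (bound := fun _ => C) hnh ?_ (hII s hsI _ hrI _ h1I) ?_ ?_ (by simp) ?_).2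
    · filter_upwards [hnh] with t ht
      exact ((hcont t (Ioo_subset_Icc_self ht)).mono hsub).aestronglyMeasurable measurableSet_uIoc
    · exact ((hcont' s hsI).mono hsub).aestronglyMeasurable measurableSet_uIoc
    · exact ae_of_all _ fun u hu t ht => hC' t ht u (hsub hu)
    · exact ae_of_all _ fun u hu t ht => hd t ht u (hsub hu)
  -- second piece
  have A2 : HasDerivAt (fun t => ∫ u in (r t)..(r s), f s u) (-(f s (r s)) * r') s := by
    have h1 : HasDerivAt (fun v => ∫ u in v..(r s), f s u) (-(f s (r s))) (r s) := by
      have hca : ContinuousAt (f s) (r s) := (hcont s hsI).continuousAt (Icc_mem_nhds hrs.1 hrs.2)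
      refine intervalIntegral.integral_hasDerivAt_left (by simp) ?_ hca
      exact ⟨Icc c 1, Icc_mem_nhds hrs.1 hrs.2,
        (hcont s hsI).aestronglyMeasurable measurableSet_Icc⟩
    exact h1.comp s hr
  -- third piece
  have A3 : HasDerivAt (fun t => ∫ u in (r t)..(r s), (f t u - f s u)) 0 s := by
    rw [hasDerivAt_iff_isLittleO]
    simp only [intervalIntegral.integral_same, sub_zero, smul_zero]
    have hb : ∀ᶠ t in 𝓝 s, ‖∫ u in (r t)..(r s), (f t u - f s u)‖
        ≤ 1 * ‖(t - s) * (C * (r t - r s))‖ := by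
      filter_upwards [hnh, hrn] with t ht hrt
      have : ∀ u ∈ uIoc (r t) (r s), ‖f t u - f s u‖ ≤ C * ‖t - s‖ := by
        intro u hu
        have hu' : u ∈ Icc c 1 := (uIoc_subset_uIcc.trans (uIcc_subset_Icc hrt hrI)) hu
        exact (convex_Ioo t1 t2).norm_image_sub_le_of_norm_hasDerivWithin_le
          (fun x hx => (hd x hx u hu').hasDerivWithinAt) (fun x hx => hC' x hx u hu') hs ht
      have h2 := intervalIntegral.norm_integral_le_of_norm_le_const this
      have hC0 : 0 ≤ C := (norm_nonneg _).trans (hC' s hs _ hrI)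
      refine h2.trans (le_of_eq ?_)
      simp only [Real.norm_eq_abs, abs_mul, abs_of_nonneg hC0, abs_sub_comm (r s)]
      ring
    have hlo : (fun t => (t - s) * (C * (r t - r s))) =o[𝓝 s] (fun t => t - s) := by
      have ht : Tendsto (fun t => C * (r t - r s)) (𝓝 s) (𝓝 0) := by
        have : ContinuousAt (fun t => C * (r t - r s)) s := by
          have := hr.continuousAt
          fun_prop
        simpa [ContinuousAt] using this
      simpa using (Asymptotics.isBigO_refl (fun t => t - s) (𝓝 s)).mul_isLittleO
        ((Asymptotics.isLittleO_one_iff ℝ).2 ht)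
    exact (Asymptotics.IsBigO.of_bound 1 hb).trans_isLittleO hlo
  have A := (A1.add A2).add A3
  refine (A.congr_of_eventuallyEq ?_).congr_deriv (by ring)
  filter_upwards [hnh, hrn] with t ht hrt
  have htI := Ioo_subset_Icc_self ht
  simp only [Pi.add_apply]
  rw [intervalIntegral.integral_sub (hII t htI _ hrt _ hrI) (hII s hsI _ hrt _ hrI),
    ← intervalIntegral.integral_add_adjacent_intervals (hII t htI _ hrt _ hrI)
      (hII t htI _ hrI _ h1I)]
  ring

lemma aux_k (h h' : ℝ → ℝ → ℝ) (k : ℕ)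
    (hd : ∀ x ∈ Icc (0:ℝ) 1, ∀ y ∈ Icc (0:ℝ) 1,
      HasDerivWithinAt (fun t => h x t) (h' x y) (Icc 0 1) y)
    (hc : ContinuousOn (fun p : ℝ × ℝ => h p.1 p.2) (Icc 0 1 ×ˢ Icc 0 1))
    (hc' : ContinuousOn (fun p : ℝ × ℝ => h' p.1 p.2) (Icc 0 1 ×ˢ Icc 0 1))
    (s : ℝ) (hs : s ∈ Ioo (0:ℝ) 1) :
    HasDerivAt (fun t => ∫ u in (Real.sqrt t)..1, h u (t / u) * (1 / u ^ k))
      ((∫ u in (Real.sqrt s)..1, h' u (s / u) * (1 / u ^ (k + 1))) -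
        h (Real.sqrt s) (Real.sqrt s) * (1 / Real.sqrt s ^ k) * (1 / (2 * Real.sqrt s))) s := by
  obtain ⟨hs0, hs1⟩ := hs
  have hr0 : 0 < Real.sqrt s := Real.sqrt_pos.2 hs0
  have hrr : Real.sqrt s * Real.sqrt s = s := Real.mul_self_sqrt hs0.le
  have hr1 : Real.sqrt s < 1 := by nlinarith
  have hsr : s < Real.sqrt s := by nlinarith
  set r := Real.sqrt s with hrdef
  obtain ⟨t2, ht2, ht2r⟩ := exists_between hsr
  obtain ⟨c, htc, hcr⟩ := exists_between ht2r
  have hmem : ∀ t ∈ Icc (s / 2) t2, ∀ u ∈ Icc c 1, 0 < u ∧ 0 < t / u ∧ t / u < 1 := by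
    intro t ht u hu
    have hu0 : 0 < u := by linarith [hu.1]
    have ht0 : 0 < t := by linarith [ht.1]
    exact ⟨hu0, by positivity, by rw [div_lt_one hu0]; linarith [ht.2, hu.1]⟩
  have hmaps : MapsTo (fun p : ℝ × ℝ => (p.2, p.1 / p.2)) (Icc (s / 2) t2 ×ˢ Icc c 1)
      (Icc 0 1 ×ˢ Icc 0 1) := by
    rintro ⟨t, u⟩ ⟨ht, hu⟩
    obtain ⟨a, b, d⟩ := hmem t ht u hu
    exact ⟨⟨a.le, hu.2⟩, ⟨b.le, d.le⟩⟩
  have hne : ∀ p ∈ Icc (s / 2) t2 ×ˢ Icc c 1, p.2 ≠ 0 := by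
    rintro ⟨t, u⟩ ⟨ht, hu⟩
    exact (hmem t ht u hu).1.ne'
  have hmc : ContinuousOn (fun p : ℝ × ℝ => (p.2, p.1 / p.2)) (Icc (s / 2) t2 ×ˢ Icc c 1) :=
    continuousOn_snd.prodMk (continuousOn_fst.div continuousOn_snd hne)
  have hpow : ∀ n : ℕ, ContinuousOn (fun p : ℝ × ℝ => 1 / p.2 ^ n)
      (Icc (s / 2) t2 ×ˢ Icc c 1) := fun n =>
    continuousOn_const.div (continuousOn_snd.pow n) (fun p hp => pow_ne_zero _ (hne p hp))
  have key := aux_leibniz (fun t u => h u (t / u) * (1 / u ^ k))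
    (fun t u => h' u (t / u) * (1 / u ^ (k + 1))) Real.sqrt (1 / (2 * r)) (s / 2) t2 c s
    ⟨by linarith, ht2⟩ ⟨hcr, hr1⟩ (Real.hasDerivAt_sqrt hs0.ne')
    ((hc.comp hmc hmaps).mul (hpow k)) ((hc'.comp hmc hmaps).mul (hpow (k + 1))) ?_
  · have : s / r = r := by rw [div_eq_iff hr0.ne', hrr]
    rw [← hrdef, this] at key
    exact key
  · intro t ht u hu
    obtain ⟨a, b, d⟩ := hmem t (Ioo_subset_Icc_self ht) u hu
    have h1 : HasDerivAt (fun y => h u y) (h' u (t / u)) (t / u) :=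
      (hd u ⟨a.le, hu.2⟩ _ ⟨b.le, d.le⟩).hasDerivAt (Icc_mem_nhds b d)
    have h2 : HasDerivAt (fun t => t / u) (1 / u) t := (hasDerivAt_id t).div_const u
    refine ((h1.comp t h2).mul_const (1 / u ^ k)).congr_deriv ?_
    field_simp
    ring

lemma aux_sym (g : ℝ → ℝ → ℝ)
    (hc : ContinuousOn (fun p : ℝ × ℝ => g p.1 p.2) (Icc 0 1 ×ˢ Icc 0 1))
    (t : ℝ) (ht : t ∈ Ioo (0:ℝ) 1) :
    ∫ u in t..1, g u (t / u) * (1 / u) =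
      ∫ u in (Real.sqrt t)..1, (g u (t / u) + g (t / u) u) * (1 / u ^ 1) := by
  obtain ⟨hs0, hs1⟩ := ht
  have hr0 : 0 < Real.sqrt t := Real.sqrt_pos.2 hs0
  have hrr : Real.sqrt t * Real.sqrt t = t := Real.mul_self_sqrt hs0.le
  have hr1 : Real.sqrt t < 1 := by nlinarith
  have hsr : t < Real.sqrt t := by nlinarith
  set r := Real.sqrt t with hrdef
  have htr : t / r = r := by rw [div_eq_iff hr0.ne', hrr]
  have hne : ∀ u ∈ Icc t 1, u ≠ 0 := fun u hu => (hs0.trans_le hu.1).ne'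
  have hdiv : ContinuousOn (fun u : ℝ => t / u) (Icc t 1) :=
    continuousOn_const.div continuousOn_id hne
  have hm : ∀ u ∈ Icc t 1, t / u ∈ Icc t 1 := by
    intro u hu
    have hu0 : 0 < u := hs0.trans_le hu.1
    constructor
    · rw [le_div_iff₀ hu0]; nlinarith [hu.2]
    · rw [div_le_one hu0]; exact hu.1
  have hsub : Icc t 1 ⊆ Icc 0 1 := Icc_subset_Icc_left hs0.le
  have hG : ContinuousOn (fun u => g u (t / u) * (1 / u)) (Icc t 1) :=
    (hc.comp (continuousOn_id.prodMk hdiv) (fun u hu => ⟨hsub hu, hsub (hm u hu)⟩)).mul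
      (continuousOn_const.div continuousOn_id hne)
  have hG2 : ContinuousOn (fun u => g (t / u) u * (1 / u)) (Icc t 1) :=
    (hc.comp (hdiv.prodMk continuousOn_id) (fun u hu => ⟨hsub (hm u hu), hsub hu⟩)).mul
      (continuousOn_const.div continuousOn_id hne)
  have hrI : r ∈ Icc t 1 := ⟨hsr.le, hr1.le⟩
  have htI : t ∈ Icc t 1 := ⟨le_rfl, hs1.le⟩
  have h1I : (1:ℝ) ∈ Icc t 1 := ⟨hs1.le, le_rfl⟩
  have hII : ∀ F : ℝ → ℝ, ContinuousOn F (Icc t 1) → ∀ a ∈ Icc t 1, ∀ b ∈ Icc t 1,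
      IntervalIntegrable F volume a b := fun F hF a ha b hb =>
    (hF.mono (uIcc_subset_Icc ha hb)).intervalIntegrable
  have hu1r : uIcc 1 r ⊆ Icc t 1 := uIcc_subset_Icc h1I hrI
  have hcv := intervalIntegral.integral_comp_mul_deriv' (a := 1) (b := r)
    (f := fun v => t / v) (f' := fun v => -t / v ^ 2) (g := fun u => g u (t / u) * (1 / u))
    (fun v hv => by
      have := (hasDerivAt_inv (hne v (hu1r hv))).const_mul t
      refine (this.congr_deriv ?_)
      have := hne v (hu1r hv)
      field_simp)
    (continuousOn_const.div (continuousOn_id.pow 2)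
      (fun v hv => pow_ne_zero _ (hne v (hu1r hv))))
    (hG.mono (by rintro _ ⟨v, hv, rfl⟩; exact hm v (hu1r hv)))
  simp only [div_one, htr] at hcv
  have hE : ∫ v in (1:ℝ)..r, ((fun u => g u (t / u) * (1 / u)) ∘ fun v => t / v) v * (-t / v ^ 2)
      = ∫ v in (1:ℝ)..r, -(g (t / v) v * (1 / v)) := by
    refine intervalIntegral.integral_congr fun v hv => ?_
    have hv0 := hne v (hu1r hv)
    have : t / (t / v) = v := by field_simp
    simp only [Function.comp, this]
    field_simp
  rw [hE, intervalIntegral.integral_neg, ← intervalIntegral.integral_symm] at hcv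
  rw [← intervalIntegral.integral_add_adjacent_intervals (hII _ hG _ htI _ hrI)
    (hII _ hG _ hrI _ h1I), ← hcv, ← intervalIntegral.integral_add (hII _ hG2 _ hrI _ h1I)
    (hII _ hG _ hrI _ h1I)]
  refine intervalIntegral.integral_congr fun v hv => ?_
  simp only [pow_one]
  ring

open Filter Topology in
lemma aux_diag (g g10 g01 : ℝ → ℝ → ℝ)
    (h1 : ∀ x ∈ Icc (0:ℝ) 1, ∀ y ∈ Icc (0:ℝ) 1,
      HasDerivWithinAt (fun t => g t y) (g10 x y) (Icc 0 1) x)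
    (h2 : ∀ x ∈ Icc (0:ℝ) 1, ∀ y ∈ Icc (0:ℝ) 1,
      HasDerivWithinAt (fun t => g x t) (g01 x y) (Icc 0 1) y)
    (hc10 : ContinuousOn (fun p : ℝ × ℝ => g10 p.1 p.2) (Icc 0 1 ×ˢ Icc 0 1))
    (hc01 : ContinuousOn (fun p : ℝ × ℝ => g01 p.1 p.2) (Icc 0 1 ×ˢ Icc 0 1))
    (r : ℝ) (hr : r ∈ Ioo (0:ℝ) 1) :
    HasDerivAt (fun t => g t t) (g10 r r + g01 r r) r := by
  have hn : (Ioo (0:ℝ) 1 ×ˢ Ioo (0:ℝ) 1) ∈ 𝓝 (r, r) :=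
    prod_mem_nhds (Ioo_mem_nhds hr.1 hr.2) (Ioo_mem_nhds hr.1 hr.2)
  have hn' : (Icc (0:ℝ) 1 ×ˢ Icc (0:ℝ) 1) ∈ 𝓝 (r, r) :=
    prod_mem_nhds (Icc_mem_nhds hr.1 hr.2) (Icc_mem_nhds hr.1 hr.2)
  have L : Continuous (fun a : ℝ => ContinuousLinearMap.toSpanSingleton ℝ a) :=
    (ContinuousLinearMap.toSpanSingletonCLE (𝕜 := ℝ) (E := ℝ)).continuous
  have key := hasStrictFDerivAt_uncurry_coprod (𝕜 := ℝ) (u := (r, r)) (f := g)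
    (f₁ := fun x y => ContinuousLinearMap.toSpanSingleton ℝ (g10 x y))
    (f₂ := fun x y => ContinuousLinearMap.toSpanSingleton ℝ (g01 x y))
    (by
      filter_upwards [hn] with v hv
      exact ((h1 _ (Ioo_subset_Icc_self hv.1) _ (Ioo_subset_Icc_self hv.2)).hasDerivAt
        (Icc_mem_nhds hv.1.1 hv.1.2)).hasFDerivAt)
    (by
      filter_upwards [hn] with v hv
      exact ((h2 _ (Ioo_subset_Icc_self hv.1) _ (Ioo_subset_Icc_self hv.2)).hasDerivAt
        (Icc_mem_nhds hv.2.1 hv.2.2)).hasFDerivAt)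
    (L.continuousAt.comp (hc10.continuousAt hn'))
    (L.continuousAt.comp (hc01.continuousAt hn'))
  have hd : HasDerivAt (fun t : ℝ => (t, t)) ((1:ℝ), (1:ℝ)) r :=
    (hasDerivAt_id r).prodMk (hasDerivAt_id r)
  have := HasFDerivAt.comp_hasDerivAt (f := fun t : ℝ => (t, t)) r key.hasFDerivAt hd
  refine (HasDerivAt.congr_deriv this ?_)
  simp [Function.HasUncurry.uncurry]

/-- The second-derivative formula for `ξ^g` from the proof of Lemma B.1 of the paper. -/
theorem stmt10
    (g g10 g01 g20 g11 g02 : ℝ → ℝ → ℝ)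
    (hdiff : ∀ x ∈ Icc (0:ℝ) 1, ∀ y ∈ Icc (0:ℝ) 1,
      HasDerivWithinAt (fun t => g t y) (g10 x y) (Icc 0 1) x ∧
      HasDerivWithinAt (fun t => g x t) (g01 x y) (Icc 0 1) y ∧
      HasDerivWithinAt (fun t => g10 t y) (g20 x y) (Icc 0 1) x ∧
      HasDerivWithinAt (fun t => g10 x t) (g11 x y) (Icc 0 1) y ∧
      HasDerivWithinAt (fun t => g01 x t) (g02 x y) (Icc 0 1) y)
    (hc : ContinuousOn (fun p : ℝ × ℝ => g p.1 p.2) (Icc 0 1 ×ˢ Icc 0 1))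
    (hc10 : ContinuousOn (fun p : ℝ × ℝ => g10 p.1 p.2) (Icc 0 1 ×ˢ Icc 0 1))
    (hc01 : ContinuousOn (fun p : ℝ × ℝ => g01 p.1 p.2) (Icc 0 1 ×ˢ Icc 0 1))
    (hc20 : ContinuousOn (fun p : ℝ × ℝ => g20 p.1 p.2) (Icc 0 1 ×ˢ Icc 0 1))
    (hc11 : ContinuousOn (fun p : ℝ × ℝ => g11 p.1 p.2) (Icc 0 1 ×ˢ Icc 0 1))
    (hc02 : ContinuousOn (fun p : ℝ × ℝ => g02 p.1 p.2) (Icc 0 1 ×ˢ Icc 0 1)) :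
    (∀ s ∈ Ioo (0:ℝ) 1,
      DifferentiableAt ℝ (fun t => ∫ u in t..1, g u (t / u) * (1 / u)) s) ∧
    ∀ s ∈ Ioo (0:ℝ) 1,
      HasDerivAt (deriv (fun t => ∫ u in t..1, g u (t / u) * (1 / u)))
        ((∫ u in Real.sqrt s..1, (g20 (s / u) u + g02 u (s / u)) * (1 / u ^ 3)) -
          (g10 (Real.sqrt s) (Real.sqrt s) + g01 (Real.sqrt s) (Real.sqrt s)) /
            (s * Real.sqrt s) +
          g (Real.sqrt s) (Real.sqrt s) / s ^ 2) s := by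
  have hswap : ContinuousOn (fun p : ℝ × ℝ => (p.2, p.1)) (Icc (0:ℝ) 1 ×ˢ Icc (0:ℝ) 1) := by
    fun_prop
  have hsm : MapsTo (fun p : ℝ × ℝ => (p.2, p.1)) (Icc (0:ℝ) 1 ×ˢ Icc (0:ℝ) 1)
      (Icc (0:ℝ) 1 ×ˢ Icc (0:ℝ) 1) := fun p hp => ⟨hp.2, hp.1⟩
  have D1 := aux_k (fun x y => g x y + g y x) (fun x y => g01 x y + g10 y x) 1
    (fun x hx y hy => (hdiff x hx y hy).2.1.add (hdiff y hy x hx).1)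
    (hc.add (hc.comp hswap hsm)) (hc01.add (hc10.comp hswap hsm))
  have D2 := aux_k (fun x y => g01 x y + g10 y x) (fun x y => g02 x y + g20 y x) 2
    (fun x hx y hy => (hdiff x hx y hy).2.2.2.2.add (hdiff y hy x hx).2.2.1)
    (hc01.add (hc10.comp hswap hsm)) (hc02.add (hc20.comp hswap hsm))
  have E : ∀ s ∈ Ioo (0:ℝ) 1, HasDerivAt (fun t => ∫ u in t..1, g u (t / u) * (1 / u))
      ((∫ u in (Real.sqrt s)..1, (g01 u (s / u) + g10 (s / u) u) * (1 / u ^ 2)) -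
        g (Real.sqrt s) (Real.sqrt s) / s) s := by
    intro s hs
    refine ((D1 s hs).congr_of_eventuallyEq ?_).congr_deriv ?_
    · filter_upwards [Ioo_mem_nhds hs.1 hs.2] with t ht
      exact aux_sym g hc t ht
    · have hr0 : 0 < Real.sqrt s := Real.sqrt_pos.2 hs.1
      have hrr : s = Real.sqrt s ^ 2 := (Real.sq_sqrt hs.1.le).symm
      congr 1
      generalize Real.sqrt s = r at *
      subst hrr
      field_simp
      ring
  refine ⟨fun s hs => (E s hs).differentiableAt, fun s hs => ?_⟩
  have hr0 : 0 < Real.sqrt s := Real.sqrt_pos.2 hs.1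
  have hrr : Real.sqrt s ^ 2 = s := Real.sq_sqrt hs.1.le
  have hr1 : Real.sqrt s < 1 := by nlinarith [hs.2]
  have G := (aux_diag g g10 g01 (fun x hx y hy => (hdiff x hx y hy).1)
    (fun x hx y hy => (hdiff x hx y hy).2.1) hc10 hc01 _ ⟨hr0, hr1⟩).comp s
    (Real.hasDerivAt_sqrt hs.1.ne')
  have T := (D2 s hs).sub (G.div (hasDerivAt_id s) hs.1.ne')
  refine (T.congr_of_eventuallyEq ?_).congr_deriv ?_
  · filter_upwards [Ioo_mem_nhds hs.1 hs.2] with t ht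
    exact (E t ht).deriv
  · have hI : ∫ u in (Real.sqrt s)..1, (g02 u (s / u) + g20 (s / u) u) * (1 / u ^ (2 + 1)) =
        ∫ u in (Real.sqrt s)..1, (g20 (s / u) u + g02 u (s / u)) * (1 / u ^ 3) :=
      intervalIntegral.integral_congr fun u _ => by simp only [add_comm (g02 _ _)]
    rw [hI]
    simp only [Function.comp, id]
    generalize (∫ u in (Real.sqrt s)..1, (g20 (s / u) u + g02 u (s / u)) * (1 / u ^ 3)) = I
    generalize Real.sqrt s = r at *
    subst hrr
    field_simp
    ring
end
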